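/- (Katz–Zahl planebrush estimate) Let K ≥ 1. For every ε > 0 there exists C_ε > 0 (depending only on K, ε) such that the following holds for all δ ∈ (0,1): let 𝕋 be a family of δ-tubes in ℝ⁴ pointing in δ-separated directions with δ^{−3}/K ≤ #𝕋 ≤ K δ^{−3}, and suppose that for each point x ∈ ⋃_{T∈𝕋} T there is an affine 2-plane H_x ⊆ ℝ⁴ such that every tube T ∈ 𝕋 containing x is contained in the (Kδ)-neighborhood of H_x. Then |⋃_{T∈𝕋} T| ≥ C_ε⁻¹ δ^ε · δ^{2/3}. -/

import Mathlib

open MeasureTheory Metric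

/-- A `δ`-tube in `ℝ⁴`: the closed `δ`-neighborhood of the unit line segment from
`x` to `x + e` (where `‖e‖ = 1`). -/
noncomputable def tube (δ : ℝ) (x e : EuclideanSpace ℝ (Fin 4)) :
    Set (EuclideanSpace ℝ (Fin 4)) :=
  cthickening δ (segment ℝ x (x + e))

namespace Planebrush

open Matrix Finset

/-- Horizontal space: `ℝ³` with the sup norm. -/
abbrev V3 : Type := Fin 3 → ℝ

theorem abs_apply_le_norm (x : V3) (k : Fin 3) : |x k| ≤ ‖x‖ := by
  simpa using norm_le_pi_norm x k

theorem norm_cross_le (x y : V3) : ‖x ⨯₃ y‖ ≤ 2 * ‖x‖ * ‖y‖ := by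
  have key : ∀ a b c d : Fin 3, |x a * y b - x c * y d| ≤ 2 * ‖x‖ * ‖y‖ := by
    intro a b c d
    have h1 : |x a * y b| ≤ ‖x‖ * ‖y‖ := by
      rw [abs_mul]
      exact mul_le_mul (abs_apply_le_norm x a) (abs_apply_le_norm y b) (abs_nonneg _)
        (norm_nonneg _)
    have h2 : |x c * y d| ≤ ‖x‖ * ‖y‖ := by
      rw [abs_mul]
      exact mul_le_mul (abs_apply_le_norm x c) (abs_apply_le_norm y d) (abs_nonneg _)
        (norm_nonneg _)
    have h3 := abs_sub (x a * y b) (x c * y d)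
    linarith
  rw [pi_norm_le_iff_of_nonneg (by positivity)]
  intro k
  rw [cross_apply, Real.norm_eq_abs]
  fin_cases k
  · exact key 1 2 2 1
  · exact key 2 0 0 2
  · exact key 0 1 1 0

theorem abs_dotProduct_le (x y : V3) : |x ⬝ᵥ y| ≤ 3 * ‖x‖ * ‖y‖ := by
  have key : ∀ a : Fin 3, |x a * y a| ≤ ‖x‖ * ‖y‖ := by
    intro a
    rw [abs_mul]
    exact mul_le_mul (abs_apply_le_norm x a) (abs_apply_le_norm y a) (abs_nonneg _)
      (norm_nonneg _)
  rw [vec3_dotProduct]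
  have h1 := abs_add_three (x 0 * y 0) (x 1 * y 1) (x 2 * y 2)
  linarith [key 0, key 1, key 2]

theorem norm_le_one_of_dotProduct_self {u : V3} (hu : u ⬝ᵥ u = 1) : ‖u‖ ≤ 1 := by
  rw [pi_norm_le_iff_of_nonneg zero_le_one]
  intro k
  rw [vec3_dotProduct] at hu
  rw [Real.norm_eq_abs, abs_le_one_iff_mul_self_le_one]
  fin_cases k <;> simp <;> nlinarith [mul_self_nonneg (u 0), mul_self_nonneg (u 1),
    mul_self_nonneg (u 2)]

theorem dotProduct_self_le (x : V3) : x ⬝ᵥ x ≤ 3 * ‖x‖ ^ 2 := by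
  have := abs_dotProduct_le x x
  have h2 := le_abs_self (x ⬝ᵥ x)
  nlinarith

theorem norm_sq_le_dotProduct_self (x : V3) : ‖x‖ ^ 2 ≤ x ⬝ᵥ x := by
  have h : ‖x‖ ≤ √(x ⬝ᵥ x) := by
    rw [pi_norm_le_iff_of_nonneg (Real.sqrt_nonneg _)]
    intro k
    rw [Real.norm_eq_abs]
    apply Real.abs_le_sqrt
    rw [vec3_dotProduct]
    fin_cases k <;> simp <;> nlinarith [mul_self_nonneg (x 0), mul_self_nonneg (x 1),
      mul_self_nonneg (x 2)]
  have h0 : 0 ≤ x ⬝ᵥ x := by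
    rw [vec3_dotProduct]
    nlinarith [mul_self_nonneg (x 0), mul_self_nonneg (x 1), mul_self_nonneg (x 2)]
  calc ‖x‖ ^ 2 ≤ √(x ⬝ᵥ x) ^ 2 := by gcongr
    _ = _ := Real.sq_sqrt h0

theorem dotProduct_self_nonneg' (x : V3) : 0 ≤ x ⬝ᵥ x :=
  (sq_nonneg _).trans (norm_sq_le_dotProduct_self x)

/-- Cauchy–Schwarz in `ℝ³`. -/
theorem dotProduct_sq_le (x y : V3) : (x ⬝ᵥ y) ^ 2 ≤ (x ⬝ᵥ x) * (y ⬝ᵥ y) := by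
  have h := cross_dot_cross x y x y
  have h0 := dotProduct_self_nonneg' (x ⨯₃ y)
  rw [dotProduct_comm y x] at h
  nlinarith

/-- Parseval for an orthonormal frame `u`, `n`, `n × u`. -/
theorem dotProduct_self_eq_of_frame (x u n : V3) (hu : u ⬝ᵥ u = 1) (hn : n ⬝ᵥ n = 1)
    (hun : u ⬝ᵥ n = 0) :
    x ⬝ᵥ x = (x ⬝ᵥ u) ^ 2 + (x ⬝ᵥ n) ^ 2 + (x ⬝ᵥ n ⨯₃ u) ^ 2 := by
  have h : (x ⬝ᵥ n ⨯₃ u) ^ 2 = (x ⬝ᵥ x) * ((n ⬝ᵥ n) * (u ⬝ᵥ u) - (u ⬝ᵥ n) ^ 2)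
      - (x ⬝ᵥ n) ^ 2 * (u ⬝ᵥ u) - (x ⬝ᵥ u) ^ 2 * (n ⬝ᵥ n)
      + 2 * (x ⬝ᵥ n) * (x ⬝ᵥ u) * (u ⬝ᵥ n) := by
    simp only [cross_apply, vec3_dotProduct]
    dsimp only [Matrix.cons_val]
    ring
  rw [h, hu, hn, hun]
  ring

theorem norm_cross_comm (x y : V3) : ‖x ⨯₃ y‖ = ‖y ⨯₃ x‖ := by
  rw [← cross_anticomm, norm_neg]

/-- The angle between unit vectors satisfies a triangle inequality up to a constant. -/
theorem norm_cross_triangle {x y z : V3} (hx : x ⬝ᵥ x = 1) (hy : y ⬝ᵥ y = 1) (hz : z ⬝ᵥ z = 1) :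
    ‖z ⨯₃ x‖ ≤ 9 * (‖y ⨯₃ x‖ + ‖z ⨯₃ y‖) := by
  have h : (y ⬝ᵥ y) • (z ⨯₃ x) = (z ⬝ᵥ y) • (y ⨯₃ x) + (x ⬝ᵥ y) • (z ⨯₃ y)
      + (x ⬝ᵥ (y ⨯₃ z)) • y := by
    simp only [cross_apply, vec3_dotProduct]
    ext k
    fin_cases k <;> simp <;> ring
  rw [hy, one_smul] at h
  rw [h]
  have nx := norm_le_one_of_dotProduct_self hx
  have ny := norm_le_one_of_dotProduct_self hy
  have nz := norm_le_one_of_dotProduct_self hz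
  have aux : ∀ p q : V3, ‖p‖ ≤ 1 → |p ⬝ᵥ q| ≤ 3 * ‖q‖ := fun p q hp => by
    have := abs_dotProduct_le p q
    nlinarith [norm_nonneg q]
  have h1 : ‖(z ⬝ᵥ y) • (y ⨯₃ x)‖ ≤ 3 * ‖y ⨯₃ x‖ := by
    rw [norm_smul, Real.norm_eq_abs]
    have := aux z y nz
    gcongr
    linarith
  have h2 : ‖(x ⬝ᵥ y) • (z ⨯₃ y)‖ ≤ 3 * ‖z ⨯₃ y‖ := by
    rw [norm_smul, Real.norm_eq_abs]
    have := aux x y nx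
    gcongr
    linarith
  have h3 : ‖(x ⬝ᵥ (y ⨯₃ z)) • y‖ ≤ 3 * ‖z ⨯₃ y‖ := by
    rw [norm_smul, Real.norm_eq_abs, norm_cross_comm z y]
    have := aux x (y ⨯₃ z) nx
    nlinarith [norm_nonneg (y ⨯₃ z), abs_nonneg (x ⬝ᵥ (y ⨯₃ z)), norm_nonneg y]
  have := norm_add₃_le (a := (z ⬝ᵥ y) • (y ⨯₃ x)) (b := (x ⬝ᵥ y) • (z ⨯₃ y))
    (c := (x ⬝ᵥ (y ⨯₃ z)) • y)
  linarith [norm_nonneg (y ⨯₃ x), norm_nonneg (z ⨯₃ y)]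

/-- A quadruple-product inequality: four unit vectors, of which consecutive triples nearly lie
in a plane. -/
theorem abs_det_mul_norm_cross_le (w x y z : V3) :
    |z ⬝ᵥ (w ⨯₃ x)| * ‖y ⨯₃ x‖ ≤
      |y ⬝ᵥ (w ⨯₃ x)| * ‖z ⨯₃ x‖ + |z ⬝ᵥ (x ⨯₃ y)| * ‖w ⨯₃ x‖ := by
  have h : (z ⬝ᵥ (w ⨯₃ x)) • (y ⨯₃ x) =
      (y ⬝ᵥ (w ⨯₃ x)) • (z ⨯₃ x) - (z ⬝ᵥ (x ⨯₃ y)) • (w ⨯₃ x) := by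
    simp only [cross_apply, vec3_dotProduct]
    ext k
    fin_cases k <;> simp <;> ring
  have h1 := congrArg norm h
  rw [norm_smul, Real.norm_eq_abs] at h1
  rw [h1]
  refine (norm_sub_le _ _).trans ?_
  rw [norm_smul, norm_smul, Real.norm_eq_abs, Real.norm_eq_abs]

/-- Vectors nearly parallel to both `u` and `z` are short when `u` and `z` are transverse. -/
theorem abs_dotProduct_mul_norm_cross_le {u z : V3} (hu : u ⬝ᵥ u = 1) (hz : z ⬝ᵥ z = 1) (v : V3) :
    |v ⬝ᵥ u| * ‖u ⨯₃ z‖ ≤ ‖v ⨯₃ z‖ + 4 * ‖v ⨯₃ u‖ := by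
  have h : (v ⬝ᵥ u) • (u ⨯₃ z) = (u ⬝ᵥ u) • (v ⨯₃ z) - (u ⨯₃ (v ⨯₃ u)) ⨯₃ z := by
    simp only [cross_apply, vec3_dotProduct]
    ext k
    fin_cases k <;> simp <;> ring
  rw [hu, one_smul] at h
  have h1 := congrArg norm h
  rw [norm_smul, Real.norm_eq_abs] at h1
  rw [h1]
  refine (norm_sub_le _ _).trans ?_
  have nu := norm_le_one_of_dotProduct_self hu
  have nz := norm_le_one_of_dotProduct_self hz
  have h2 := norm_cross_le (u ⨯₃ (v ⨯₃ u)) z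
  have h3 := norm_cross_le u (v ⨯₃ u)
  have h4 : ‖u ⨯₃ (v ⨯₃ u)‖ ≤ 2 * ‖v ⨯₃ u‖ := by nlinarith [norm_nonneg (v ⨯₃ u)]
  nlinarith [norm_nonneg (u ⨯₃ (v ⨯₃ u))]

/-- A vector is controlled by its component along a unit vector and its cross product with it. -/
theorem norm_le_abs_dotProduct_add {u : V3} (hu : u ⬝ᵥ u = 1) (v : V3) :
    ‖v‖ ≤ |v ⬝ᵥ u| + 2 * ‖v ⨯₃ u‖ := by
  have h : (u ⬝ᵥ u) • v = (v ⬝ᵥ u) • u + u ⨯₃ (v ⨯₃ u) := by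
    simp only [cross_apply, vec3_dotProduct]
    ext k
    fin_cases k <;> simp <;> ring
  rw [hu, one_smul] at h
  have nu := norm_le_one_of_dotProduct_self hu
  have h1 := norm_add_le ((v ⬝ᵥ u) • u) (u ⨯₃ (v ⨯₃ u))
  rw [← h, norm_smul, Real.norm_eq_abs] at h1
  have h3 := norm_cross_le u (v ⨯₃ u)
  nlinarith [norm_nonneg (v ⨯₃ u), abs_nonneg (v ⬝ᵥ u)]

section Packing

variable {ι : Type*}

theorem card_Icc_floor_le {x r : ℝ} (hx : 0 ≤ x) (hr : 0 < r) :
    ((Icc ⌊-x / r⌋ ⌊x / r⌋).card : ℝ) ≤ 2 * x / r + 2 := by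
  have h0 : 0 ≤ x / r := by positivity
  have h1 : ⌊-x / r⌋ ≤ ⌊x / r⌋ + 1 := by
    have : -x / r ≤ x / r := by rw [neg_div]; linarith
    have := Int.floor_le_floor this
    omega
  rw [Int.card_Icc]
  have h2 : ((⌊x / r⌋ + 1 - ⌊-x / r⌋).toNat : ℤ) = ⌊x / r⌋ + 1 - ⌊-x / r⌋ :=
    Int.toNat_of_nonneg (by omega)
  have h3 : ((⌊x / r⌋ + 1 - ⌊-x / r⌋).toNat : ℝ) = ⌊x / r⌋ + 1 - ⌊-x / r⌋ := by
    exact_mod_cast h2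
  rw [h3]
  have h4 := Int.floor_le (x / r)
  have h5 := Int.lt_floor_add_one (-x / r)
  have h6 : -x / r = -(x / r) := neg_div _ _
  have h7 : 2 * x / r = 2 * (x / r) := by ring
  rw [h7]
  rw [h6] at h5 ⊢
  linarith

/-- Number of cells of a grid met by a separated set contained in a box. -/
theorem card_le_of_box (S : Finset ι) (f : Fin 3 → ι → ℝ) (A r : Fin 3 → ℝ)
    (hr : ∀ k, 0 < r k) (hA : ∀ k, 0 ≤ A k) (hf : ∀ i ∈ S, ∀ k, |f k i| ≤ A k)
    (hsep : ∀ i ∈ S, ∀ j ∈ S, (∀ k, |f k i - f k j| < r k) → i = j) :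
    (S.card : ℝ) ≤ (2 * A 0 / r 0 + 2) * (2 * A 1 / r 1 + 2) * (2 * A 2 / r 2 + 2) := by
  classical
  set B : Finset (Fin 3 → ℤ) := Fintype.piFinset fun k => Icc ⌊-A k / r k⌋ ⌊A k / r k⌋
  have hcard : S.card ≤ B.card := by
    refine card_le_card_of_injOn (fun i k => ⌊f k i / r k⌋) ?_ ?_
    · intro i hi
      refine Finset.mem_coe.2 (Fintype.mem_piFinset.2 fun k => Finset.mem_Icc.2 ?_)
      have h := abs_le.1 (hf i hi k)
      have := (hr k).le
      exact ⟨Int.floor_le_floor (by gcongr; exact h.1), Int.floor_le_floor (by gcongr; exact h.2)⟩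
    · intro i hi j hj hij
      refine hsep i hi j hj fun k => ?_
      have h := congrFun hij k
      have h2 := Int.abs_sub_lt_one_of_floor_eq_floor h
      rw [← sub_div, abs_div, abs_of_pos (hr k), div_lt_one (hr k)] at h2
      exact h2
  have hB : (B.card : ℝ) = ((Icc ⌊-A 0 / r 0⌋ ⌊A 0 / r 0⌋).card : ℝ) *
      ((Icc ⌊-A 1 / r 1⌋ ⌊A 1 / r 1⌋).card : ℝ) * ((Icc ⌊-A 2 / r 2⌋ ⌊A 2 / r 2⌋).card : ℝ) := by
    simp only [B, Fintype.card_piFinset, Fin.prod_univ_three]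
    push_cast
    ring
  calc (S.card : ℝ) ≤ B.card := by exact_mod_cast hcard
    _ ≤ _ := by
      rw [hB]
      have h := fun k => card_Icc_floor_le (hA k) (hr k)
      have h0 : ∀ k, 0 ≤ 2 * A k / r k := fun k => by
        have := hA k; have := hr k; positivity
      have := h0 0; have := h0 1
      gcongr
      · exact h 0
      · exact h 1
      · exact h 2

/-- Packing in a ball. -/
theorem card_le_of_ball {S : Finset ι} {v : ι → V3} {c : V3} {δ R : ℝ} (hδ : 0 < δ) (hR : 0 ≤ R)
    (hsep : ∀ i ∈ S, ∀ j ∈ S, i ≠ j → δ ≤ ‖v i - v j‖) (hb : ∀ i ∈ S, ‖v i - c‖ ≤ R) :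
    (S.card : ℝ) ≤ (2 * R / δ + 2) ^ 3 := by
  have := card_le_of_box S (fun k i => (v i - c) k) (fun _ => R) (fun _ => δ) (fun _ => hδ)
    (fun _ => hR) (fun i hi k => (abs_apply_le_norm _ k).trans (hb i hi)) ?_
  · calc _ ≤ _ := this
      _ = _ := by ring
  · intro i hi j hj h
    by_contra hne
    have h1 := hsep i hi j hj hne
    have : ‖v i - v j‖ < δ := by
      rw [pi_norm_lt_iff hδ]
      intro k
      have := h k
      simpa [Real.norm_eq_abs] using this
    linarith

/-- Packing in a slab around a plane and a line: the box is long in the direction `u`, has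
width `A₂` around `u`, and height governed by the normal direction `w = u' × u`. -/
theorem card_le_of_slab {S : Finset ι} {v : ι → V3} {c u u' : V3} {δ A₁ A₂ A₃ ω : ℝ}
    (hδ : 0 < δ) (hA₁ : 0 ≤ A₁) (hA₂ : 0 ≤ A₂) (hA₃ : 0 ≤ A₃) (hω : 0 < ω)
    (hu : u ⬝ᵥ u = 1) (hw : ω ≤ ‖u' ⨯₃ u‖)
    (hsep : ∀ i ∈ S, ∀ j ∈ S, i ≠ j → δ ≤ ‖v i - v j‖)
    (h₁ : ∀ i ∈ S, ‖v i - c‖ ≤ A₁) (h₂ : ∀ i ∈ S, ‖(v i - c) ⨯₃ u‖ ≤ A₂)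
    (h₃ : ∀ i ∈ S, |(v i - c) ⬝ᵥ (u' ⨯₃ u)| ≤ A₃) :
    (S.card : ℝ) ≤ (12 * A₁ / δ + 2) * (8 * A₂ / δ + 2) * (4 * A₃ / (ω * δ) + 2) := by
  set w := u' ⨯₃ u with hwdef
  set l := √(w ⬝ᵥ w) with hl
  have hlw : l ^ 2 = w ⬝ᵥ w := Real.sq_sqrt (dotProduct_self_nonneg' w)
  have hωl : ω ≤ l := by
    refine hw.trans (Real.le_sqrt_of_sq_le (norm_sq_le_dotProduct_self w))
  have hlpos : 0 < l := hω.trans_le hωl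
  set n := l⁻¹ • w with hn
  have hnn : n ⬝ᵥ n = 1 := by
    rw [hn, smul_dotProduct, dotProduct_smul, ← hlw, smul_eq_mul, smul_eq_mul]
    field_simp
  have hun : u ⬝ᵥ n = 0 := by
    rw [hn, dotProduct_smul, hwdef, dot_cross_self, smul_zero]
  have nu := norm_le_one_of_dotProduct_self hu
  have hframe := fun x => dotProduct_self_eq_of_frame x u n hu hnn hun
  have := card_le_of_box S
    ![fun i => (v i - c) ⬝ᵥ u, fun i => (v i - c) ⬝ᵥ n ⨯₃ u, fun i => (v i - c) ⬝ᵥ n]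
    ![3 * A₁, 2 * A₂, A₃ / ω] ![δ / 2, δ / 2, δ / 2] ?_ ?_ ?_ ?_
  · refine this.trans (le_of_eq ?_)
    simp only [Matrix.cons_val]
    field_simp
    ring
  · intro k; fin_cases k <;> simp [hδ]
  · intro k; fin_cases k <;> simp <;> positivity
  · intro i hi k
    fin_cases k
    · simp only [Fin.zero_eta, Matrix.cons_val]
      have := abs_dotProduct_le (v i - c) u
      have := h₁ i hi
      nlinarith [norm_nonneg (v i - c), norm_nonneg u]
    · simp only [Fin.mk_one, Matrix.cons_val]
      have e : (v i - c) ⬝ᵥ n ⨯₃ u = - (n ⬝ᵥ ((v i - c) ⨯₃ u)) := by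
        rw [triple_product_permutation, ← cross_anticomm, dotProduct_neg]
      rw [e, abs_neg]
      have h := dotProduct_sq_le n ((v i - c) ⨯₃ u)
      rw [hnn, one_mul] at h
      have h' := dotProduct_self_le ((v i - c) ⨯₃ u)
      have h2 := h₂ i hi
      apply abs_le_of_sq_le_sq _ (by positivity)
      nlinarith [norm_nonneg ((v i - c) ⨯₃ u)]
    · simp only [Fin.reduceFinMk, Matrix.cons_val]
      rw [hn, dotProduct_smul, smul_eq_mul, abs_mul, abs_inv, abs_of_pos hlpos,
        inv_mul_eq_div]
      have := h₃ i hi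
      gcongr
  · intro i hi j hj h
    by_contra hne
    have hs := hsep i hi j hj hne
    have e0 := h 0
    have e1 := h 1
    have e2 := h 2
    simp only [Matrix.cons_val, ← sub_dotProduct, sub_sub_sub_cancel_right] at e0 e1 e2
    have hf := hframe (v i - v j)
    have hd := norm_sq_le_dotProduct_self (v i - v j)
    have q0 := sq_lt_sq' (abs_lt.1 e0).1 (abs_lt.1 e0).2
    have q1 := sq_lt_sq' (abs_lt.1 e1).1 (abs_lt.1 e1).2
    have q2 := sq_lt_sq' (abs_lt.1 e2).1 (abs_lt.1 e2).2
    nlinarith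

/-- Packing near a line. -/
theorem card_le_of_line {S : Finset ι} {v : ι → V3} {c u : V3} {δ A₁ A₂ : ℝ}
    (hδ : 0 < δ) (hA₁ : 0 ≤ A₁) (hA₂ : 0 ≤ A₂) (hu : u ⬝ᵥ u = 1)
    (hsep : ∀ i ∈ S, ∀ j ∈ S, i ≠ j → δ ≤ ‖v i - v j‖)
    (h₁ : ∀ i ∈ S, ‖v i - c‖ ≤ A₁) (h₂ : ∀ i ∈ S, ‖(v i - c) ⨯₃ u‖ ≤ A₂) :
    (S.card : ℝ) ≤ (12 * A₁ / δ + 2) * (8 * A₂ / δ + 2) ^ 2 := by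
  obtain ⟨k, hk⟩ : ∃ k : Fin 3, 1 / 2 ≤ ‖(Pi.single k 1 : V3) ⨯₃ u‖ := by
    by_contra! hcon
    have key : ∀ k l : Fin 3, |((Pi.single k 1 : V3) ⨯₃ u) l| < 1 / 2 := fun k l =>
      (abs_apply_le_norm _ l).trans_lt (hcon k)
    have a0 := key 0 2
    have a1 := key 1 0
    have a2 := key 1 2
    rw [vec3_dotProduct] at hu
    simp [cross_apply] at a0 a1 a2
    have b0 := sq_lt_sq' (abs_lt.1 a0).1 (abs_lt.1 a0).2
    have b1 := sq_lt_sq' (abs_lt.1 a1).1 (abs_lt.1 a1).2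
    have b2 := sq_lt_sq' (abs_lt.1 a2).1 (abs_lt.1 a2).2
    nlinarith
  have := card_le_of_slab (A₃ := A₂) hδ hA₁ hA₂ hA₂ (by norm_num : (0 : ℝ) < 1 / 2) hu hk hsep
    h₁ h₂ ?_
  · refine this.trans (le_of_eq ?_)
    field_simp
    ring
  · intro i hi
    have e : (v i - c) ⬝ᵥ (Pi.single k 1 : V3) ⨯₃ u = -((v i - c) ⨯₃ u) k := by
      rw [triple_product_permutation, ← cross_anticomm, dotProduct_neg, single_dotProduct, one_mul]
    rw [e, abs_neg]
    exact (abs_apply_le_norm _ k).trans (h₂ i hi)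

/-- Number of integers in an interval. -/
theorem card_nat_le_of_interval {S : Finset ℕ} {c R : ℝ} (hR : 0 ≤ R)
    (h : ∀ k ∈ S, |(k : ℝ) - c| ≤ R) : (S.card : ℝ) ≤ 2 * R + 2 := by
  classical
  have hcard : S.card ≤ (Icc ⌊-R / 1⌋ ⌊R / 1⌋).card := by
    refine card_le_card_of_injOn (fun k => ⌊(k : ℝ) - c⌋) ?_ ?_
    · intro k hk
      have hk' := abs_le.1 (h k hk)
      refine Finset.mem_coe.2 (Finset.mem_Icc.2 ⟨Int.floor_le_floor ?_, Int.floor_le_floor ?_⟩)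
      · linarith
      · linarith
    · intro i hi j hj hij
      have h2 := Int.abs_sub_lt_one_of_floor_eq_floor hij
      rw [sub_sub_sub_cancel_right] at h2
      have h1 : |(i : ℤ) - j| < 1 := by exact_mod_cast h2
      rw [Int.abs_lt_one_iff] at h1
      omega
  have h1 := card_Icc_floor_le hR one_pos
  have h2 : (S.card : ℝ) ≤ (Icc ⌊-R / 1⌋ ⌊R / 1⌋).card := by exact_mod_cast hcard
  linarith

end Packing

end Planebrush

namespace Planebrush

open Finset

section Markov

/-- The contraction used to pigeonhole scales. -/
noncomputable def sqShrink (r : ℝ) : ℝ := r ^ 2 / 16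

/-- The square of the `n`-fold iterate of `sqShrink`. -/
noncomputable def sqShrinkIter (n : ℕ) (r : ℝ) : ℝ := (sqShrink^[n] r) ^ 2 / 16

/-- The probability with which one finds paths of pigeonholed type among `n` scales. -/
noncomputable def pathConst (n : ℕ) : ℝ := sqShrink^[n] ((sqShrinkIter n)^[n] 1)

theorem exists_jump {n : ℕ} {Φ : ℝ → ℝ} (hmono : ∀ x y, 0 ≤ x → x ≤ y → y ≤ 1 → Φ x ≤ Φ y)
    (hpos : ∀ x, 0 < x → x ≤ 1 → 0 < Φ x) (hle : ∀ x, 0 < x → x ≤ 1 → Φ x ≤ x)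
    {p : ℕ → ℝ} (hp0 : p 0 ≤ 0) (hp1 : ∀ k, p k ≤ 1) {r : ℝ} (hr : 0 < r) (hpn : r ≤ p n) :
    ∃ k < n, p k ≤ Φ (p (k + 1)) ∧ Φ^[n] r ≤ p (k + 1) := by
  induction n generalizing r with
  | zero => linarith
  | succ n ih =>
    have hr1 : r ≤ 1 := hpn.trans (hp1 _)
    have hiter : ∀ m, ∀ s, 0 < s → s ≤ 1 → Φ^[m] s ≤ s := by
      intro m
      induction m with
      | zero => intro s _ _; simp
      | succ m ihm =>
        intro s hs hs1
        rw [Function.iterate_succ_apply]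
        have := hle s hs hs1
        exact (ihm _ (hpos s hs hs1) (by linarith)).trans this
    by_cases h : p n ≤ Φ (p (n + 1))
    · exact ⟨n, Nat.lt_succ_self n, h, (hiter _ r hr hr1).trans hpn⟩
    · push Not at h
      have h2 : Φ r ≤ p n := (hmono r _ hr.le hpn (hp1 _)).trans h.le
      obtain ⟨k, hk, h3, h4⟩ := ih (hpos r hr hr1) h2
      exact ⟨k, by omega, h3, by rwa [Function.iterate_succ_apply]⟩

theorem sqShrink_mono {x y : ℝ} (hx : 0 ≤ x) (hxy : x ≤ y) : sqShrink x ≤ sqShrink y := by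
  unfold sqShrink; gcongr

theorem sqShrink_pos {x : ℝ} (hx : 0 < x) : 0 < sqShrink x := by
  unfold sqShrink; positivity

theorem sqShrink_le {x : ℝ} (hx : 0 ≤ x) (hx1 : x ≤ 1) : sqShrink x ≤ x := by
  unfold sqShrink; nlinarith

theorem sqShrink_iterate (n : ℕ) :
    (∀ x, 0 < x → 0 < sqShrink^[n] x) ∧ (∀ x, 0 < x → x ≤ 1 → sqShrink^[n] x ≤ x) ∧
      (∀ x y, 0 ≤ x → x ≤ y → 0 ≤ sqShrink^[n] x ∧ sqShrink^[n] x ≤ sqShrink^[n] y) := by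
  induction n with
  | zero => exact ⟨fun _ h => h, fun _ _ _ => le_rfl, fun _ _ h h' => ⟨h, h'⟩⟩
  | succ n ih =>
    obtain ⟨h1, h2, h3⟩ := ih
    refine ⟨fun x hx => ?_, fun x hx hx1 => ?_, fun x y hx hxy => ?_⟩
    · rw [Function.iterate_succ_apply]; exact h1 _ (sqShrink_pos hx)
    · rw [Function.iterate_succ_apply]
      have := sqShrink_le hx.le hx1
      exact (h2 _ (sqShrink_pos hx) (by linarith)).trans this
    · rw [Function.iterate_succ_apply, Function.iterate_succ_apply]
      exact h3 _ _ (by unfold sqShrink; positivity) (sqShrink_mono hx hxy)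

theorem sqShrinkIter_mono (n : ℕ) (x y : ℝ) (hx : 0 ≤ x) (hxy : x ≤ y) :
    sqShrinkIter n x ≤ sqShrinkIter n y := by
  obtain ⟨h, h'⟩ := (sqShrink_iterate n).2.2 x y hx hxy
  unfold sqShrinkIter; gcongr

theorem sqShrinkIter_pos (n : ℕ) (x : ℝ) (hx : 0 < x) : 0 < sqShrinkIter n x := by
  have := (sqShrink_iterate n).1 x hx
  unfold sqShrinkIter; positivity

theorem sqShrinkIter_le (n : ℕ) (x : ℝ) (hx : 0 < x) (hx1 : x ≤ 1) : sqShrinkIter n x ≤ x := by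
  have h := (sqShrink_iterate n).1 x hx
  have h' := (sqShrink_iterate n).2.1 x hx hx1
  unfold sqShrinkIter
  nlinarith

theorem pathConst_pos (n : ℕ) : 0 < pathConst n := by
  have h : ∀ m, ∀ x, 0 < x → 0 < (sqShrinkIter n)^[m] x := by
    intro m
    induction m with
    | zero => simp
    | succ m ih =>
      intro x hx
      rw [Function.iterate_succ_apply]
      exact ih _ (sqShrinkIter_pos n x hx)
  exact (sqShrink_iterate n).1 _ (h n 1 one_pos)

variable {α β : Type*} {P : Finset α} {E : Finset β} {tgt : β → α} {w : α → β → ℝ}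

/-- Averaging against the transition weights. -/
def avg (E : Finset β) (w : α → β → ℝ) (x : α) (f : β → ℝ) : ℝ := ∑ e ∈ E, w x e * f e

theorem avg_mono (hw : ∀ x e, 0 ≤ w x e) {x : α} {f g : β → ℝ} (h : ∀ e ∈ E, f e ≤ g e) :
    avg E w x f ≤ avg E w x g :=
  sum_le_sum fun e he => mul_le_mul_of_nonneg_left (h e he) (hw x e)

theorem avg_nonneg (hw : ∀ x e, 0 ≤ w x e) {x : α} {f : β → ℝ} (h : ∀ e ∈ E, 0 ≤ f e) :
    0 ≤ avg E w x f :=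
  sum_nonneg fun e he => mul_nonneg (hw x e) (h e he)

theorem avg_add {x : α} {f g : β → ℝ} :
    avg E w x (fun e => f e + g e) = avg E w x f + avg E w x g := by
  simp only [avg, mul_add, sum_add_distrib]

theorem avg_const {x : α} (hx : ∑ e ∈ E, w x e = 1) (c : ℝ) : avg E w x (fun _ => c) = c := by
  simp only [avg, ← sum_mul, hx, one_mul]

theorem avg_congr {x : α} {f g : β → ℝ} (h : ∀ e ∈ E, f e = g e) :
    avg E w x f = avg E w x g :=
  sum_congr rfl fun e he => by rw [h e he]

theorem avg_mul_left {x : α} {f : β → ℝ} (c : ℝ) :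
    avg E w x (fun e => c * f e) = c * avg E w x f := by
  simp only [avg, mul_sum]
  exact sum_congr rfl fun e _ => by ring

theorem avg_mul_right {x : α} {f : β → ℝ} (c : ℝ) :
    avg E w x (fun e => f e * c) = avg E w x f * c := by
  simp only [avg, sum_mul]
  exact sum_congr rfl fun e _ => by ring

theorem sum_avg_stationary (hrow : ∀ x ∈ P, ∑ e ∈ E, w x e = 1)
    (hsymm : ∀ h : α → α → ℝ, ∑ x ∈ P, avg E w x (fun e => h x (tgt e)) =
      ∑ x ∈ P, avg E w x (fun e => h (tgt e) x)) (f : α → ℝ) :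
    ∑ x ∈ P, avg E w x (fun e => f (tgt e)) = ∑ x ∈ P, f x := by
  rw [hsymm fun _ y => f y]
  exact sum_congr rfl fun x hx => avg_const (hrow x hx) _

open Classical in
/-- Pigeonholing of a reversible random walk: one finds a starting point from which a positive
proportion of two-step paths have pigeonholed angles `th` and determinants `D`, and such that an
additional backwards step has the same type. -/
theorem exists_typical_paths (n : ℕ) (hP : P.Nonempty) (htgt : ∀ e ∈ E, tgt e ∈ P)
    (hw : ∀ x e, 0 ≤ w x e) (hrow : ∀ x ∈ P, ∑ e ∈ E, w x e = 1)
    (hsymm : ∀ h : α → α → ℝ, ∑ x ∈ P, avg E w x (fun e => h x (tgt e)) =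
      ∑ x ∈ P, avg E w x (fun e => h (tgt e) x))
    (th : α → α → ℝ) (D : α → α → α → ℝ) (τ : ℕ → ℝ) (hth : ∀ x y, th x y = th y x)
    (hth0 : ∀ x y, th x y < τ 0) (hD0 : ∀ x y z, D x y z < τ 0)
    (hthn : ∀ x y, τ n ≤ th x y) (hDn : ∀ x y z, τ n ≤ D x y z)
    (Bad : α → β → β → Prop)
    (hbad : ∑ x ∈ P, avg E w x (fun e => avg E w (tgt e) fun e' => if Bad x e e' then 1 else 0) ≤
      pathConst n ^ 2 / 16 * #P) :
    ∃ k < n, ∃ l < n, ∃ x ∈ P, ∃ y' ∈ P, τ (k + 1) ≤ th y' x ∧ th y' x < τ k ∧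
      pathConst n ^ 2 / 2 ≤ avg E w x fun e => avg E w (tgt e) fun e' =>
        if ¬ Bad x e e' ∧ τ (k + 1) ≤ th x (tgt e) ∧ th x (tgt e) < τ k ∧
          th (tgt e) (tgt e') < τ k ∧ τ (l + 1) ≤ D x (tgt e) (tgt e') ∧
          D x (tgt e) (tgt e') < τ l ∧ D y' x (tgt e) < τ l then 1 else 0 := by
  have hN : (0 : ℝ) < #P := by exact_mod_cast hP.card_pos
  set p : ℕ → ℝ := fun k => (∑ x ∈ P, avg E w x fun e => if τ k ≤ th x (tgt e) then 1 else 0) / #P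
    with hp
  have hstat := sum_avg_stationary (tgt := tgt) hrow hsymm
  have ite1 : ∀ (q : Prop) [Decidable q], (if q then (1 : ℝ) else 0) ≤ 1 := fun q _ => by
    split_ifs <;> norm_num
  have ite0 : ∀ (q : Prop) [Decidable q], (0 : ℝ) ≤ if q then (1 : ℝ) else 0 := fun q _ => by
    split_ifs <;> norm_num
  have prob_le : ∀ f : α → ℝ, (∀ x ∈ P, f x ≤ 1) → (∑ x ∈ P, f x) / #P ≤ 1 := by
    intro f hf
    rw [div_le_one hN]
    simpa using sum_le_card_nsmul P f 1 hf
  have hp0 : p 0 ≤ 0 := by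
    simp only [hp, not_le.2 (hth0 _ _), if_false]
    simp [avg]
  have hp1 : ∀ k, p k ≤ 1 := fun k => prob_le _ fun x hx =>
    (avg_mono hw fun e _ => ite1 _).trans_eq (avg_const (hrow x hx) 1)
  have hpn : 1 ≤ p n := by
    simp only [hp, hthn, if_true]
    rw [sum_congr rfl fun x hx => avg_const (hrow x hx) 1]
    simp [hN.ne']
  obtain ⟨k, hk, hk1, hk2⟩ := exists_jump (fun x y hx hxy _ => sqShrinkIter_mono n x y hx hxy)
    (fun x hx _ => sqShrinkIter_pos n x hx) (sqShrinkIter_le n) hp0 hp1 one_pos hpn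
  have hiterpos : ∀ m, 0 < (sqShrinkIter n)^[m] 1 := by
    intro m
    induction m with
    | zero => simp
    | succ m ih => rw [Function.iterate_succ_apply']; exact sqShrinkIter_pos n _ ih
  have hpk : 0 < p (k + 1) := (hiterpos n).trans_le hk2
  set q : ℕ → ℝ := fun l => (∑ x ∈ P, avg E w x fun e => avg E w (tgt e) fun e' =>
    if τ (k + 1) ≤ th x (tgt e) ∧ τ l ≤ D x (tgt e) (tgt e') then 1 else 0) / #P with hq
  have hq0 : q 0 ≤ 0 := by
    simp only [hq, not_le.2 (hD0 _ _ _), and_false, if_false]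
    simp [avg]
  have hq1 : ∀ l, q l ≤ 1 := fun l => prob_le _ fun x hx => by
    refine (avg_mono hw fun e he => ?_).trans_eq (avg_const (hrow x hx) 1)
    exact (avg_mono hw fun e _ => ite1 _).trans_eq (avg_const (hrow _ (htgt e he)) 1)
  have hqn : p (k + 1) ≤ q n := by
    simp only [hq, hp, hDn, and_true]
    refine div_le_div_of_nonneg_right (sum_le_sum fun x hx => ?_) hN.le
    exact avg_mono hw fun e he => (avg_const (hrow _ (htgt e he)) _).ge
  obtain ⟨l, hl, hl1, hl2⟩ := exists_jump (fun x y hx hxy _ => sqShrink_mono hx hxy)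
    (fun x hx _ => sqShrink_pos hx) (fun x hx hx1 => sqShrink_le hx.le hx1) hq0 hq1 hpk hqn
  have hγ : pathConst n ≤ q (l + 1) :=
    ((sqShrink_iterate n).2.2 _ _ (hiterpos n).le hk2).2.trans hl2
  have hpkγ : p k ≤ q (l + 1) ^ 2 / 16 := by
    refine hk1.trans ?_
    unfold sqShrinkIter
    have := ((sqShrink_iterate n).1 _ hpk).le
    gcongr
  have hqlγ : q l ≤ q (l + 1) ^ 2 / 16 := hl1
  refine ⟨k, hk, l, hl, ?_⟩
  by_contra! hcon
  -- indicator functions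
  set F : α → α → ℝ := fun x y => if τ (k + 1) ≤ th x y then 1 else 0 with hF
  set G : α → β → β → ℝ := fun x e e' =>
    if τ (k + 1) ≤ th x (tgt e) ∧ τ (l + 1) ≤ D x (tgt e) (tgt e') then 1 else 0 with hG
  set γ : α → ℝ := fun x => avg E w x fun e => avg E w (tgt e) fun e' => G x e e' with hγdef
  set H : α → α → ℝ := fun y' x => avg E w x fun e => avg E w (tgt e) fun e' =>
        if ¬ Bad x e e' ∧ τ (k + 1) ≤ th y' x ∧ th y' x < τ k ∧
          τ (k + 1) ≤ th x (tgt e) ∧ th x (tgt e) < τ k ∧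
          th (tgt e) (tgt e') < τ k ∧ τ (l + 1) ≤ D x (tgt e) (tgt e') ∧
          D x (tgt e) (tgt e') < τ l ∧ D y' x (tgt e) < τ l then 1 else 0 with hH
  have hHle : ∀ y' ∈ P, ∀ x ∈ P, H y' x ≤ pathConst n ^ 2 / 2 := by
    intro y' hy' x hx
    by_cases h : τ (k + 1) ≤ th y' x ∧ th y' x < τ k
    · simp only [hH, h.1, h.2, true_and]
      exact (hcon x hx y' hy' h.1 h.2).le
    · have : H y' x = 0 := by
        simp only [hH]
        refine (avg_congr fun e _ => (avg_congr fun e' _ => if_neg ?_)).trans ?_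
        · exact fun h' => h ⟨h'.2.1, h'.2.2.1⟩
        · simp [avg]
      rw [this]; positivity
  -- lower bound for the probability of the main event
  have hlow : #P * q (l + 1) ^ 2 ≤
      ∑ x ∈ P, avg E w x fun e => F x (tgt e) * γ (tgt e) := by
    rw [hsymm fun x y => F x y * γ y]
    have h1 : ∀ x ∈ P, γ x ^ 2 ≤ avg E w x fun e => F (tgt e) x * γ x := by
      intro x hx
      have hγ0 : 0 ≤ γ x := avg_nonneg hw fun e _ => avg_nonneg hw fun e' _ => ite0 _
      rw [avg_mul_right, sq]
      refine mul_le_mul_of_nonneg_right ?_ hγ0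
      refine avg_mono hw fun e he => ?_
      have : F (tgt e) x = avg E w (tgt e) fun _ => F (tgt e) x :=
        (avg_const (hrow _ (htgt e he)) _).symm
      rw [this]
      refine avg_mono hw fun e' _ => ?_
      simp only [hF, hG, hth (tgt e) x]
      split_ifs with h1 h2 <;> first | exact absurd h1.1 h2 | norm_num
    have h2 : (∑ x ∈ P, γ x) = q (l + 1) * #P := by
      simp only [hq]
      rw [div_mul_cancel₀ _ hN.ne']
    have h3 := sq_sum_le_card_mul_sum_sq (s := P) (f := γ)
    rw [h2] at h3
    have h4 : #P * q (l + 1) ^ 2 ≤ ∑ x ∈ P, γ x ^ 2 := by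
      refine le_of_mul_le_mul_left ?_ hN
      calc _ = (q (l + 1) * #P) ^ 2 := by ring
        _ ≤ _ := h3
    exact h4.trans (sum_le_sum h1)
  -- the union bound
  set I1 : α → β → β → ℝ := fun x e e' => if Bad x e e' then 1 else 0 with hI1
  set I2 : α → α → ℝ := fun x y => if τ k ≤ th x y then 1 else 0 with hI2
  set I3 : α → α → α → ℝ := fun x y z =>
    if τ (k + 1) ≤ th x y ∧ τ l ≤ D x y z then 1 else 0 with hI3
  have hpt : ∀ x0 x1 e e', F x0 x1 * G x1 e e' ≤
      (if ¬ Bad x1 e e' ∧ τ (k + 1) ≤ th x0 x1 ∧ th x0 x1 < τ k ∧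
          τ (k + 1) ≤ th x1 (tgt e) ∧ th x1 (tgt e) < τ k ∧
          th (tgt e) (tgt e') < τ k ∧ τ (l + 1) ≤ D x1 (tgt e) (tgt e') ∧
          D x1 (tgt e) (tgt e') < τ l ∧ D x0 x1 (tgt e) < τ l then 1 else 0)
      + I1 x1 e e' + I2 x0 x1 + I2 x1 (tgt e) + I2 (tgt e) (tgt e') + I3 x0 x1 (tgt e)
      + I3 x1 (tgt e) (tgt e') := by
    intro x0 x1 e e'
    have n1 : 0 ≤ I1 x1 e e' := ite0 _
    have n2 : ∀ x y, 0 ≤ I2 x y := fun _ _ => ite0 _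
    have n3 : ∀ x y z, 0 ≤ I3 x y z := fun _ _ _ => ite0 _
    have := n2 x0 x1; have := n2 x1 (tgt e); have := n2 (tgt e) (tgt e')
    have := n3 x0 x1 (tgt e); have := n3 x1 (tgt e) (tgt e')
    by_cases hFG : τ (k + 1) ≤ th x0 x1 ∧ τ (k + 1) ≤ th x1 (tgt e) ∧
      τ (l + 1) ≤ D x1 (tgt e) (tgt e')
    · obtain ⟨a1, a2, a3⟩ := hFG
      have hFG1 : F x0 x1 * G x1 e e' = 1 := by simp [hF, hG, a1, a2, a3]
      rw [hFG1]
      by_cases c1 : Bad x1 e e'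
      · have : I1 x1 e e' = 1 := if_pos c1
        have := ite0 (¬ Bad x1 e e' ∧ τ (k + 1) ≤ th x0 x1 ∧ th x0 x1 < τ k ∧
          τ (k + 1) ≤ th x1 (tgt e) ∧ th x1 (tgt e) < τ k ∧
          th (tgt e) (tgt e') < τ k ∧ τ (l + 1) ≤ D x1 (tgt e) (tgt e') ∧
          D x1 (tgt e) (tgt e') < τ l ∧ D x0 x1 (tgt e) < τ l)
        linarith
      simp only [c1, not_false_eq_true, a1, a2, a3, true_and]
      by_cases c2 : th x0 x1 < τ k
      swap
      · have : I2 x0 x1 = 1 := if_pos (not_lt.1 c2)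
        rw [if_neg (fun h => c2 h.1)]
        linarith
      by_cases c3 : th x1 (tgt e) < τ k
      swap
      · have : I2 x1 (tgt e) = 1 := if_pos (not_lt.1 c3)
        rw [if_neg (fun h => c3 h.2.1)]
        linarith
      by_cases c4 : th (tgt e) (tgt e') < τ k
      swap
      · have : I2 (tgt e) (tgt e') = 1 := if_pos (not_lt.1 c4)
        rw [if_neg (fun h => c4 h.2.2.1)]
        linarith
      by_cases c5 : D x1 (tgt e) (tgt e') < τ l
      swap
      · have : I3 x1 (tgt e) (tgt e') = 1 := if_pos ⟨a2, not_lt.1 c5⟩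
        rw [if_neg (fun h => c5 h.2.2.2.1)]
        linarith
      by_cases c6 : D x0 x1 (tgt e) < τ l
      swap
      · have : I3 x0 x1 (tgt e) = 1 := if_pos ⟨a1, not_lt.1 c6⟩
        rw [if_neg (fun h => c6 h.2.2.2.2)]
        linarith
      rw [if_pos ⟨c2, c3, c4, c5, c6⟩]
      linarith
    · have hFG0 : F x0 x1 * G x1 e e' = 0 := by
        simp only [hF, hG, ← ite_and, ite_mul, one_mul, zero_mul]
        rw [if_neg hFG]
      rw [hFG0]
      have := ite0 (¬ Bad x1 e e' ∧ τ (k + 1) ≤ th x0 x1 ∧ th x0 x1 < τ k ∧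
          τ (k + 1) ≤ th x1 (tgt e) ∧ th x1 (tgt e) < τ k ∧
          th (tgt e) (tgt e') < τ k ∧ τ (l + 1) ≤ D x1 (tgt e) (tgt e') ∧
          D x1 (tgt e) (tgt e') < τ l ∧ D x0 x1 (tgt e) < τ l)
      linarith
  have hsum : ∀ x0 ∈ P, ∀ x1 ∈ P, F x0 x1 * γ x1 ≤ H x0 x1
      + (avg E w x1 fun e => avg E w (tgt e) fun e' => I1 x1 e e') + I2 x0 x1
      + (avg E w x1 fun e => I2 x1 (tgt e))
      + (avg E w x1 fun e => avg E w (tgt e) fun e' => I2 (tgt e) (tgt e'))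
      + (avg E w x1 fun e => I3 x0 x1 (tgt e))
      + (avg E w x1 fun e => avg E w (tgt e) fun e' => I3 x1 (tgt e) (tgt e')) := by
    intro x0 _ x1 hx1
    have h1 := avg_mono (E := E) (x := x1) hw fun e _ => avg_mono (E := E) (x := tgt e) hw
      fun e' _ => hpt x0 x1 e e'
    simp only [avg_add, avg_mul_left] at h1
    rw [avg_congr fun e he => avg_const (hrow _ (htgt e he)) (I2 x0 x1),
      avg_congr fun e he => avg_const (hrow _ (htgt e he)) (I2 x1 (tgt e)),
      avg_congr fun e he => avg_const (hrow _ (htgt e he)) (I3 x0 x1 (tgt e)),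
      avg_const (hrow _ hx1)] at h1
    exact h1
  have hfin : ∑ x ∈ P, avg E w x (fun e => F x (tgt e) * γ (tgt e)) ≤
      (pathConst n ^ 2 / 2) * #P + pathConst n ^ 2 / 16 * #P + p k * #P + p k * #P + p k * #P
        + q l * #P + q l * #P := by
    refine (sum_le_sum fun x hx => avg_mono hw fun e he => hsum x hx _ (htgt e he)).trans ?_
    simp only [avg_add, sum_add_distrib]
    have s1 : ∑ x ∈ P, avg E w x (fun e => H x (tgt e)) ≤ (pathConst n ^ 2 / 2) * #P := by
      rw [mul_comm, ← nsmul_eq_mul]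
      refine sum_le_card_nsmul _ _ _ fun x hx => ?_
      exact (avg_mono hw fun e he => hHle x hx _ (htgt e he)).trans_eq (avg_const (hrow x hx) _)
    have s2 := hstat fun x1 => avg E w x1 fun e => avg E w (tgt e) fun e' => I1 x1 e e'
    have s3 : ∑ x ∈ P, avg E w x (fun e => I2 x (tgt e)) = p k * #P := by
      simp only [hp]; rw [div_mul_cancel₀ _ hN.ne']
    have s4 := hstat fun x1 => avg E w x1 fun e => I2 x1 (tgt e)
    have s5 := hstat fun x1 => avg E w x1 fun e => avg E w (tgt e) fun e' => I2 (tgt e) (tgt e')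
    have s5' := hstat fun x1 => avg E w x1 fun e => I2 x1 (tgt e)
    have s6 : ∑ x ∈ P, avg E w x (fun e => avg E w (tgt e) fun e' => I3 x (tgt e) (tgt e'))
        = q l * #P := by
      simp only [hq]; rw [div_mul_cancel₀ _ hN.ne']
    have s7 := hstat fun x1 => avg E w x1 fun e => avg E w (tgt e) fun e' =>
      I3 x1 (tgt e) (tgt e')
    rw [s2, s3, s4, s5, s5', s3, s6, s7, s6]
    linarith
  have hγ2 : pathConst n ^ 2 ≤ q (l + 1) ^ 2 := by
    have := (pathConst_pos n).le
    gcongr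
  have hlast := hlow.trans hfin
  have hdiv : q (l + 1) ^ 2 ≤ pathConst n ^ 2 / 2 + pathConst n ^ 2 / 16 + 3 * p k + 2 * q l := by
    refine le_of_mul_le_mul_left ?_ hN
    linarith
  have := pow_pos (pathConst_pos n) 2
  linarith

end Markov

end Planebrush

namespace Planebrush

open Matrix Finset

theorem norm_cross_le_of_unit {u : V3} (hu : u ⬝ᵥ u = 1) (v : V3) : ‖v ⨯₃ u‖ ≤ 2 * ‖v‖ := by
  have := norm_cross_le v u
  have := norm_le_one_of_dotProduct_self hu
  nlinarith [norm_nonneg v]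

theorem norm_cross_le_two {u v : V3} (hu : u ⬝ᵥ u = 1) (hv : v ⬝ᵥ v = 1) : ‖v ⨯₃ u‖ ≤ 2 := by
  have := norm_cross_le_of_unit hu v
  have := norm_le_one_of_dotProduct_self hv
  linarith

theorem half_le_norm_of_unit {u : V3} (hu : u ⬝ᵥ u = 1) : 1 / 2 ≤ ‖u‖ := by
  have := dotProduct_self_le u
  by_contra! h
  nlinarith [norm_nonneg u]

theorem abs_le_of_norm_smul_unit {u v : V3} {r A η : ℝ} (hu : u ⬝ᵥ u = 1)
    (h : ‖v - r • u‖ ≤ η) (hv : ‖v‖ ≤ A) : |r| ≤ 2 * (A + η) := by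
  have h1 : ‖r • u‖ ≤ A + η := by
    have : r • u = v - (v - r • u) := by abel
    rw [this]
    exact (norm_sub_le _ _).trans (by linarith)
  rw [norm_smul, Real.norm_eq_abs] at h1
  nlinarith [half_le_norm_of_unit hu, abs_nonneg r]

theorem le_abs_of_norm_smul_unit {u v : V3} {r ρ η : ℝ} (hu : u ⬝ᵥ u = 1)
    (h : ‖v - r • u‖ ≤ η) (hv : ρ ≤ ‖v‖) : ρ - η ≤ |r| := by
  have h1 : ‖v‖ ≤ ‖r • u‖ + η := by
    have := norm_add_le (r • u) (v - r • u)
    rw [add_sub_cancel] at this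
    linarith
  rw [norm_smul, Real.norm_eq_abs] at h1
  nlinarith [norm_le_one_of_dotProduct_self hu, abs_nonneg r]

/-- Two paths of tubes between the same end points: the difference of the intermediate times is
controlled through the common normal of the end planes. -/
theorem time_diff_of_normal {px py py' pz b₁ b₂ b₁' b₂' ux uz : V3} {tx t t' tz r r' η : ℝ}
    (h₁ : ‖py - px - (t - tx) • b₁‖ ≤ 2 * η) (h₂ : ‖pz - py - (tz - t) • b₂‖ ≤ 2 * η)
    (h₁' : ‖py' - px - (t' - tx) • b₁'‖ ≤ 2 * η) (h₂' : ‖pz - py' - (tz - t') • b₂'‖ ≤ 2 * η)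
    (hr : ‖b₁ - b₁' - r • ux‖ ≤ η) (hr' : ‖b₂ - b₂' - r' • uz‖ ≤ η)
    (ht : |t - tx| ≤ 1) (ht' : |tz - t| ≤ 1) :
    |t - t'| * |(b₁' - b₂') ⬝ᵥ (ux ⨯₃ uz)| ≤ 30 * η * ‖ux ⨯₃ uz‖ := by
  set n := ux ⨯₃ uz
  set w := (py' - px - (t' - tx) • b₁') + (pz - py' - (tz - t') • b₂')
    - (py - px - (t - tx) • b₁) - (pz - py - (tz - t) • b₂)
    - (t - tx) • (b₁ - b₁' - r • ux) - (tz - t) • (b₂ - b₂' - r' • uz) with hw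
  have hid : (t - t') • (b₁' - b₂') = w - ((t - tx) * r) • ux - ((tz - t) * r') • uz := by
    rw [hw]; module
  have hn1 : ux ⬝ᵥ n = 0 := dot_self_cross _ _
  have hn2 : uz ⬝ᵥ n = 0 := dot_cross_self _ _
  have hdot : (t - t') * ((b₁' - b₂') ⬝ᵥ n) = w ⬝ᵥ n := by
    rw [← smul_eq_mul, ← smul_dotProduct, hid, sub_dotProduct, sub_dotProduct, smul_dotProduct,
      smul_dotProduct, hn1, hn2]
    simp
  have hη : 0 ≤ η := (norm_nonneg _).trans hr
  have s1 : ‖(t - tx) • (b₁ - b₁' - r • ux)‖ ≤ η := by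
    rw [norm_smul, Real.norm_eq_abs]
    nlinarith [norm_nonneg (b₁ - b₁' - r • ux)]
  have s2 : ‖(tz - t) • (b₂ - b₂' - r' • uz)‖ ≤ η := by
    rw [norm_smul, Real.norm_eq_abs]
    nlinarith [norm_nonneg (b₂ - b₂' - r' • uz)]
  have hwn : ‖w‖ ≤ 10 * η := by
    refine (norm_sub_le _ _).trans ?_
    refine (add_le_add (norm_sub_le _ _) s2).trans ?_
    have e1 := norm_sub_le (py' - px - (t' - tx) • b₁' + (pz - py' - (tz - t') • b₂')
      - (py - px - (t - tx) • b₁)) (pz - py - (tz - t) • b₂)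
    have e2 := norm_sub_le (py' - px - (t' - tx) • b₁' + (pz - py' - (tz - t') • b₂'))
      (py - px - (t - tx) • b₁)
    have e3 := norm_add_le (py' - px - (t' - tx) • b₁') (pz - py' - (tz - t') • b₂')
    linarith
  rw [← abs_mul, hdot]
  have := abs_dotProduct_le w n
  nlinarith [norm_nonneg n]

/-- The analogue of `time_diff_of_normal` when the last tube is fixed. -/
theorem time_diff_of_cross {px py py' b₁ b₁' b₂ ux : V3} {tx t t' r η : ℝ} (hu : ux ⬝ᵥ ux = 1)
    (h₁ : ‖py - px - (t - tx) • b₁‖ ≤ 2 * η) (h₁' : ‖py' - px - (t' - tx) • b₁'‖ ≤ 2 * η)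
    (h₂ : ‖py' - py - (t' - t) • b₂‖ ≤ 2 * η) (hr : ‖b₁ - b₁' - r • ux‖ ≤ η)
    (ht : |t - tx| ≤ 1) :
    |t - t'| * ‖(b₂ - b₁') ⨯₃ ux‖ ≤ 14 * η := by
  set w := (py - px - (t - tx) • b₁) - (py' - px - (t' - tx) • b₁')
    + (py' - py - (t' - t) • b₂) + (t - tx) • (b₁ - b₁' - r • ux) with hw
  have hid : (t - t') • (b₂ - b₁') = w + ((t - tx) * r) • ux := by
    rw [hw]; module
  have hη : 0 ≤ η := (norm_nonneg _).trans hr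
  have s1 : ‖(t - tx) • (b₁ - b₁' - r • ux)‖ ≤ η := by
    rw [norm_smul, Real.norm_eq_abs]
    nlinarith [norm_nonneg (b₁ - b₁' - r • ux)]
  have hwn : ‖w‖ ≤ 7 * η := by
    refine (norm_add_le _ _).trans ?_
    have e1 := norm_add_le ((py - px - (t - tx) • b₁) - (py' - px - (t' - tx) • b₁'))
      (py' - py - (t' - t) • b₂)
    have e2 := norm_sub_le (py - px - (t - tx) • b₁) (py' - px - (t' - tx) • b₁')
    linarith
  have hc : (t - t') • ((b₂ - b₁') ⨯₃ ux) = w ⨯₃ ux := by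
    have := congrArg (fun v => v ⨯₃ ux) hid
    simpa using this
  have := norm_cross_le_of_unit hu w
  rw [← hc, norm_smul, Real.norm_eq_abs] at this
  linarith

/-- The time of the point `q`. -/
noncomputable def time {α : Type*} (k : α → ℕ) (M : ℕ) (q : α) : ℝ := k q / M

theorem time_nonneg {α : Type*} (k : α → ℕ) (M : ℕ) (q : α) : 0 ≤ time k M q := by
  unfold time; positivity

/-- A discretised configuration: tubes with slopes `b` and positions `a` at time `0`, points
`p q` at time `k q / M`, with each point `q` lying on the tubes `I q`, whose slopes lie near a line
of direction `u q`. -/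
structure Config {α ι : Type*} (K δ : ℝ) (M m : ℕ) (P : Finset α) (T : Finset ι) (a b : ι → V3)
    (k : α → ℕ) (p : α → V3) (I : α → Finset ι) (u : α → V3) : Prop where
  one_le_K : 1 ≤ K
  δ_pos : 0 < δ
  δ_le : δ ≤ 1
  one_le_Mδ : 1 ≤ M * δ
  b_sep : ∀ i ∈ T, ∀ j ∈ T, i ≠ j → δ ≤ ‖b i - b j‖
  b_le : ∀ i ∈ T, ‖b i‖ ≤ 1
  p_sep : ∀ q ∈ P, ∀ q' ∈ P, q ≠ q' → k q = k q' → δ ≤ ‖p q - p q'‖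
  k_lt : ∀ q ∈ P, k q < M
  I_sub : ∀ q ∈ P, I q ⊆ T
  I_card : ∀ q ∈ P, #(I q) = m
  inc : ∀ q ∈ P, ∀ i ∈ I q, ‖p q - a i - time k M q • b i‖ ≤ K * δ
  u_unit : ∀ q, u q ⬝ᵥ u q = 1
  line : ∀ q ∈ P, ∀ i ∈ I q, ∀ j ∈ I q, ∃ r : ℝ, ‖b i - b j - r • u q‖ ≤ K * δ

namespace Config

variable {α ι : Type*} {K δ : ℝ} {M m : ℕ} {P : Finset α} {T : Finset ι} {a b : ι → V3}
  {k : α → ℕ} {p : α → V3} {I : α → Finset ι} {u : α → V3}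

section Basic

variable (h : Config K δ M m P T a b k p I u)

include h

theorem M_pos : (0 : ℝ) < M := by
  have := h.one_le_Mδ
  have := h.δ_pos
  by_contra hM
  have : (M : ℝ) * δ ≤ 0 := mul_nonpos_of_nonpos_of_nonneg (not_lt.1 hM) h.δ_pos.le
  linarith

theorem K_pos : 0 < K := one_pos.trans_le h.one_le_K

theorem η_pos : 0 < K * δ := mul_pos h.K_pos h.δ_pos

theorem time_lt_one {q : α} (hq : q ∈ P) : time k M q < 1 := by
  unfold time
  rw [div_lt_one h.M_pos]
  exact_mod_cast h.k_lt q hq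

theorem abs_time_sub_le {q q' : α} (hq : q ∈ P) (hq' : q' ∈ P) :
    |time k M q - time k M q'| ≤ 1 := by
  rw [abs_le]
  have := time_nonneg k M q
  have := time_nonneg k M q'
  have := h.time_lt_one hq
  have := h.time_lt_one hq'
  constructor <;> linarith

theorem inc_sub {q q' : α} {i : ι} (hq : q ∈ P) (hq' : q' ∈ P) (hi : i ∈ I q) (hi' : i ∈ I q') :
    ‖p q' - p q - (time k M q' - time k M q) • b i‖ ≤ 2 * (K * δ) := by
  have h1 := h.inc q hq i hi
  have h2 := h.inc q' hq' i hi'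
  have : p q' - p q - (time k M q' - time k M q) • b i =
      (p q' - a i - time k M q' • b i) - (p q - a i - time k M q • b i) := by module
  rw [this]
  exact (norm_sub_le _ _).trans (by linarith)

open Classical in
theorem card_tube_time_le {i : ι} (S : Finset α) (hS : ∀ q ∈ S, q ∈ P ∧ i ∈ I q) (κ : ℕ)
    (hκ : ∀ q ∈ S, k q = κ) : (#S : ℝ) ≤ 64 * K ^ 3 := by
  have h1 := card_le_of_ball (v := p) (c := a i + ((κ : ℝ) / M) • b i) h.δ_pos h.η_pos.le
    (fun q hq q' hq' hne => h.p_sep q (hS q hq).1 q' (hS q' hq').1 hne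
      ((hκ q hq).trans (hκ q' hq').symm))
    (fun q hq => by
      have := h.inc q (hS q hq).1 i (hS q hq).2
      rw [time, hκ q hq] at this
      rwa [← sub_sub])
  have hδ := h.δ_pos
  have hK := h.one_le_K
  have e : 2 * (K * δ) / δ = 2 * K := by field_simp
  rw [e] at h1
  calc _ ≤ _ := h1
    _ ≤ (4 * K) ^ 3 := by gcongr; linarith
    _ = _ := by ring

open Classical in
/-- Points on a tube at given times. -/
theorem card_tube_times_le {i : ι} (S : Finset α) (hS : ∀ q ∈ S, q ∈ P ∧ i ∈ I q) :
    (#S : ℝ) ≤ 64 * K ^ 3 * #(S.image k) := by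
  have h1 : #S = ∑ κ ∈ S.image k, #{q ∈ S | k q = κ} :=
    card_eq_sum_card_image k S
  rw [h1]
  push_cast
  have h2 : ∀ κ ∈ S.image k, (#{q ∈ S | k q = κ} : ℝ) ≤ 64 * K ^ 3 := fun κ _ =>
    h.card_tube_time_le (i := i) _ (fun q hq => hS q (mem_filter.1 hq).1) κ
      fun q hq => (mem_filter.1 hq).2
  calc _ ≤ _ := sum_le_card_nsmul _ _ _ h2
    _ = _ := by rw [nsmul_eq_mul]; ring

open Classical in
theorem card_tube_le {i : ι} (S : Finset α) (hS : ∀ q ∈ S, q ∈ P ∧ i ∈ I q) :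
    (#S : ℝ) ≤ 64 * K ^ 3 * M := by
  refine (h.card_tube_times_le S hS).trans ?_
  have : #(S.image k) ≤ M := by
    have : S.image k ⊆ range M := by
      intro κ hκ
      obtain ⟨q, hq, rfl⟩ := mem_image.1 hκ
      exact mem_range.2 (h.k_lt q (hS q hq).1)
    simpa using card_le_card this
  have hK := h.K_pos
  gcongr

open Classical in
/-- Points on a tube whose times lie in an interval. -/
theorem card_tube_interval_le {i : ι} (S : Finset α) (hS : ∀ q ∈ S, q ∈ P ∧ i ∈ I q) {c R : ℝ}
    (hR : 0 ≤ R) (hc : ∀ q ∈ S, |time k M q - c| ≤ R) :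
    (#S : ℝ) ≤ 64 * K ^ 3 * (2 * (R * M) + 2) := by
  refine (h.card_tube_times_le S hS).trans ?_
  have hM := h.M_pos
  have hK := h.K_pos
  have := card_nat_le_of_interval (S := S.image k) (c := c * M) (R := R * M) (by positivity) ?_
  · gcongr
  · intro κ hκ
    obtain ⟨q, hq, rfl⟩ := mem_image.1 hκ
    have h1 := hc q hq
    have e : (k q : ℝ) - c * M = (time k M q - c) * M := by
      unfold time; field_simp
    rw [e, abs_mul, abs_of_pos hM]
    gcongr

theorem m_le (hP : P.Nonempty) : (m : ℝ) ≤ 8424 * K ^ 2 / δ := by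
  obtain ⟨q, hq⟩ := hP
  rw [← h.I_card q hq]
  have hδ := h.δ_pos
  have hδ1 := h.δ_le
  have hK := h.one_le_K
  have hη := h.η_pos
  rcases (I q).eq_empty_or_nonempty with he | ⟨j, hj⟩
  · rw [he]; simp; positivity
  have h1 := card_le_of_line (S := I q) (v := b) (c := b j) (u := u q) (A₁ := 2) (A₂ := 2 * (K * δ))
    hδ (by norm_num) (by positivity) (h.u_unit q)
    (fun i hi i' hi' hne => h.b_sep i (h.I_sub q hq hi) i' (h.I_sub q hq hi') hne)
    (fun i hi => by
      have := h.b_le i (h.I_sub q hq hi)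
      have := h.b_le j (h.I_sub q hq hj)
      exact (norm_sub_le _ _).trans (by linarith))
    (fun i hi => by
      obtain ⟨r, hr⟩ := h.line q hq i hi j hj
      have : (b i - b j) ⨯₃ u q = (b i - b j - r • u q) ⨯₃ u q := by simp
      rw [this]
      exact (norm_cross_le_of_unit (h.u_unit q) _).trans (by linarith))
  refine h1.trans ?_
  have e : 8 * (2 * (K * δ)) / δ = 16 * K := by field_simp; ring
  rw [e]
  calc (12 * 2 / δ + 2) * (16 * K + 2) ^ 2 ≤ (26 / δ) * (18 * K) ^ 2 := by
        gcongr
        · have : 1 ≤ 1 / δ := by rw [le_div_iff₀ hδ]; linarith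
          have : 26 / δ = 12 * 2 / δ + 2 * (1 / δ) := by ring
          linarith
        · linarith
    _ = _ := by ring

/-- Points `y` on paths `x - y - z` at a fixed time lie near two transverse lines. -/
theorem card_mid_time_le {x z : α} (hx : x ∈ P) (hz : z ∈ P) (S : Finset α)
    (hS : ∀ y ∈ S, y ∈ P ∧ ∃ i ∈ I x, i ∈ I y ∧ ∃ j ∈ I z, j ∈ I y)
    (hn : 0 < ‖u x ⨯₃ u z‖) (κ : ℕ) (hκ : ∀ y ∈ S, k y = κ) :
    (#S : ℝ) ≤ 10 ^ 7 * K ^ 3 / ‖u x ⨯₃ u z‖ := by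
  have hδ := h.δ_pos
  have hK := h.one_le_K
  have hη := h.η_pos
  rcases S.eq_empty_or_nonempty with he | ⟨y', hy'⟩
  · rw [he]; simp; positivity
  -- displacement towards a reference point, seen from an end point of the path
  have key : ∀ w ∈ P, ∀ y ∈ S, (∃ i ∈ I w, i ∈ I y) → (∃ i ∈ I w, i ∈ I y') →
      ‖(p y - p y') ⨯₃ u w‖ ≤ 10 * (K * δ) := by
    rintro w hw y hy ⟨i, hi, hi'⟩ ⟨j, hj, hj'⟩
    have hyP := (hS y hy).1
    have hyP' := (hS y' hy').1
    have h1 := h.inc_sub hw hyP hi hi'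
    have h2 := h.inc_sub hw hyP' hj hj'
    have ht : time k M y = time k M y' := by unfold time; rw [hκ y hy, hκ y' hy']
    obtain ⟨r, hr⟩ := h.line w hw i hi j hj
    have hid : (p y - p y') ⨯₃ u w = ((p y - p w - (time k M y - time k M w) • b i)
        - (p y' - p w - (time k M y' - time k M w) • b j)
        + (time k M y - time k M w) • (b i - b j - r • u w)) ⨯₃ u w := by
      have : p y - p y' = (p y - p w - (time k M y - time k M w) • b i)
        - (p y' - p w - (time k M y' - time k M w) • b j)
        + (time k M y - time k M w) • (b i - b j - r • u w)
        + ((time k M y - time k M w) * r) • u w := by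
        rw [ht]; module
      rw [this]
      simp
    have s1 : ‖(time k M y - time k M w) • (b i - b j - r • u w)‖ ≤ K * δ := by
      rw [norm_smul, Real.norm_eq_abs]
      have := h.abs_time_sub_le hyP hw
      nlinarith [norm_nonneg (b i - b j - r • u w)]
    rw [hid]
    refine (norm_cross_le_of_unit (h.u_unit w) _).trans ?_
    have e1 := norm_add_le ((p y - p w - (time k M y - time k M w) • b i)
        - (p y' - p w - (time k M y' - time k M w) • b j))
        ((time k M y - time k M w) • (b i - b j - r • u w))
    have e2 := norm_sub_le (p y - p w - (time k M y - time k M w) • b i)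
        (p y' - p w - (time k M y' - time k M w) • b j)
    linarith
  have hn2 := norm_cross_le_two (h.u_unit z) (h.u_unit x)
  set ν := ‖u x ⨯₃ u z‖ with hν
  have keyx : ∀ y ∈ S, ‖(p y - p y') ⨯₃ u x‖ ≤ 10 * (K * δ) := fun y hy => by
    obtain ⟨-, i, hi, hi', -⟩ := hS y hy
    obtain ⟨-, j, hj, hj', -⟩ := hS y' hy'
    exact key x hx y hy ⟨i, hi, hi'⟩ ⟨j, hj, hj'⟩
  have keyz : ∀ y ∈ S, ‖(p y - p y') ⨯₃ u z‖ ≤ 10 * (K * δ) := fun y hy => by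
    obtain ⟨-, -, -, -, i, hi, hi'⟩ := hS y hy
    obtain ⟨-, -, -, -, j, hj, hj'⟩ := hS y' hy'
    exact key z hz y hy ⟨i, hi, hi'⟩ ⟨j, hj, hj'⟩
  have hlen : ∀ y ∈ S, ‖p y - p y'‖ ≤ 90 * (K * δ) / ν := fun y hy => by
    have h1 := abs_dotProduct_mul_norm_cross_le (h.u_unit x) (h.u_unit z) (p y - p y')
    have h2 := norm_le_abs_dotProduct_add (h.u_unit x) (p y - p y')
    rw [le_div_iff₀ hn]
    have := keyx y hy
    have := keyz y hy
    rw [← hν] at h1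
    nlinarith
  have h1 := card_le_of_line (S := S) (v := p) (c := p y') (u := u x) (A₁ := 90 * (K * δ) / ν)
    (A₂ := 10 * (K * δ)) hδ (by positivity) (by positivity) (h.u_unit x)
    (fun q hq q' hq' hne => h.p_sep q (hS q hq).1 q' (hS q' hq').1 hne
      ((hκ q hq).trans (hκ q' hq').symm)) hlen keyx
  refine h1.trans ?_
  have e : 8 * (10 * (K * δ)) / δ = 80 * K := by field_simp; ring
  have e2 : 12 * (90 * (K * δ) / ν) / δ = 1080 * K / ν := by field_simp; ring
  have e3 : 2 ≤ 4 * K / ν := by rw [le_div_iff₀ hn]; linarith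
  rw [e, e2]
  calc (1080 * K / ν + 2) * (80 * K + 2) ^ 2 ≤ (1084 * K / ν) * (82 * K) ^ 2 := by
        gcongr
        · have : 1084 * K / ν = 1080 * K / ν + 4 * K / ν := by ring
          linarith
        · linarith
    _ = 7288816 * (K ^ 3 / ν) := by ring
    _ ≤ 10 ^ 7 * (K ^ 3 / ν) := by gcongr; norm_num
    _ = _ := by ring

open Classical in
/-- Points `y` on paths `x - y - z` with large determinant. -/
theorem card_mid_of_det {x z : α} (hx : x ∈ P) (hz : z ∈ P) {ρ σ : ℝ} (hρ : 2 * (K * δ) ≤ ρ)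
    (hρ1 : ρ ≤ 1) (hσ : 0 < σ) (hsmall : 12 * (K * δ) * ‖u x ⨯₃ u z‖ ≤ ρ * σ) (S : Finset α)
    (hS : ∀ y ∈ S, y ∈ P ∧ ∃ i ∈ I x, i ∈ I y ∧ ∃ j ∈ I z, j ∈ I y ∧ ρ ≤ ‖b i - b j‖)
    (hdet : ∀ y ∈ S, σ ≤ |u y ⬝ᵥ (u x ⨯₃ u z)|) :
    (#S : ℝ) ≤ 10 ^ 10 * K ^ 4 * (M * δ / (ρ * σ)) := by
  have hδ := h.δ_pos
  have hK := h.one_le_K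
  have hη := h.η_pos
  have hM := h.M_pos
  have hρ0 : 0 < ρ := by linarith
  rcases S.eq_empty_or_nonempty with he | ⟨y', hy'⟩
  · rw [he]; simp; positivity
  have hn3 : ∀ y ∈ S, σ ≤ 3 * ‖u x ⨯₃ u z‖ := fun y hy => by
    have h1 := hdet y hy
    have h2 := abs_dotProduct_le (u y) (u x ⨯₃ u z)
    have h3 := norm_le_one_of_dotProduct_self (h.u_unit y)
    nlinarith [norm_nonneg (u x ⨯₃ u z)]
  set ν := ‖u x ⨯₃ u z‖ with hν
  have hn : 0 < ν := by linarith [hn3 y' hy']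
  obtain ⟨hyP', i', hi', hiy', j', hj', hjy', hij'⟩ := hS y' hy'
  obtain ⟨r₀, hr₀⟩ := h.line y' hyP' i' hiy' j' hjy'
  have hD' : ρ * σ / 4 ≤ |(b i' - b j') ⬝ᵥ (u x ⨯₃ u z)| := by
    have h1 := le_abs_of_norm_smul_unit (h.u_unit y') hr₀ hij'
    have h2 : (b i' - b j') ⬝ᵥ (u x ⨯₃ u z) = r₀ * (u y' ⬝ᵥ (u x ⨯₃ u z))
        + (b i' - b j' - r₀ • u y') ⬝ᵥ (u x ⨯₃ u z) := by
      simp only [sub_dotProduct, smul_dotProduct, smul_eq_mul]; ring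
    have h3 := abs_dotProduct_le (b i' - b j' - r₀ • u y') (u x ⨯₃ u z)
    have h4 : |r₀| * |u y' ⬝ᵥ (u x ⨯₃ u z)| ≤ |(b i' - b j') ⬝ᵥ (u x ⨯₃ u z)|
        + |(b i' - b j' - r₀ • u y') ⬝ᵥ (u x ⨯₃ u z)| := by
      rw [← abs_mul]
      have : r₀ * (u y' ⬝ᵥ (u x ⨯₃ u z)) = (b i' - b j') ⬝ᵥ (u x ⨯₃ u z)
        - (b i' - b j' - r₀ • u y') ⬝ᵥ (u x ⨯₃ u z) := by rw [h2]; ring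
      rw [this]
      exact abs_sub _ _
    have h5 : ρ / 2 * σ ≤ |r₀| * |u y' ⬝ᵥ (u x ⨯₃ u z)| := by
      have := hdet y' hy'
      gcongr
      linarith
    rw [← hν] at h3
    have h6 : 3 * ‖b i' - b j' - r₀ • u y'‖ * ν ≤ 3 * (K * δ) * ν := by gcongr
    linarith
  have htime : ∀ y ∈ S, |time k M y - time k M y'| ≤ 120 * (K * δ) * ν / (ρ * σ) := by
    intro y hy
    obtain ⟨hyP, i, hi, hiy, j, hj, hjy, -⟩ := hS y hy
    obtain ⟨r, hr⟩ := h.line x hx i hi i' hi'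
    obtain ⟨r', hr'⟩ := h.line z hz j hj j' hj'
    have := time_diff_of_normal (h.inc_sub hx hyP hi hiy) (h.inc_sub hyP hz hjy hj)
      (h.inc_sub hx hyP' hi' hiy') (h.inc_sub hyP' hz hjy' hj') hr hr'
      (h.abs_time_sub_le hyP hx) (h.abs_time_sub_le hz hyP)
    rw [← hν] at this
    rw [le_div_iff₀ (by positivity)]
    have h2 := mul_le_mul_of_nonneg_left hD' (abs_nonneg (time k M y - time k M y'))
    linarith
  have h1 : #S = ∑ κ ∈ S.image k, #{q ∈ S | k q = κ} := card_eq_sum_card_image k S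
  have h2 : ∀ κ ∈ S.image k, (#{q ∈ S | k q = κ} : ℝ) ≤ 10 ^ 7 * K ^ 3 / ν := fun κ _ =>
    h.card_mid_time_le hx hz _ (fun y hy => by
      obtain ⟨hyP, i, hi, hiy, j, hj, hjy, -⟩ := hS y (mem_filter.1 hy).1
      exact ⟨hyP, i, hi, hiy, j, hj, hjy⟩) hn κ fun q hq => (mem_filter.1 hq).2
  have h3 := card_nat_le_of_interval (S := S.image k) (c := time k M y' * M)
    (R := 120 * (K * δ) * ν / (ρ * σ) * M) (by positivity) ?_
  · rw [h1]
    push_cast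
    refine (sum_le_card_nsmul _ _ _ h2).trans ?_
    rw [nsmul_eq_mul]
    have h4 : 2 ≤ 6 * ν * (M * δ / (ρ * σ)) := by
      have := hn3 y' hy'
      have := h.one_le_Mδ
      rw [← mul_div_assoc, le_div_iff₀ (by positivity)]
      calc 2 * (ρ * σ) ≤ 2 * (1 * (3 * ν)) := by gcongr
        _ = 6 * ν * 1 := by ring
        _ ≤ 6 * ν * (M * δ) := by gcongr
    have h5 : 2 * (120 * (K * δ) * ν / (ρ * σ) * M) + 2 ≤ 246 * K * ν * (M * δ / (ρ * σ)) := by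
      have e : 2 * (120 * (K * δ) * ν / (ρ * σ) * M) = 240 * K * ν * (M * δ / (ρ * σ)) := by ring
      have e2 : 6 * ν * (M * δ / (ρ * σ)) ≤ 6 * K * ν * (M * δ / (ρ * σ)) := by
        have : 6 * ν ≤ 6 * K * ν := by nlinarith
        gcongr
      rw [e]; linarith
    calc _ ≤ 246 * K * ν * (M * δ / (ρ * σ)) * (10 ^ 7 * K ^ 3 / ν) := by
          gcongr
          exact h3.trans h5
      _ = 246 * 10 ^ 7 * (K ^ 4 * (M * δ / (ρ * σ))) := by field_simp
      _ ≤ 10 ^ 10 * (K ^ 4 * (M * δ / (ρ * σ))) := by gcongr; norm_num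
      _ = _ := by ring
  · intro κ hκ
    obtain ⟨q, hq, rfl⟩ := mem_image.1 hκ
    have e : (k q : ℝ) - time k M y' * M = (time k M q - time k M y') * M := by
      unfold time; field_simp
    rw [e, abs_mul, abs_of_pos hM]
    gcongr
    exact htime q hq

/-- Points `y` on a fixed tube `j` meeting the hairbrush of `x` at a large angle. -/
theorem card_mid_of_angle {x : α} (hx : x ∈ P) {j : ι} {ρ τ : ℝ} (hρ1 : ρ ≤ 1) (hτ : 0 < τ)
    (hρ0 : 0 < ρ) (hsmall : 8 * (K * δ) ≤ ρ * τ) (S : Finset α)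
    (hS : ∀ y ∈ S, y ∈ P ∧ j ∈ I y ∧ ∃ i ∈ I x, i ∈ I y ∧ ρ ≤ ‖b i - b j‖)
    (hang : ∀ y ∈ S, τ ≤ ‖u x ⨯₃ u y‖) :
    (#S : ℝ) ≤ 10 ^ 4 * K ^ 4 * (M * δ / (ρ * τ)) := by
  have hδ := h.δ_pos
  have hK := h.one_le_K
  have hη := h.η_pos
  have hM := h.M_pos
  rcases S.eq_empty_or_nonempty with he | ⟨y', hy'⟩
  · rw [he]; simp; positivity
  have hτ2 : τ ≤ 2 := (hang y' hy').trans (norm_cross_le_two (h.u_unit y') (h.u_unit x))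
  obtain ⟨hyP', hjy', i', hi', hiy', hij'⟩ := hS y' hy'
  obtain ⟨r₀, hr₀⟩ := h.line y' hyP' j hjy' i' hiy'
  have hD' : ρ * τ / 4 ≤ ‖(b j - b i') ⨯₃ u x‖ := by
    rw [norm_sub_rev] at hij'
    have h1 := le_abs_of_norm_smul_unit (h.u_unit y') hr₀ hij'
    have h2 : r₀ • (u y' ⨯₃ u x) = (b j - b i') ⨯₃ u x - (b j - b i' - r₀ • u y') ⨯₃ u x := by
      simp
    have h3 := norm_cross_le_of_unit (h.u_unit x) (b j - b i' - r₀ • u y')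
    have h4 := congrArg norm h2
    rw [norm_smul, Real.norm_eq_abs] at h4
    have h5 := norm_sub_le ((b j - b i') ⨯₃ u x) ((b j - b i' - r₀ • u y') ⨯₃ u x)
    have h6 : ρ / 2 * τ ≤ |r₀| * ‖u y' ⨯₃ u x‖ := by
      have := hang y' hy'
      rw [norm_cross_comm] at this
      have : K * δ ≤ ρ / 2 := by nlinarith
      gcongr
      linarith
    linarith
  have htime : ∀ y ∈ S, |time k M y - time k M y'| ≤ 56 * (K * δ) / (ρ * τ) := by
    intro y hy
    obtain ⟨hyP, hjy, i, hi, hiy, -⟩ := hS y hy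
    obtain ⟨r, hr⟩ := h.line x hx i hi i' hi'
    have := time_diff_of_cross (h.u_unit x) (h.inc_sub hx hyP hi hiy) (h.inc_sub hx hyP' hi' hiy')
      (h.inc_sub hyP hyP' hjy hjy') hr (h.abs_time_sub_le hyP hx)
    rw [le_div_iff₀ (by positivity)]
    have h2 := mul_le_mul_of_nonneg_left hD' (abs_nonneg (time k M y - time k M y'))
    linarith
  refine (h.card_tube_interval_le (i := j) S (fun y hy => ⟨(hS y hy).1, (hS y hy).2.1⟩)
    (by positivity) htime).trans ?_
  have h4 : 2 ≤ 4 * (M * δ / (ρ * τ)) := by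
    have := h.one_le_Mδ
    rw [← mul_div_assoc, le_div_iff₀ (by positivity)]
    calc 2 * (ρ * τ) ≤ 2 * (1 * 2) := by gcongr
      _ = 4 * 1 := by ring
      _ ≤ 4 * (M * δ) := by gcongr
  have h5 : 2 * (56 * (K * δ) / (ρ * τ) * M) + 2 ≤ 116 * K * (M * δ / (ρ * τ)) := by
    have e : 2 * (56 * (K * δ) / (ρ * τ) * M) = 112 * K * (M * δ / (ρ * τ)) := by ring
    have e2 : 4 * (M * δ / (ρ * τ)) ≤ 4 * K * (M * δ / (ρ * τ)) := by
      have : (4 : ℝ) ≤ 4 * K := by linarith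
      gcongr
    rw [e]; linarith
  calc _ ≤ 64 * K ^ 3 * (116 * K * (M * δ / (ρ * τ))) := by gcongr
    _ = 7424 * (K ^ 4 * (M * δ / (ρ * τ))) := by ring
    _ ≤ 10 ^ 4 * (K ^ 4 * (M * δ / (ρ * τ))) := by gcongr; norm_num
    _ = _ := by ring

/-- Tubes through two points at distant times. -/
theorem card_common_le {x y : α} (hx : x ∈ P) (hy : y ∈ P) {s : ℝ} (hs : 0 < s) (hs1 : s ≤ 1)
    (hst : s ≤ |time k M x - time k M y|) (S : Finset ι) (hS : ∀ i ∈ S, i ∈ I x ∧ i ∈ I y) :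
    (#S : ℝ) ≤ 10 ^ 3 * K ^ 3 / s ^ 3 := by
  have hδ := h.δ_pos
  have hK := h.one_le_K
  have hη := h.η_pos
  rcases S.eq_empty_or_nonempty with he | ⟨j, hj⟩
  · rw [he]; simp; positivity
  have h1 := card_le_of_ball (S := S) (v := b) (c := b j) (R := 4 * (K * δ) / s) hδ (by positivity)
    (fun i hi i' hi' hne => h.b_sep i (h.I_sub x hx (hS i hi).1) i' (h.I_sub x hx (hS i' hi').1)
      hne) (fun i hi => by
      have e1 := h.inc_sub hx hy (hS i hi).1 (hS i hi).2
      have e2 := h.inc_sub hx hy (hS j hj).1 (hS j hj).2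
      have e3 : (time k M x - time k M y) • (b i - b j) =
          (p y - p x - (time k M y - time k M x) • b i)
          - (p y - p x - (time k M y - time k M x) • b j) := by module
      have e4 := congrArg norm e3
      rw [norm_smul, Real.norm_eq_abs] at e4
      have e5 := norm_sub_le (p y - p x - (time k M y - time k M x) • b i)
        (p y - p x - (time k M y - time k M x) • b j)
      rw [le_div_iff₀ hs]
      nlinarith [norm_nonneg (b i - b j)])
  refine h1.trans ?_
  have e : 2 * (4 * (K * δ) / s) / δ = 8 * K / s := by field_simp; ring
  have e2 : 2 ≤ 2 * K / s := by rw [le_div_iff₀ hs]; nlinarith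
  rw [e]
  calc (8 * K / s + 2) ^ 3 ≤ (10 * K / s) ^ 3 := by
        gcongr
        have : 10 * K / s = 8 * K / s + 2 * K / s := by ring
        linarith
    _ = _ := by ring

end Basic

end Config

end Planebrush

namespace Planebrush

open Matrix Finset

section Angles

variable {α : Type*}

/-- The angle between the directions at `x` and `y`, truncated below at `δ`. -/
noncomputable def ang (u : α → V3) (δ : ℝ) (x y : α) : ℝ := max ‖u x ⨯₃ u y‖ δ

/-- The determinant of three directions. -/
noncomputable def det3 (u : α → V3) (x y z : α) : ℝ := |u z ⬝ᵥ (u x ⨯₃ u y)|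

/-- The determinant of three directions, truncated below. -/
noncomputable def vol3 (u : α → V3) (δ L : ℝ) (x y z : α) : ℝ :=
  max (det3 u x y z) (L * δ * ang u δ x y)

theorem ang_comm (u : α → V3) (δ : ℝ) (x y : α) : ang u δ x y = ang u δ y x := by
  unfold ang; rw [norm_cross_comm]

theorem det3_eq (u : α → V3) (x y z : α) : det3 u x y z = |u y ⬝ᵥ (u x ⨯₃ u z)| := by
  unfold det3
  rw [triple_product_permutation, triple_product_permutation, ← cross_anticomm (u x) (u z),
    dotProduct_neg, abs_neg]

end Angles

namespace Config

variable {α ι : Type*} {K δ : ℝ} {M m : ℕ} {P : Finset α} {T : Finset ι} {a b : ι → V3}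
  {k : α → ℕ} {p : α → V3} {I : α → Finset ι} {u : α → V3}

variable (h : Config K δ M m P T a b k p I u)

include h

open Classical in
/-- The number of middle points on paths `x - y - z` of given type. -/
theorem card_mid_le {g : ℝ} (hg : 0 < g) (hgK : 10 ^ 12 * K ^ 6 * g ≤ 1) (hδg : δ ≤ g ^ 20)
    {x z : α} (hx : x ∈ P) (hz : z ∈ P) {τ σ : ℝ} (hσ : 0 < σ) (S : Finset α)
    (hS : ∀ y ∈ S, y ∈ P ∧ ∃ i ∈ I x, i ∈ I y ∧ ∃ j ∈ I z, j ∈ I y ∧ g ^ 8 ≤ ‖b i - b j‖)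
    (hS' : ∀ y ∈ S, g * τ ≤ ang u δ x y ∧ ang u δ x y < τ ∧ ang u δ y z < τ ∧
      σ ≤ vol3 u δ (g ^ 10)⁻¹ x y z) :
    (#S : ℝ) * (g ^ 19 * σ) ≤ M * δ := by
  have hδ := h.δ_pos
  have hK := h.one_le_K
  have hη := h.η_pos
  have hM := h.M_pos
  have hK6 : K ≤ K ^ 6 := le_self_pow₀ hK (by norm_num)
  have hK1 : 1 ≤ K ^ 6 := one_le_pow₀ hK
  have hgK1 : 10 ^ 12 * K * g ≤ 1 := le_trans (by gcongr) hgK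
  have hg1 : g ≤ 1 := by nlinarith
  have hKδ : 10 ^ 12 * (K * δ) ≤ g ^ 19 := by
    calc 10 ^ 12 * (K * δ) ≤ 10 ^ 12 * (K * g ^ 20) := by gcongr
      _ = (10 ^ 12 * K * g) * g ^ 19 := by ring
      _ ≤ 1 * g ^ 19 := by gcongr
      _ = _ := one_mul _
  have hg19 : g ^ 19 ≤ g ^ 8 := pow_le_pow_of_le_one hg.le hg1 (by norm_num)
  set τ₂ := σ * g ^ 10 / δ with hτ₂
  have hτ₂pos : 0 < τ₂ := by positivity
  set B := {y ∈ S | τ₂ ≤ ang u δ x y} with hB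
  set A := {y ∈ S | ¬ τ₂ ≤ ang u δ x y} with hA
  have hcard : (#S : ℝ) = #B + #A := by
    exact_mod_cast (card_filter_add_card_filter_not (s := S) (fun y => τ₂ ≤ ang u δ x y)).symm
  have hAle : (#A : ℝ) ≤ 10 ^ 10 * K ^ 4 * (M * δ / (g ^ 8 * σ)) := by
    rcases A.eq_empty_or_nonempty with he | ⟨y, hy⟩
    · rw [he]; simp; positivity
    have hyA := mem_filter.1 hy
    obtain ⟨h1, h2, h3, h4⟩ := hS' y hyA.1
    have h5 := not_le.1 hyA.2
    refine h.card_mid_of_det hx hz (ρ := g ^ 8) (by linarith) (pow_le_one₀ hg.le hg1) hσ ?_ A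
      (fun y hy => hS y (mem_filter.1 hy).1) ?_
    · have t1 := norm_cross_triangle (h.u_unit x) (h.u_unit y) (h.u_unit z)
      rw [norm_cross_comm (u z), norm_cross_comm (u y), norm_cross_comm (u z)] at t1
      have t2 : ‖u x ⨯₃ u y‖ < τ := (le_max_left _ _).trans_lt h2
      have t3 : ‖u y ⨯₃ u z‖ < τ := (le_max_left _ _).trans_lt h3
      have t4 : g * τ ≤ σ * g ^ 10 / δ := h1.trans h5.le
      rw [le_div_iff₀ hδ] at t4
      have t5 : τ * δ ≤ σ * g ^ 9 := by
        refine le_of_mul_le_mul_left ?_ hg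
        calc _ = g * τ * δ := by ring
          _ ≤ _ := t4
          _ = _ := by ring
      calc 12 * (K * δ) * ‖u x ⨯₃ u z‖ ≤ 12 * (K * δ) * (18 * τ) := by gcongr; linarith
        _ = 216 * K * (τ * δ) := by ring
        _ ≤ 216 * K * (σ * g ^ 9) := by gcongr
        _ = (216 * K * g) * (g ^ 8 * σ) := by ring
        _ ≤ 1 * (g ^ 8 * σ) := by
          gcongr
          nlinarith
        _ = _ := one_mul _
    · intro y hy
      have hyA := mem_filter.1 hy
      have h4 := (hS' y hyA.1).2.2.2
      have h5 := not_le.1 hyA.2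
      rw [hτ₂, lt_div_iff₀ hδ] at h5
      have h6 : (g ^ 10)⁻¹ * δ * ang u δ x y < σ := by
        rw [mul_assoc, inv_mul_lt_iff₀ (by positivity)]
        linarith
      rw [← det3_eq]
      rcases le_max_iff.1 h4 with h7 | h7
      · exact h7
      · linarith
  have hBle : (#B : ℝ) ≤ 10 ^ 8 * K ^ 6 * (M * δ / (g ^ 18 * σ)) := by
    have hsub : B ⊆ (I z).biUnion fun j => {y ∈ B | j ∈ I y ∧ ∃ i ∈ I x, i ∈ I y ∧
        g ^ 8 ≤ ‖b i - b j‖} := by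
      intro y hy
      obtain ⟨hyP, i, hi, hiy, j, hj, hjy, hij⟩ := hS y (mem_filter.1 hy).1
      exact mem_biUnion.2 ⟨j, hj, mem_filter.2 ⟨hy, hjy, i, hi, hiy, hij⟩⟩
    have hm := h.m_le ⟨x, hx⟩
    have hcount : ∀ C : ℝ, (∀ j ∈ I z, (#{y ∈ B | j ∈ I y ∧ ∃ i ∈ I x, i ∈ I y ∧
        g ^ 8 ≤ ‖b i - b j‖} : ℝ) ≤ C) → (#B : ℝ) ≤ m * C := by
      intro C hC
      have h1 : (#B : ℝ) ≤ ∑ j ∈ I z, (#{y ∈ B | j ∈ I y ∧ ∃ i ∈ I x, i ∈ I y ∧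
        g ^ 8 ≤ ‖b i - b j‖} : ℝ) := by
        exact_mod_cast (card_le_card hsub).trans card_biUnion_le
      refine h1.trans ((sum_le_card_nsmul _ _ _ hC).trans_eq ?_)
      rw [nsmul_eq_mul, h.I_card z hz]
    by_cases hcase : 8 * (K * δ) ≤ g ^ 8 * τ₂
    · have hδτ : δ < τ₂ := by
        have : g ^ 8 ≤ 1 := pow_le_one₀ hg.le hg1
        nlinarith
      have := hcount (10 ^ 4 * K ^ 4 * (M * δ / (g ^ 8 * τ₂))) fun j _ =>
        h.card_mid_of_angle hx (pow_le_one₀ hg.le hg1) hτ₂pos (by positivity) hcase _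
          (fun y hy => by
            obtain ⟨h1, h2, h3⟩ := mem_filter.1 hy
            exact ⟨(hS y (mem_filter.1 h1).1).1, h2, h3⟩)
          (fun y hy => by
            have h1 := (mem_filter.1 (mem_filter.1 hy).1).2
            rcases le_max_iff.1 h1 with h2 | h2
            · exact h2
            · linarith)
      calc (#B : ℝ) ≤ _ := this
        _ ≤ (8424 * K ^ 2 / δ) * (10 ^ 4 * K ^ 4 * (M * δ / (g ^ 8 * τ₂))) := by gcongr
        _ = (8424 * 10 ^ 4) * (K ^ 6 * (M * δ / (g ^ 18 * σ))) := by
          rw [hτ₂]; field_simp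
        _ ≤ 10 ^ 8 * (K ^ 6 * (M * δ / (g ^ 18 * σ))) := by gcongr; norm_num
        _ = _ := by ring
    · have := hcount (64 * K ^ 3 * M) fun j _ => h.card_tube_le (i := j) _ fun y hy => by
        obtain ⟨h1, h2, h3⟩ := mem_filter.1 hy
        exact ⟨(hS y (mem_filter.1 h1).1).1, h2⟩
      have h2 : g ^ 18 * σ ≤ 8 * K * δ ^ 2 := by
        have h3 := (not_le.1 hcase).le
        rw [hτ₂, ← mul_div_assoc, div_le_iff₀ hδ] at h3
        calc _ = g ^ 8 * (σ * g ^ 10) := by ring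
          _ ≤ _ := h3
          _ = _ := by ring
      calc (#B : ℝ) ≤ _ := this
        _ ≤ (8424 * K ^ 2 / δ) * (64 * K ^ 3 * M) := by gcongr
        _ = 8424 * 64 * K ^ 5 * M / δ * (g ^ 18 * σ) / (g ^ 18 * σ) := by field_simp
        _ ≤ 8424 * 64 * K ^ 5 * M / δ * (8 * K * δ ^ 2) / (g ^ 18 * σ) := by gcongr
        _ = (8424 * 64 * 8) * (K ^ 6 * (M * δ / (g ^ 18 * σ))) := by field_simp
        _ ≤ 10 ^ 8 * (K ^ 6 * (M * δ / (g ^ 18 * σ))) := by gcongr; norm_num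
        _ = _ := by ring
  have hA2 : 10 ^ 10 * K ^ 4 * (M * δ / (g ^ 8 * σ)) ≤
      10 ^ 10 * K ^ 6 * (M * δ / (g ^ 18 * σ)) := by
    have e1 : g ^ 18 ≤ g ^ 8 := pow_le_pow_of_le_one hg.le hg1 (by norm_num)
    have e2 : K ^ 4 ≤ K ^ 6 := pow_le_pow_right₀ hK (by norm_num)
    gcongr
  calc (#S : ℝ) * (g ^ 19 * σ) ≤ (2 * 10 ^ 10 * K ^ 6 * (M * δ / (g ^ 18 * σ))) * (g ^ 19 * σ) := by
        gcongr
        have : 0 ≤ K ^ 6 * (M * δ / (g ^ 18 * σ)) := by positivity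
        linarith
    _ = (2 * 10 ^ 10 * K ^ 6 * g) * (M * δ) := by field_simp
    _ ≤ 1 * (M * δ) := by
        gcongr
        nlinarith [mul_pos (pow_pos h.K_pos 6) hg]
    _ = _ := one_mul _

set_option maxHeartbeats 1600000 in
open Classical in
/-- All tubes through the end points of paths of given type lie in a small slab of directions. -/
theorem card_end_le {g : ℝ} (hg : 0 < g) (hgK : 10 ^ 12 * K ^ 6 * g ≤ 1)
    {x y' : α} (hx : x ∈ P) {τ σ : ℝ} (hσ : 0 < σ) (Z : Finset α)
    (hy' : g * τ ≤ ang u δ y' x ∧ ang u δ y' x < τ)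
    (hZ : ∀ z ∈ Z, z ∈ P ∧ ∃ y ∈ P, (∃ i ∈ I x, i ∈ I y ∧ ∃ j ∈ I y, j ∈ I z) ∧
      g * τ ≤ ang u δ x y ∧ ang u δ x y < τ ∧ ang u δ y z < τ ∧
      vol3 u δ (g ^ 10)⁻¹ x y z < σ ∧ vol3 u δ (g ^ 10)⁻¹ y' x y < σ) :
    (#Z : ℝ) * m * (g ^ 4 * δ ^ 3) ≤ M * σ := by
  have hδ := h.δ_pos
  have hδ1 := h.δ_le
  have hK := h.one_le_K
  have hη := h.η_pos
  have hM := h.M_pos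
  have hK6 : K ≤ K ^ 6 := le_self_pow₀ hK (by norm_num)
  have hK5 : K ^ 5 ≤ K ^ 6 := pow_le_pow_right₀ hK (by norm_num)
  have hK1 : 1 ≤ K ^ 6 := one_le_pow₀ hK
  have hg1 : g ≤ 1 := by nlinarith
  have hg10 : g ^ 10 ≤ 1 := pow_le_one₀ hg.le hg1
  have hg9 : g ^ 9 ≤ 1 := pow_le_one₀ hg.le hg1
  have hτδ : δ < τ := (le_max_right _ _).trans_lt hy'.2
  have hτ : 0 < τ := hδ.trans hτδ
  rcases Z.eq_empty_or_nonempty with he | ⟨z₀, hz₀⟩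
  · rw [he]; simp; positivity
  obtain ⟨-, y₀, -, ⟨i₀, hi₀, -⟩, hy₀, -, -, hv₀, -⟩ := hZ z₀ hz₀
  have hvol : (g ^ 10)⁻¹ * δ * ang u δ x y₀ < σ := (le_max_right _ _).trans_lt hv₀
  rw [mul_assoc, inv_mul_lt_iff₀ (by positivity)] at hvol
  have hστ : δ * τ ≤ σ := by
    have h1 : δ * (g * τ) ≤ g ^ 10 * σ := le_trans (by gcongr) hvol.le
    have h2 : δ * τ ≤ g ^ 9 * σ := by
      refine le_of_mul_le_mul_left ?_ hg
      calc _ = δ * (g * τ) := by ring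
        _ ≤ _ := h1
        _ = _ := by ring
    nlinarith
  have hσδ : δ ^ 2 ≤ σ := by nlinarith
  have hKg : 10 ^ 9 * K ^ 2 * g ≤ 1 := by
    refine le_trans ?_ hgK
    have : K ^ 2 ≤ K ^ 6 := pow_le_pow_right₀ hK (by norm_num)
    gcongr
    · norm_num
    · norm_num
  set B := Z.biUnion I with hB
  have hBT : ∀ l ∈ B, l ∈ T := by
    intro l hl
    obtain ⟨z, hz, hlz⟩ := mem_biUnion.1 hl
    exact h.I_sub z (hZ z hz).1 hlz
  have hnorm2 : ∀ i ∈ T, ∀ j ∈ T, ‖b i - b j‖ ≤ 2 := fun i hi j hj => by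
    have := h.b_le i hi
    have := h.b_le j hj
    exact (norm_sub_le _ _).trans (by linarith)
  have hi₀T := h.I_sub x hx hi₀
  have hKδ : K * δ ≤ K := by nlinarith
  have hstruct : ∀ l ∈ B, ∃ z y, ∃ rz ry rx : ℝ, ∃ f : V3,
      b l - b i₀ = rz • u z + ry • u y + rx • u x + f ∧ ‖f‖ ≤ 3 * (K * δ) ∧ |rz| ≤ 6 * K ∧
      |ry| ≤ 6 * K ∧ g * τ ≤ ang u δ x y ∧ ang u δ x y < τ ∧ ang u δ y z < τ ∧
      vol3 u δ (g ^ 10)⁻¹ x y z < σ ∧ vol3 u δ (g ^ 10)⁻¹ y' x y < σ := by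
    intro l hl
    obtain ⟨z, hz, hlz⟩ := mem_biUnion.1 hl
    obtain ⟨hzP, y, hyP, ⟨i, hix, hiy, j, hjy, hjz⟩, hrest⟩ := hZ z hz
    obtain ⟨rz, hrz⟩ := h.line z hzP l hlz j hjz
    obtain ⟨ry, hry⟩ := h.line y hyP j hjy i hiy
    obtain ⟨rx, hrx⟩ := h.line x hx i hix i₀ hi₀
    have hjT := h.I_sub y hyP hjy
    have hiT := h.I_sub y hyP hiy
    have b1 := abs_le_of_norm_smul_unit (h.u_unit z) hrz (hnorm2 l (hBT l hl) j hjT)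
    have b2 := abs_le_of_norm_smul_unit (h.u_unit y) hry (hnorm2 j hjT i hiT)
    refine ⟨z, y, rz, ry, rx, (b l - b j - rz • u z) + (b j - b i - ry • u y)
      + (b i - b i₀ - rx • u x), by abel, ?_, by linarith, by linarith, hrest⟩
    exact norm_add₃_le.trans (by linarith)
  have hcross : ∀ l ∈ B, ‖(b l - b i₀) ⨯₃ u x‖ ≤ 120 * K * τ := by
    intro l hl
    obtain ⟨z, y, rz, ry, rx, f, hv, hf, hrz, hry, -, h2, h3, -, -⟩ := hstruct l hl
    have t1 := norm_cross_triangle (h.u_unit x) (h.u_unit y) (h.u_unit z)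
    rw [norm_cross_comm (u y), norm_cross_comm (u z) (u y)] at t1
    have t2 : ‖u x ⨯₃ u y‖ < τ := (le_max_left _ _).trans_lt h2
    have t3 : ‖u y ⨯₃ u z‖ < τ := (le_max_left _ _).trans_lt h3
    have e : (b l - b i₀) ⨯₃ u x = rz • (u z ⨯₃ u x) + ry • (u y ⨯₃ u x) + f ⨯₃ u x := by
      rw [hv]; simp
    rw [e]
    have n1 : ‖rz • (u z ⨯₃ u x)‖ ≤ 6 * K * (18 * τ) := by
      rw [norm_smul, Real.norm_eq_abs]; gcongr; linarith
    have n2 : ‖ry • (u y ⨯₃ u x)‖ ≤ 6 * K * τ := by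
      rw [norm_smul, Real.norm_eq_abs, norm_cross_comm]; gcongr
    have n3 := norm_cross_le_of_unit (h.u_unit x) f
    have n4 : K * δ ≤ K * τ := by gcongr
    exact norm_add₃_le.trans (by linarith)
  have hBcard : (#B : ℝ) * (g ^ 3 * δ ^ 3) ≤ σ := by
    have hsep : ∀ i ∈ B, ∀ j ∈ B, i ≠ j → δ ≤ ‖b i - b j‖ := fun i hi j hj hne =>
      h.b_sep i (hBT i hi) j (hBT j hj) hne
    have hlen : ∀ i ∈ B, ‖b i - b i₀‖ ≤ 2 := fun i hi => hnorm2 i (hBT i hi) i₀ hi₀T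
    have e26 : 12 * 2 / δ + 2 ≤ 26 / δ := by
      rw [div_add' _ _ _ hδ.ne']; gcongr; linarith
    by_cases hcase : g * τ ≤ δ
    · have h1 := card_le_of_line (S := B) (v := b) (c := b i₀) (u := u x) (A₁ := 2)
        (A₂ := 120 * K * τ) hδ (by norm_num) (by positivity) (h.u_unit x) hsep hlen hcross
      have h2 : 8 * (120 * K * τ) / δ + 2 ≤ 962 * K / g := by
        have h3 : τ / δ ≤ 1 / g := by
          rw [div_le_div_iff₀ hδ hg]; linarith
        have h4 : 2 ≤ 2 * K / g := by
          rw [le_div_iff₀ hg]; nlinarith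
        calc 8 * (120 * K * τ) / δ + 2 = 960 * K * (τ / δ) + 2 := by ring
          _ ≤ 960 * K * (1 / g) + 2 * K / g := by gcongr
          _ = _ := by ring
      calc (#B : ℝ) * (g ^ 3 * δ ^ 3) ≤ (26 / δ * (962 * K / g) ^ 2) * (g ^ 3 * δ ^ 3) := by
            gcongr
            refine h1.trans ?_
            gcongr
        _ = (26 * 962 ^ 2 * K ^ 2 * g) * δ ^ 2 := by field_simp
        _ ≤ 1 * δ ^ 2 := by
            gcongr
            refine le_trans ?_ hKg
            gcongr
            norm_num
        _ ≤ σ := by linarith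
    · have hcase' := not_le.1 hcase
      have hgτ : 0 < g * τ := by positivity
      have hω : ∀ w w', g * τ ≤ ang u δ w w' → g * τ ≤ ‖u w ⨯₃ u w'‖ := fun w w' hw => by
        rcases le_max_iff.1 hw with h1 | h1
        · exact h1
        · linarith
      have hnormal : ∀ l ∈ B, |(b l - b i₀) ⬝ᵥ (u y' ⨯₃ u x)| ≤ 129 * K * σ / g := by
        intro l hl
        obtain ⟨z, y, rz, ry, rx, f, hv, hf, hrz, hry, h1, h2, h3, h4, h5⟩ := hstruct l hl
        have t1 := norm_cross_triangle (h.u_unit x) (h.u_unit y) (h.u_unit z)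
        rw [norm_cross_comm (u y), norm_cross_comm (u z) (u y)] at t1
        have t2 : ‖u x ⨯₃ u y‖ < τ := (le_max_left _ _).trans_lt h2
        have t3 : ‖u y ⨯₃ u z‖ < τ := (le_max_left _ _).trans_lt h3
        have t4 : ‖u y' ⨯₃ u x‖ < τ := (le_max_left _ _).trans_lt hy'.2
        have d1 : |u z ⬝ᵥ (u x ⨯₃ u y)| < σ := (le_max_left _ _).trans_lt h4
        have d2 : |u y ⬝ᵥ (u y' ⨯₃ u x)| < σ := (le_max_left _ _).trans_lt h5
        have q1 := abs_det_mul_norm_cross_le (u y') (u x) (u y) (u z)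
        have q2 : |u z ⬝ᵥ (u y' ⨯₃ u x)| ≤ 19 * σ / g := by
          rw [le_div_iff₀ hg]
          refine le_of_mul_le_mul_right ?_ hτ
          have r1 := hω x y h1
          rw [norm_cross_comm] at r1
          calc |u z ⬝ᵥ (u y' ⨯₃ u x)| * g * τ = |u z ⬝ᵥ (u y' ⨯₃ u x)| * (g * τ) := by ring
            _ ≤ |u z ⬝ᵥ (u y' ⨯₃ u x)| * ‖u y ⨯₃ u x‖ := by gcongr
            _ ≤ _ := q1
            _ ≤ σ * (18 * τ) + σ * τ := by
              gcongr
              linarith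
            _ = _ := by ring
        have e : (b l - b i₀) ⬝ᵥ (u y' ⨯₃ u x) = rz * (u z ⬝ᵥ (u y' ⨯₃ u x))
            + ry * (u y ⬝ᵥ (u y' ⨯₃ u x)) + f ⬝ᵥ (u y' ⨯₃ u x) := by
          rw [hv]
          simp only [add_dotProduct, smul_dotProduct, smul_eq_mul, dot_cross_self]
          ring
        rw [e]
        refine (abs_add_three _ _ _).trans ?_
        rw [abs_mul, abs_mul]
        have n3 := abs_dotProduct_le f (u y' ⨯₃ u x)
        have n4 : 3 * ‖f‖ * ‖u y' ⨯₃ u x‖ ≤ 3 * (3 * (K * δ)) * τ := by gcongr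
        have n5 : K * (δ * τ) ≤ K * σ := by gcongr
        have n6 : K * σ ≤ K * σ / g := by
          rw [le_div_iff₀ hg]
          have : 0 < K * σ := by positivity
          nlinarith
        calc _ ≤ 6 * K * (19 * σ / g) + 6 * K * σ + 3 * (3 * (K * δ)) * τ := by
              gcongr
              exact n3.trans n4
          _ = 114 * (K * σ / g) + 6 * (K * σ) + 9 * (K * (δ * τ)) := by ring
          _ ≤ 129 * (K * σ / g) := by linarith
          _ = _ := by ring
      have h1 := card_le_of_slab (S := B) (v := b) (c := b i₀) (u := u x) (u' := u y') (A₁ := 2)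
        (A₂ := 120 * K * τ) (A₃ := 129 * K * σ / g) hδ (by norm_num) (by positivity)
        (by positivity) hgτ (h.u_unit x) (hω _ _ hy'.1) hsep hlen hcross hnormal
      have h2 : 8 * (120 * K * τ) / δ + 2 ≤ 962 * K * τ / δ := by
        have h4 : 2 ≤ 2 * K * τ / δ := by
          rw [le_div_iff₀ hδ]; nlinarith
        calc 8 * (120 * K * τ) / δ + 2 ≤ 8 * (120 * K * τ) / δ + 2 * K * τ / δ := by gcongr
          _ = _ := by ring
      have h3 : 4 * (129 * K * σ / g) / (g * τ * δ) + 2 ≤ 518 * K * σ / (g ^ 2 * τ * δ) := by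
        have h4 : 2 ≤ 2 * K * σ / (g ^ 2 * τ * δ) := by
          rw [le_div_iff₀ (by positivity)]
          have : g ^ 2 * (δ * τ) ≤ 1 * σ := by
            gcongr
            exact pow_le_one₀ hg.le hg1
          nlinarith
        calc _ ≤ 4 * (129 * K * σ / g) / (g * τ * δ) + 2 * K * σ / (g ^ 2 * τ * δ) := by gcongr
          _ = _ := by field_simp; ring
      calc (#B : ℝ) * (g ^ 3 * δ ^ 3) ≤ (26 / δ * (962 * K * τ / δ) *
            (518 * K * σ / (g ^ 2 * τ * δ))) * (g ^ 3 * δ ^ 3) := by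
            gcongr
            refine h1.trans ?_
            gcongr
        _ = (26 * 962 * 518 * K ^ 2 * g) * σ := by field_simp
        _ ≤ 1 * σ := by
            gcongr
            refine le_trans ?_ hKg
            gcongr
            norm_num
        _ = σ := one_mul _
  have hdouble : (#Z : ℝ) * m ≤ #B * (64 * K ^ 3 * M) := by
    have h1 : ∑ z ∈ Z, #{l ∈ B | l ∈ I z} = ∑ l ∈ B, #{z ∈ Z | l ∈ I z} :=
      sum_card_bipartiteAbove_eq_sum_card_bipartiteBelow fun z l => l ∈ I z
    have h2 : ∑ z ∈ Z, #{l ∈ B | l ∈ I z} = #Z * m := by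
      refine sum_const_nat fun z hz => ?_
      rw [← h.I_card z (hZ z hz).1]
      congr 1
      ext l
      simp only [mem_filter, and_iff_right_iff_imp]
      exact fun hl => mem_biUnion.2 ⟨z, hz, hl⟩
    rw [h2] at h1
    have h3 : (#Z : ℝ) * m = ∑ l ∈ B, (#{z ∈ Z | l ∈ I z} : ℝ) := by exact_mod_cast h1
    rw [h3]
    refine (sum_le_card_nsmul _ _ _ fun l _ => h.card_tube_le (i := l) _ fun z hz => ?_).trans_eq ?_
    · exact ⟨(hZ z (mem_filter.1 hz).1).1, (mem_filter.1 hz).2⟩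
    · rw [nsmul_eq_mul]
  calc (#Z : ℝ) * m * (g ^ 4 * δ ^ 3) ≤ #B * (64 * K ^ 3 * M) * (g ^ 4 * δ ^ 3) := by gcongr
    _ = (64 * K ^ 3 * g) * M * (#B * (g ^ 3 * δ ^ 3)) := by ring
    _ ≤ 1 * M * σ := by
        have : 64 * K ^ 3 * g ≤ 1 := by
          refine le_trans ?_ hgK
          have : K ^ 3 ≤ K ^ 6 := pow_le_pow_right₀ hK (by norm_num)
          gcongr
          norm_num
        gcongr
    _ = _ := by ring

end Config

end Planebrush

namespace Planebrush

open Matrix Finset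

section Walk

variable {α ι : Type*} {P : Finset α} {T : Finset ι} {I : α → Finset ι} {m : ℕ}

open Classical in
/-- The number of points on the tube `i`. -/
noncomputable def deg (P : Finset α) (I : α → Finset ι) (i : ι) : ℕ := #{q ∈ P | i ∈ I q}

open Classical in
/-- The transition weights of the random walk from points to points along tubes. -/
noncomputable def walk (P : Finset α) (I : α → Finset ι) (m : ℕ) (x : α) (e : ι × α) : ℝ :=
  if e.1 ∈ I x ∧ e.1 ∈ I e.2 then (m * deg P I e.1 : ℝ)⁻¹ else 0

theorem walk_nonneg (x : α) (e : ι × α) : 0 ≤ walk P I m x e := by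
  unfold walk
  split_ifs <;> positivity

open Classical in
theorem avg_walk_eq (hI : ∀ q ∈ P, I q ⊆ T) {x : α} (hx : x ∈ P) (f : ι × α → ℝ) :
    avg (T ×ˢ P) (walk P I m) x f =
      ∑ i ∈ I x, ∑ y ∈ P with i ∈ I y, (m * deg P I i : ℝ)⁻¹ * f (i, y) := by
  unfold avg
  rw [sum_product, ← sum_subset (hI x hx)]
  · refine sum_congr rfl fun i hi => ?_
    rw [sum_filter]
    refine sum_congr rfl fun y _ => ?_
    simp only [walk, hi, true_and]
    split_ifs <;> simp
  · intro i _ hi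
    refine sum_eq_zero fun y _ => ?_
    simp [walk, hi]

theorem deg_pos {x : α} (hx : x ∈ P) {i : ι} (hi : i ∈ I x) : 0 < deg P I i := by
  classical
  exact card_pos.2 ⟨x, mem_filter.2 ⟨hx, hi⟩⟩

theorem avg_walk_tube (hI : ∀ q ∈ P, I q ⊆ T) {x : α} (hx : x ∈ P) (f : ι → ℝ) :
    avg (T ×ˢ P) (walk P I m) x (fun e => f e.1) = ∑ i ∈ I x, (m : ℝ)⁻¹ * f i := by
  classical
  rw [avg_walk_eq hI hx]
  refine sum_congr rfl fun i hi => ?_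
  have hd : (0 : ℝ) < deg P I i := by exact_mod_cast deg_pos hx hi
  dsimp only
  rw [sum_const, nsmul_eq_mul]
  change (deg P I i : ℝ) * _ = _
  rw [mul_inv]
  field_simp

theorem sum_walk (hI : ∀ q ∈ P, I q ⊆ T) (hm : 1 ≤ m) {x : α} (hx : x ∈ P) (hc : #(I x) = m) :
    ∑ e ∈ T ×ˢ P, walk P I m x e = 1 := by
  have h := avg_walk_tube (m := m) hI hx (fun _ => 1)
  simp only [avg, mul_one, sum_const, hc, nsmul_eq_mul] at h
  rw [h, mul_inv_cancel₀]
  have : 0 < m := hm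
  positivity

theorem sum_avg_walk_symm (h : α → α → ℝ) :
    ∑ x ∈ P, avg (T ×ˢ P) (walk P I m) x (fun e => h x e.2) =
      ∑ x ∈ P, avg (T ×ˢ P) (walk P I m) x (fun e => h e.2 x) := by
  simp only [avg, sum_product]
  rw [sum_comm]
  conv_rhs => rw [sum_comm]
  refine sum_congr rfl fun i _ => ?_
  conv_rhs => rw [sum_comm]
  refine sum_congr rfl fun x _ => sum_congr rfl fun y _ => ?_
  simp only [walk]
  by_cases h1 : i ∈ I x <;> by_cases h2 : i ∈ I y <;> simp [h1, h2]

/-- If `f x e` is bounded on the support of the walk then so is its average. -/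
theorem avg_walk_le (hI : ∀ q ∈ P, I q ⊆ T) (hm : 1 ≤ m) {x : α} (hx : x ∈ P) (hc : #(I x) = m)
    {f : ι × α → ℝ} {C : ℝ} (hC : ∀ i ∈ I x, ∀ y ∈ P, i ∈ I y → f (i, y) ≤ C) :
    avg (T ×ˢ P) (walk P I m) x f ≤ C := by
  classical
  rw [← avg_const (sum_walk hI hm hx hc) C, avg_walk_eq hI hx, avg_walk_eq hI hx]
  refine sum_le_sum fun i hi => sum_le_sum fun y hy => ?_
  have := hC i hi y (mem_filter.1 hy).1 (mem_filter.1 hy).2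
  gcongr

open Classical in
/-- A step of the walk uses a tube with few points with small probability. -/
theorem sum_avg_deg_lt (hI : ∀ q ∈ P, I q ⊆ T) (d₀ : ℝ) :
    ∑ x ∈ P, avg (T ×ˢ P) (walk P I m) x (fun e => if (deg P I e.1 : ℝ) < d₀ then 1 else 0) ≤
      (m : ℝ)⁻¹ * (#T * max d₀ 0) := by
  have h1 : ∀ x ∈ P, avg (T ×ˢ P) (walk P I m) x
      (fun e => if (deg P I e.1 : ℝ) < d₀ then 1 else 0) =
      ∑ i ∈ T, if i ∈ I x then (m : ℝ)⁻¹ * (if (deg P I i : ℝ) < d₀ then 1 else 0) else 0 := by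
    intro x hx
    rw [avg_walk_tube hI hx (fun i => if (deg P I i : ℝ) < d₀ then 1 else 0), ← sum_filter]
    refine sum_congr ?_ fun _ _ => rfl
    ext i
    simp only [mem_filter]
    exact ⟨fun hi => ⟨hI x hx hi, hi⟩, fun hi => hi.2⟩
  rw [sum_congr rfl h1, sum_comm, ← nsmul_eq_mul, ← sum_const, mul_sum]
  refine sum_le_sum fun i _ => ?_
  rw [← sum_filter, sum_const, nsmul_eq_mul]
  change (deg P I i : ℝ) * _ ≤ _
  split_ifs with hd
  · rw [mul_one, mul_comm]
    gcongr
    exact hd.le.trans (le_max_left _ _)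
  · rw [mul_zero, mul_zero]; positivity

end Walk

theorem card_le_mul_card_image_real {α β : Type*} [DecidableEq β] {f : α → β} (S : Finset α)
    {C : ℝ} (h : ∀ b ∈ S.image f, (#{a ∈ S | f a = b} : ℝ) ≤ C) :
    (#S : ℝ) ≤ C * #(S.image f) := by
  rw [card_eq_sum_card_image f S]
  push_cast
  exact (sum_le_card_nsmul _ _ _ h).trans_eq (by rw [nsmul_eq_mul, mul_comm])

namespace Config

variable {α ι : Type*} {K δ : ℝ} {M m : ℕ} {P : Finset α} {T : Finset ι} {a b : ι → V3}
  {k : α → ℕ} {p : α → V3} {I : α → Finset ι} {u : α → V3}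

variable (h : Config K δ M m P T a b k p I u)

include h

/-- The number of incidences is at most a constant times the total length of the tubes. -/
theorem incidence_le : (#P : ℝ) * m ≤ 64 * K ^ 3 * (M * #T) := by
  classical
  have h1 : ∑ q ∈ P, #{l ∈ T | l ∈ I q} = ∑ l ∈ T, #{q ∈ P | l ∈ I q} :=
    sum_card_bipartiteAbove_eq_sum_card_bipartiteBelow fun q l => l ∈ I q
  have h2 : ∑ q ∈ P, #{l ∈ T | l ∈ I q} = #P * m := by
    refine sum_const_nat fun q hq => ?_
    rw [← h.I_card q hq]
    congr 1
    ext l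
    simp only [mem_filter, and_iff_right_iff_imp]
    exact fun hl => h.I_sub q hq hl
  rw [h2] at h1
  have h3 : (#P : ℝ) * m = ∑ l ∈ T, (#{q ∈ P | l ∈ I q} : ℝ) := by exact_mod_cast h1
  rw [h3]
  refine (sum_le_card_nsmul _ _ _ fun l _ => h.card_tube_le (i := l) _ fun q hq => ?_).trans_eq ?_
  · exact ⟨(mem_filter.1 hq).1, (mem_filter.1 hq).2⟩
  · rw [nsmul_eq_mul]; ring

open Classical in
theorem avg_close_le (hm : 1 ≤ m) {x : α} (hx : x ∈ P) {s d₀ : ℝ} (hs : 1 ≤ s * M) (hd : 0 < d₀) :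
    avg (T ×ˢ P) (walk P I m) x (fun e => if d₀ ≤ deg P I e.1 ∧
      |time k M x - time k M e.2| < s then 1 else 0) ≤ 256 * K ^ 3 * (s * M) / d₀ := by
  have hK := h.K_pos
  have hM := h.M_pos
  have hs0 : 0 < s := by
    by_contra! hcon
    nlinarith
  have hm' : (0 : ℝ) < m := by exact_mod_cast hm
  rw [avg_walk_eq h.I_sub hx]
  have key : ∀ i ∈ I x, ∑ y ∈ P with i ∈ I y, (m * deg P I i : ℝ)⁻¹ *
      (if d₀ ≤ (deg P I i : ℝ) ∧ |time k M x - time k M y| < s then 1 else 0) ≤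
      (m : ℝ)⁻¹ * (256 * K ^ 3 * (s * M) / d₀) := by
    intro i hi
    by_cases hdi : d₀ ≤ (deg P I i : ℝ)
    · simp only [hdi, true_and]
      rw [← mul_sum, ← sum_filter, sum_const, nsmul_eq_mul, mul_one, mul_inv, mul_assoc]
      gcongr
      rw [inv_mul_eq_div]
      gcongr
      have := h.card_tube_interval_le (i := i)
        {y ∈ {y ∈ P | i ∈ I y} | |time k M x - time k M y| < s} (fun y hy => by
          simpa using (mem_filter.1 hy).1) (c := time k M x) hs0.le (fun y hy => by
          rw [abs_sub_comm]; exact (mem_filter.1 hy).2.le)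
      refine this.trans ?_
      calc 64 * K ^ 3 * (2 * (s * M) + 2) ≤ 64 * K ^ 3 * (2 * (s * M) + 2 * (s * M)) := by
            gcongr; linarith
        _ = _ := by ring
    · simp only [hdi, false_and, if_false, mul_zero, sum_const_zero]
      positivity
  refine (sum_le_card_nsmul _ _ _ key).trans_eq ?_
  rw [nsmul_eq_mul, h.I_card x hx]
  field_simp

open Classical in
/-- The number of paths of given type. -/
theorem card_paths_le {g : ℝ} (hg : 0 < g) (hgK : 10 ^ 12 * K ^ 6 * g ≤ 1) (hδg : δ ≤ g ^ 20)
    {s : ℝ} (hs : 0 < s) (hs1 : s ≤ 1) (hm : 1 ≤ m)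
    {x y' : α} (hx : x ∈ P) {τ σ : ℝ} (hσ : 0 < σ)
    (hy' : g * τ ≤ ang u δ y' x ∧ ang u δ y' x < τ) (G : Finset ((ι × α) × (ι × α)))
    (hG : ∀ w ∈ G, w.1.2 ∈ P ∧ w.2.2 ∈ P ∧ w.1.1 ∈ I x ∧ w.1.1 ∈ I w.1.2 ∧ w.2.1 ∈ I w.1.2 ∧
      w.2.1 ∈ I w.2.2 ∧ g ^ 8 ≤ ‖b w.1.1 - b w.2.1‖ ∧ s ≤ |time k M x - time k M w.1.2| ∧
      s ≤ |time k M w.1.2 - time k M w.2.2| ∧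
      g * τ ≤ ang u δ x w.1.2 ∧ ang u δ x w.1.2 < τ ∧ ang u δ w.1.2 w.2.2 < τ ∧
      g * σ ≤ vol3 u δ (g ^ 10)⁻¹ x w.1.2 w.2.2 ∧ vol3 u δ (g ^ 10)⁻¹ x w.1.2 w.2.2 < σ ∧
      vol3 u δ (g ^ 10)⁻¹ y' x w.1.2 < σ) :
    (#G : ℝ) * m * (s ^ 6 * g ^ 25 * δ ^ 2) ≤ M ^ 2 := by
  have hδ := h.δ_pos
  have hK := h.one_le_K
  have hM := h.M_pos
  have hm' : (0 : ℝ) < m := by exact_mod_cast hm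
  set A : ℝ := (10 ^ 3 * K ^ 3 / s ^ 3) ^ 2 with hA
  set B : ℝ := M * δ / (g ^ 20 * σ) with hB
  have h1 : ∀ z ∈ G.image (fun w => w.2.2), ∀ y ∈ ({w ∈ G | w.2.2 = z}).image (fun w => w.1.2),
      (#{w ∈ {w ∈ G | w.2.2 = z} | w.1.2 = y} : ℝ) ≤ A := by
    intro z hz y hy
    obtain ⟨w₀, hw₀, rfl⟩ := mem_image.1 hy
    obtain ⟨hw₀G, rfl⟩ := mem_filter.1 hw₀
    obtain ⟨hy₀, hz₀, -, -, -, -, -, ht₁, ht₂, -⟩ := hG w₀ hw₀G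
    have hinj : #{w ∈ {w ∈ G | w.2.2 = w₀.2.2} | w.1.2 = w₀.1.2} ≤
        #({i ∈ I x | i ∈ I w₀.1.2} ×ˢ {i ∈ I w₀.1.2 | i ∈ I w₀.2.2}) := by
      refine card_le_card_of_injOn (fun w => (w.1.1, w.2.1)) ?_ ?_
      · intro w hw
        obtain ⟨hw1, hw2⟩ := mem_filter.1 hw
        obtain ⟨hw1, hw3⟩ := mem_filter.1 hw1
        obtain ⟨-, -, c1, c2, c3, c4, -⟩ := hG w hw1
        rw [hw2] at c2 c3
        rw [hw3] at c4
        exact mem_product.2 ⟨mem_filter.2 ⟨c1, c2⟩, mem_filter.2 ⟨c3, c4⟩⟩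
      · intro w hw w' hw' heq
        obtain ⟨hw1, hw2⟩ := mem_filter.1 hw
        obtain ⟨hw1, hw3⟩ := mem_filter.1 hw1
        obtain ⟨hv1, hv2⟩ := mem_filter.1 hw'
        obtain ⟨hv1, hv3⟩ := mem_filter.1 hv1
        simp only [Prod.mk.injEq] at heq
        exact Prod.ext (Prod.ext heq.1 (hw2.trans hv2.symm))
          (Prod.ext heq.2 (hw3.trans hv3.symm))
    rw [card_product] at hinj
    have e1 := h.card_common_le hx hy₀ hs hs1 ht₁ {i ∈ I x | i ∈ I w₀.1.2}
      fun i hi => mem_filter.1 hi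
    have e2 := h.card_common_le hy₀ hz₀ hs hs1 ht₂ {i ∈ I w₀.1.2 | i ∈ I w₀.2.2}
      fun i hi => mem_filter.1 hi
    calc _ ≤ (#{i ∈ I x | i ∈ I w₀.1.2} : ℝ) * #{i ∈ I w₀.1.2 | i ∈ I w₀.2.2} := by
          exact_mod_cast hinj
      _ ≤ (10 ^ 3 * K ^ 3 / s ^ 3) * (10 ^ 3 * K ^ 3 / s ^ 3) := by gcongr
      _ = A := by rw [hA]; ring
  have h2 : ∀ z ∈ G.image (fun w => w.2.2), (#{w ∈ G | w.2.2 = z} : ℝ) ≤ A * B := by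
    intro z hz
    refine (card_le_mul_card_image_real _ (h1 z hz)).trans ?_
    gcongr
    obtain ⟨w₀, hw₀, hwz⟩ := mem_image.1 hz
    have hzP : z ∈ P := hwz ▸ (hG w₀ hw₀).2.1
    rw [hB, le_div_iff₀ (by positivity)]
    have := h.card_mid_le hg hgK hδg hx hzP (τ := τ) (σ := g * σ) (by positivity)
      (({w ∈ G | w.2.2 = z}).image (fun w => w.1.2)) ?_ ?_
    · calc _ = (#(({w ∈ G | w.2.2 = z}).image (fun w => w.1.2)) : ℝ) * (g ^ 19 * (g * σ)) := by ring
        _ ≤ _ := this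
    · intro y hy
      obtain ⟨w, hw, rfl⟩ := mem_image.1 hy
      obtain ⟨hwG, rfl⟩ := mem_filter.1 hw
      obtain ⟨hyP, hzP, c1, c2, c3, c4, c5, -⟩ := hG w hwG
      exact ⟨hyP, _, c1, c2, _, c4, c3, c5⟩
    · intro y hy
      obtain ⟨w, hw, rfl⟩ := mem_image.1 hy
      obtain ⟨hwG, rfl⟩ := mem_filter.1 hw
      obtain ⟨-, -, -, -, -, -, -, -, -, c1, c2, c3, c4, -⟩ := hG w hwG
      exact ⟨c1, c2, c3, c4⟩
  have h3 := card_le_mul_card_image_real G h2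
  have h4 := h.card_end_le hg hgK hx hσ (G.image (fun w => w.2.2)) hy' (by
    intro z hz
    obtain ⟨w, hw, rfl⟩ := mem_image.1 hz
    obtain ⟨hyP, hzP, c1, c2, c3, c4, -, -, -, c5, c6, c7, -, c8, c9⟩ := hG w hw
    exact ⟨hzP, _, hyP, ⟨_, c1, c2, _, c3, c4⟩, c5, c6, c7, c8, c9⟩)
  have hAB : 0 ≤ A * B := by positivity
  calc (#G : ℝ) * m * (s ^ 6 * g ^ 25 * δ ^ 2)
      ≤ (A * B * #(G.image (fun w => w.2.2))) * m * (s ^ 6 * g ^ 25 * δ ^ 2) := by gcongr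
    _ = (10 ^ 6 * K ^ 6 * g) * (M / σ) *
        (#(G.image (fun w => w.2.2)) * m * (g ^ 4 * δ ^ 3)) := by
      rw [hA, hB]; field_simp
    _ ≤ 1 * (M / σ) * (M * σ) := by
      gcongr
      refine le_trans ?_ hgK
      gcongr
      · norm_num
      · norm_num
    _ = _ := by field_simp

end Config

end Planebrush

namespace Planebrush

open Matrix Finset

namespace Config

variable {α ι : Type*} {K δ : ℝ} {M m : ℕ} {P : Finset α} {T : Finset ι} {a b : ι → V3}
  {k : α → ℕ} {p : α → V3} {I : α → Finset ι} {u : α → V3}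

/-- Two consecutive steps of the walk with degenerate behaviour. -/
def BadPath (b : ι → V3) (k : α → ℕ) (I : α → Finset ι) (P : Finset α) (M : ℕ) (d₀ s ρ : ℝ)
    (x : α) (e e' : ι × α) : Prop :=
  ((deg P I e.1 : ℝ) < d₀ ∨ d₀ ≤ deg P I e.1 ∧ |time k M x - time k M e.2| < s) ∨
  ((deg P I e'.1 : ℝ) < d₀ ∨ d₀ ≤ deg P I e'.1 ∧ |time k M e.2 - time k M e'.2| < s) ∨
  ‖b e.1 - b e'.1‖ < ρ

/-- At no point is a positive proportion of the directions concentrated in a small ball. -/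
def IsBroad (b : ι → V3) (I : α → Finset ι) (P : Finset α) (m : ℕ) (g : ℝ) : Prop :=
  ∀ q ∈ P, ∀ i ∈ I q, ∀ S ⊆ I q, (∀ j ∈ S, ‖b i - b j‖ < g ^ 8) → (#S : ℝ) ≤ 27 * g * m

variable (h : Config K δ M m P T a b k p I u)

include h

open Classical in
theorem sum_avg_step_le (hm : 1 ≤ m) {s d₀ : ℝ} (hs : 1 ≤ s * M) (hd : 0 < d₀) :
    ∑ x ∈ P, avg (T ×ˢ P) (walk P I m) x (fun e => if (deg P I e.1 : ℝ) < d₀ ∨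
      d₀ ≤ deg P I e.1 ∧ |time k M x - time k M e.2| < s then 1 else 0) ≤
      (m : ℝ)⁻¹ * (#T * d₀) + 256 * K ^ 3 * (s * M) / d₀ * #P := by
  have h1 := sum_avg_deg_lt (m := m) h.I_sub d₀
  rw [max_eq_left hd.le] at h1
  have h2 := sum_le_sum fun x hx => h.avg_close_le hm hx hs hd
  rw [sum_const, nsmul_eq_mul, mul_comm (#P : ℝ)] at h2
  refine le_trans ?_ (add_le_add h1 h2)
  rw [← sum_add_distrib]
  refine sum_le_sum fun x hx => ?_
  rw [← avg_add]
  refine avg_mono walk_nonneg fun e _ => ?_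
  by_cases c1 : (deg P I e.1 : ℝ) < d₀ <;>
    by_cases c2 : d₀ ≤ deg P I e.1 ∧ |time k M x - time k M e.2| < s <;>
    simp [c1, c2]

open Classical in
theorem sum_avg_bad_le (hm : 1 ≤ m) {s d₀ ρ β : ℝ} (hs : 1 ≤ s * M) (hd : 0 < d₀)
    (hbroad : ∀ q ∈ P, ∀ i ∈ I q, (#{j ∈ I q | ‖b i - b j‖ < ρ} : ℝ) ≤ β * m) :
    ∑ x ∈ P, avg (T ×ˢ P) (walk P I m) x (fun e => avg (T ×ˢ P) (walk P I m) e.2 fun e' =>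
      if BadPath b k I P M d₀ s ρ x e e' then 1 else 0) ≤
      2 * ((m : ℝ)⁻¹ * (#T * d₀) + 256 * K ^ 3 * (s * M) / d₀ * #P) + β * #P := by
  have hm' : (0 : ℝ) < m := by exact_mod_cast hm
  set F : α → ι × α → ℝ := fun x e => if (deg P I e.1 : ℝ) < d₀ ∨
      d₀ ≤ deg P I e.1 ∧ |time k M x - time k M e.2| < s then 1 else 0 with hF
  have hF1 := h.sum_avg_step_le hm hs hd
  have hrow : ∀ x ∈ P, ∑ e ∈ T ×ˢ P, walk P I m x e = 1 := fun x hx =>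
    sum_walk h.I_sub hm hx (h.I_card x hx)
  have hF2 : ∑ x ∈ P, avg (T ×ˢ P) (walk P I m) x
      (fun e => avg (T ×ˢ P) (walk P I m) e.2 (F e.2)) =
      ∑ x ∈ P, avg (T ×ˢ P) (walk P I m) x (F x) :=
    sum_avg_stationary (tgt := Prod.snd) hrow (fun f => sum_avg_walk_symm f)
      fun y => avg (T ×ˢ P) (walk P I m) y (F y)
  have hclose : ∀ x ∈ P, avg (T ×ˢ P) (walk P I m) x (fun e => avg (T ×ˢ P) (walk P I m) e.2
      fun e' => if ‖b e.1 - b e'.1‖ < ρ then 1 else 0) ≤ β := by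
    intro x hx
    refine avg_walk_le h.I_sub hm hx (h.I_card x hx) fun i _ y hy hiy => ?_
    dsimp only
    rw [avg_walk_tube h.I_sub hy (fun j => if ‖b i - b j‖ < ρ then 1 else 0), ← mul_sum,
      ← sum_filter, sum_const, nsmul_eq_mul, mul_one, inv_mul_le_iff₀ hm', mul_comm]
    exact hbroad y hy i hiy
  have hsum : ∑ x ∈ P, avg (T ×ˢ P) (walk P I m) x (fun e => avg (T ×ˢ P) (walk P I m) e.2
      fun e' => if BadPath b k I P M d₀ s ρ x e e' then 1 else 0) ≤
      ∑ x ∈ P, (avg (T ×ˢ P) (walk P I m) x (F x) + (avg (T ×ˢ P) (walk P I m) x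
      (fun e => avg (T ×ˢ P) (walk P I m) e.2 (F e.2)) + avg (T ×ˢ P) (walk P I m) x
      (fun e => avg (T ×ˢ P) (walk P I m) e.2
      fun e' => if ‖b e.1 - b e'.1‖ < ρ then 1 else 0))) := by
    refine sum_le_sum fun x hx => ?_
    rw [← avg_add, ← avg_add]
    refine avg_mono walk_nonneg fun e he => ?_
    have hy : e.2 ∈ P := (mem_product.1 he).2
    conv_rhs => rw [← avg_const (hrow e.2 hy) (F x e)]
    rw [← avg_add, ← avg_add]
    refine avg_mono walk_nonneg fun e' _ => ?_
    have aux : ∀ (D A B C : Prop) [Decidable D] [Decidable A] [Decidable B] [Decidable C],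
        (D ↔ A ∨ B ∨ C) → (if D then (1 : ℝ) else 0) ≤
        (if A then 1 else 0) + ((if B then 1 else 0) + if C then 1 else 0) := by
      intro D A B C _ _ _ _ hD
      by_cases A <;> by_cases B <;> by_cases C <;> simp [*]
    exact aux _ _ _ _ Iff.rfl
  refine hsum.trans ?_
  rw [sum_add_distrib, sum_add_distrib, hF2]
  have h3 := sum_le_sum hclose
  rw [sum_const, nsmul_eq_mul] at h3
  linarith

set_option maxHeartbeats 1000000 in
/-- The estimate for configurations all of whose points are broad. -/
theorem broad_bound (hP : P.Nonempty) (hm : 1 ≤ m) {g : ℝ} (hg : 0 < g) {J : ℕ} (hJ : 20 ≤ J)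
    (hδg : δ = g ^ J) (hgK : 10 ^ 12 * K ^ 6 * g ≤ 1)
    (hgc : 10 ^ 4 * K ^ 3 * g ≤ pathConst (2 * J + 1) ^ 2)
    (hbroad : IsBroad b I P m g) :
    (m : ℝ) ^ 3 * (#P * m) ^ 8 * (g ^ 56 * δ ^ 2) ≤ (M * #T) ^ 8 := by
  classical
  have hδ := h.δ_pos
  have hK := h.one_le_K
  have hM := h.M_pos
  have hm' : (0 : ℝ) < m := by exact_mod_cast hm
  have hP' : (0 : ℝ) < #P := by exact_mod_cast hP.card_pos
  have hT : (0 : ℝ) < #T := by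
    obtain ⟨q, hq⟩ := hP
    have h1 := card_le_card (h.I_sub q hq)
    rw [h.I_card q hq] at h1
    exact_mod_cast hm.trans h1
  have hK3 : 1 ≤ K ^ 3 := one_le_pow₀ hK
  have hK36 : K ^ 3 ≤ K ^ 6 := pow_le_pow_right₀ hK (by norm_num)
  have hg1 : 10 ^ 12 * K ^ 3 * g ≤ 1 := le_trans (by gcongr) hgK
  have hg2 : 10 ^ 12 * g ≤ 1 := by nlinarith
  have hg3 : g ≤ 1 := by linarith
  obtain ⟨l, hl0, hlPm⟩ : ∃ l : ℝ, 0 < l ∧ (#P : ℝ) * m = l * (M * #T) :=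
    ⟨#P * m / (M * #T), by positivity, by field_simp⟩
  have hlK : l ≤ 64 * K ^ 3 := by
    refine le_of_mul_le_mul_right ?_ (show 0 < (M : ℝ) * #T by positivity)
    rw [← hlPm]
    exact h.incidence_le
  suffices hs : (m : ℝ) ^ 3 * l ^ 8 * (g ^ 56 * δ ^ 2) ≤ 1 by
    rw [hlPm]
    calc _ = ((m : ℝ) ^ 3 * l ^ 8 * (g ^ 56 * δ ^ 2)) * (M * #T) ^ 8 := by ring
      _ ≤ 1 * (M * #T) ^ 8 := by gcongr
      _ = _ := one_mul _
  have hmle := h.m_le hP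
  set s : ℝ := l * g ^ 3 with hs
  by_cases hsδ : s < δ
  · have e1 : (m : ℝ) * δ ≤ 8424 * K ^ 2 := (le_div_iff₀ hδ).1 hmle
    have e2 : g * (m * δ) ≤ 1 := by
      calc g * (m * δ) ≤ g * (8424 * K ^ 2) := by gcongr
        _ ≤ 10 ^ 12 * K ^ 6 * g := by
          have : K ^ 2 ≤ K ^ 6 := pow_le_pow_right₀ hK (by norm_num)
          nlinarith [mul_pos hg (pow_pos h.K_pos 6)]
        _ ≤ 1 := hgK
    calc (m : ℝ) ^ 3 * l ^ 8 * (g ^ 56 * δ ^ 2) = (g * (m * δ)) ^ 3 * s ^ 8 * g ^ 29 / δ := by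
          rw [hs]; field_simp
      _ ≤ 1 ^ 3 * δ ^ 8 * 1 / δ := by
          have : g ^ 29 ≤ 1 := pow_le_one₀ hg.le hg3
          have hs0 : 0 ≤ s := by positivity
          gcongr
      _ = δ ^ 7 := by field_simp
      _ ≤ 1 := pow_le_one₀ hδ.le h.δ_le
  have hsδ' := not_lt.1 hsδ
  have hs0 : 0 < s := by positivity
  have hs1 : s ≤ 1 := by
    have : g ^ 3 ≤ g := by simpa using pow_le_pow_of_le_one hg.le hg3 (by norm_num : 1 ≤ 3)
    calc s ≤ 64 * K ^ 3 * g := by rw [hs]; gcongr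
      _ ≤ 10 ^ 12 * K ^ 3 * g := by gcongr; norm_num
      _ ≤ 1 := hg1
  have hsM : 1 ≤ s * M := by
    calc 1 ≤ M * δ := h.one_le_Mδ
      _ ≤ M * s := by gcongr
      _ = _ := mul_comm _ _
  set d₀ : ℝ := l * M * g with hd₀
  have hd0 : 0 < d₀ := by positivity
  set n := 2 * J + 1 with hn
  have hδ20 : δ ≤ g ^ 20 := by
    rw [hδg]; exact pow_le_pow_of_le_one hg.le hg3 hJ
  have hbad : ∑ x ∈ P, avg (T ×ˢ P) (walk P I m) x (fun e => avg (T ×ˢ P) (walk P I m) e.2 fun e' =>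
      if BadPath b k I P M d₀ s (g ^ 8) x e e' then 1 else 0) ≤ pathConst n ^ 2 / 16 * #P := by
    refine (h.sum_avg_bad_le hm hsM hd0 fun q hq i hi => hbroad q hq i hi _ (filter_subset _ _)
      fun j hj => (mem_filter.1 hj).2).trans ?_
    have e1 : (m : ℝ)⁻¹ * (#T * d₀) = g * #P := by
      rw [hd₀, inv_mul_eq_iff_eq_mul₀ hm'.ne']
      linear_combination (-g) * hlPm
    have e2 : 256 * K ^ 3 * (s * M) / d₀ = 256 * K ^ 3 * g ^ 2 := by
      rw [hs, hd₀]; field_simp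
    rw [e1, e2]
    have e3 : g ^ 2 ≤ g := by nlinarith
    calc _ = (29 * g + 512 * (K ^ 3 * g ^ 2)) * #P := by ring
      _ ≤ (29 * (K ^ 3 * g) + 512 * (K ^ 3 * g)) * #P := by
        gcongr
        nlinarith
      _ ≤ (10 ^ 4 * K ^ 3 * g / 16) * #P := by
        gcongr
        nlinarith [mul_pos (pow_pos h.K_pos 3) hg]
      _ ≤ _ := by gcongr
  have hang2 : ∀ x y, ang u δ x y ≤ 2 := fun x y =>
    max_le (norm_cross_le_two (h.u_unit y) (h.u_unit x)) (h.δ_le.trans (by norm_num))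
  have h2g : (10 : ℝ) < g ^ 0 / g := by
    rw [lt_div_iff₀ hg]; simp; linarith
  have hτn : g ^ n / g = δ ^ 2 := by
    rw [hδg, hn, pow_succ, mul_div_assoc, div_self hg.ne', mul_one, ← pow_mul, mul_comm]
  have hδang : ∀ x y, δ ≤ ang u δ x y := fun x y => le_max_right _ _
  have hgδ : (g ^ 10)⁻¹ * δ ≤ 1 := by
    rw [inv_mul_le_iff₀ (by positivity), mul_one]
    exact hδ20.trans (pow_le_pow_of_le_one hg.le hg3 (by norm_num))
  have hg10 : 1 ≤ (g ^ 10)⁻¹ := (one_le_inv₀ (by positivity)).2 (pow_le_one₀ hg.le hg3)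
  obtain ⟨κ, -, κ', -, x, hx, y', -, hy1, hy2, hpaths⟩ := exists_typical_paths (P := P)
    (E := T ×ˢ P) (tgt := Prod.snd) (w := walk P I m) n hP (fun e he => (mem_product.1 he).2)
    walk_nonneg (fun x hx => sum_walk h.I_sub hm hx (h.I_card x hx)) sum_avg_walk_symm
    (ang u δ) (vol3 u δ (g ^ 10)⁻¹) (fun j => g ^ j / g) (ang_comm u δ)
    (fun x y => (hang2 x y).trans_lt (by linarith))
    (fun x y z => by
      refine max_lt ?_ ?_
      · have e1 := abs_dotProduct_le (u z) (u x ⨯₃ u y)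
        have e2 := norm_cross_le_two (h.u_unit y) (h.u_unit x)
        have e3 := norm_le_one_of_dotProduct_self (h.u_unit z)
        have : ‖u z‖ * ‖u x ⨯₃ u y‖ ≤ 1 * 2 := by gcongr
        refine lt_of_le_of_lt e1 ?_
        linarith
      · have : (g ^ 10)⁻¹ * δ * ang u δ x y ≤ 1 * 2 := by
          have := hang2 x y
          have := (hδ.le).trans (hδang x y)
          gcongr
        linarith)
    (fun x y => by
      rw [hτn]
      have := hδang x y
      have := h.δ_le
      nlinarith)
    (fun x y z => by
      rw [hτn]
      refine le_trans ?_ (le_max_right _ _)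
      have := hδang x y
      calc δ ^ 2 = 1 * δ * δ := by ring
        _ ≤ (g ^ 10)⁻¹ * δ * ang u δ x y := by gcongr)
    (BadPath b k I P M d₀ s (g ^ 8)) hbad
  set c : ℝ := pathConst n ^ 2 / 2 with hc
  have hgc' : g ≤ c := by
    rw [hc]; nlinarith
  set τ := g ^ κ / g with hτ
  set σ := g ^ κ' / g with hσ
  have hτ' : g ^ (κ + 1) / g = g * τ := by rw [hτ, pow_succ]; field_simp
  have hσ' : g ^ (κ' + 1) / g = g * σ := by rw [hσ, pow_succ]; field_simp
  rw [hτ'] at hy1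
  simp only [hτ', hσ'] at hpaths
  set Good : ι × α → ι × α → Prop := fun e e' => ¬BadPath b k I P M d₀ s (g ^ 8) x e e' ∧
    g * τ ≤ ang u δ x e.2 ∧ ang u δ x e.2 < τ ∧ ang u δ e.2 e'.2 < τ ∧
    g * σ ≤ vol3 u δ (g ^ 10)⁻¹ x e.2 e'.2 ∧ vol3 u δ (g ^ 10)⁻¹ x e.2 e'.2 < σ ∧
    vol3 u δ (g ^ 10)⁻¹ y' x e.2 < σ with hGood
  change c ≤ avg (T ×ˢ P) (walk P I m) x fun e => avg (T ×ˢ P) (walk P I m) e.2 fun e' =>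
    if Good e e' then 1 else 0 at hpaths
  set G : Finset ((ι × α) × (ι × α)) := {w ∈ (T ×ˢ P) ×ˢ (T ×ˢ P) | (w.1.1 ∈ I x ∧ w.1.1 ∈ I w.1.2 ∧
    w.2.1 ∈ I w.1.2 ∧ w.2.1 ∈ I w.2.2) ∧ Good w.1 w.2} with hG
  have hGcard : c ≤ #G * ((m * d₀) ^ 2)⁻¹ := by
    refine hpaths.trans ?_
    unfold avg
    simp_rw [mul_sum]
    rw [← sum_product' (T ×ˢ P) (T ×ˢ P) (fun e e' => walk P I m x e *
      (walk P I m e.2 e' * if Good e e' then 1 else 0)), ← nsmul_eq_mul, ← sum_const, hG,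
      sum_filter]
    refine sum_le_sum fun w _ => ?_
    split_ifs with c1 c2 c2
    · have hb : ∀ (z : α) (e : ι × α), d₀ ≤ deg P I e.1 → walk P I m z e ≤ (m * d₀)⁻¹ := by
        intro z e he
        unfold walk
        split_ifs
        · gcongr
        · positivity
      have hd := c2.2.1
      simp only [BadPath, not_or, not_lt] at hd
      calc _ ≤ (m * d₀)⁻¹ * ((m * d₀)⁻¹ * 1) := by
            gcongr
            · exact mul_nonneg (walk_nonneg _ _) zero_le_one
            · exact hb _ _ hd.1.1
            · exact hb _ _ hd.2.1.1
        _ = _ := by rw [mul_one, ← mul_inv, sq]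
    · by_cases e1 : w.1.1 ∈ I x ∧ w.1.1 ∈ I w.1.2
      · by_cases e2 : w.2.1 ∈ I w.1.2 ∧ w.2.1 ∈ I w.2.2
        · exact absurd ⟨⟨e1.1, e1.2, e2.1, e2.2⟩, c1⟩ c2
        · simp [walk, e2]
      · simp [walk, e1]
    · rw [mul_zero, mul_zero]; positivity
    · simp
  have hcount := h.card_paths_le hg hgK hδ20 hs0 hs1 hm hx (τ := τ) (σ := σ) (by positivity)
    ⟨hy1, hy2⟩ G (by
      intro w hw
      obtain ⟨hw1, ⟨c1, c2, c3, c4⟩, hw2, hw3⟩ := mem_filter.1 hw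
      obtain ⟨hwa, hwb⟩ := mem_product.1 hw1
      simp only [BadPath, not_or, not_lt, not_and] at hw2
      exact ⟨(mem_product.1 hwa).2, (mem_product.1 hwb).2, c1, c2, c3, c4, hw2.2.2,
        hw2.1.2 hw2.1.1, hw2.2.1.2 hw2.2.1.1, hw3⟩)
  rw [← div_eq_mul_inv, le_div_iff₀ (by positivity)] at hGcard
  have hfin : c * (m * d₀) ^ 2 * m * (s ^ 6 * g ^ 25 * δ ^ 2) ≤ M ^ 2 :=
    le_trans (by gcongr) hcount
  refine le_of_mul_le_mul_right ?_ (show (0 : ℝ) < M ^ 2 by positivity)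
  calc (m : ℝ) ^ 3 * l ^ 8 * (g ^ 56 * δ ^ 2) * M ^ 2
      = (g * (m * d₀) ^ 2 * m * (s ^ 6 * g ^ 25 * δ ^ 2)) * g ^ 10 := by
        rw [hs, hd₀]; ring
    _ ≤ (c * (m * d₀) ^ 2 * m * (s ^ 6 * g ^ 25 * δ ^ 2)) * 1 := by
        have : g ^ 10 ≤ 1 := pow_le_one₀ hg.le hg3
        gcongr
    _ ≤ 1 * M ^ 2 := by linarith

end Config

end Planebrush

namespace Planebrush

open Matrix Finset

namespace Config

variable {α ι : Type*} {K δ : ℝ} {M m : ℕ} {P : Finset α} {T : Finset ι} {a b : ι → V3}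
  {k : α → ℕ} {p : α → V3} {I : α → Finset ι} {u : α → V3}

theorem restrict (h : Config K δ M m P T a b k p I u) {P' : Finset α} {T' : Finset ι} {m' : ℕ}
    {I' : α → Finset ι} (hP : P' ⊆ P) (hT : T' ⊆ T) (hI : ∀ q ∈ P', I' q ⊆ I q)
    (hI' : ∀ q ∈ P', I' q ⊆ T') (hm : ∀ q ∈ P', #(I' q) = m') :
    Config K δ M m' P' T' a b k p I' u where
  one_le_K := h.one_le_K
  δ_pos := h.δ_pos
  δ_le := h.δ_le
  one_le_Mδ := h.one_le_Mδ
  b_sep i hi j hj := h.b_sep i (hT hi) j (hT hj)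
  b_le i hi := h.b_le i (hT hi)
  p_sep q hq q' hq' := h.p_sep q (hP hq) q' (hP hq')
  k_lt q hq := h.k_lt q (hP hq)
  I_sub := hI'
  I_card := hm
  inc q hq i hi := h.inc q (hP hq) i (hI q hq hi)
  u_unit := h.u_unit
  line q hq i hi j hj := h.line q (hP hq) i (hI q hq hi) j (hI q hq hj)

theorem rescale (h : Config K δ M m P T a b k p I u) {ρ : ℝ} (hδρ : δ ≤ ρ) (hρ1 : ρ ≤ 1) (c : V3)
    (hc : ∀ i ∈ T, ‖b i - c‖ ≤ ρ) :
    Config K (δ / ρ) M m P T (fun i => ρ⁻¹ • a i) (fun i => ρ⁻¹ • (b i - c)) k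
      (fun q => ρ⁻¹ • (p q - time k M q • c)) I u := by
  have hδ := h.δ_pos
  have hρ : 0 < ρ := hδ.trans_le hδρ
  have key : ∀ v : V3, ‖ρ⁻¹ • v‖ = ‖v‖ / ρ := fun v => by
    rw [norm_smul, norm_inv, Real.norm_of_nonneg hρ.le, inv_mul_eq_div]
  refine ⟨h.one_le_K, by positivity, (div_le_one hρ).2 hδρ, ?_, ?_, ?_, ?_, h.k_lt, h.I_sub,
    h.I_card, ?_, h.u_unit, ?_⟩
  · refine h.one_le_Mδ.trans ?_
    gcongr
    exact le_div_self hδ.le hρ hρ1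
  · intro i hi j hj hij
    rw [← smul_sub, sub_sub_sub_cancel_right, key]
    have := h.b_sep i hi j hj hij
    gcongr
  · intro i hi
    rw [key, div_le_one hρ]
    exact hc i hi
  · intro q hq q' hq' hne hk
    have ht : time k M q = time k M q' := by unfold time; rw [hk]
    rw [← smul_sub, ht, sub_sub_sub_cancel_right, key]
    have := h.p_sep q hq q' hq' hne hk
    gcongr
  · intro q hq i hi
    have e : ρ⁻¹ • (p q - time k M q • c) - ρ⁻¹ • a i - time k M q • (ρ⁻¹ • (b i - c)) =
        ρ⁻¹ • (p q - a i - time k M q • b i) := by module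
    have := h.inc q hq i hi
    rw [e, key, ← mul_div_assoc]
    gcongr
  · intro q hq i hi j hj
    obtain ⟨r, hr⟩ := h.line q hq i hi j hj
    refine ⟨ρ⁻¹ * r, ?_⟩
    have e : ρ⁻¹ • (b i - c) - ρ⁻¹ • (b j - c) - (ρ⁻¹ * r) • u q =
        ρ⁻¹ • (b i - b j - r • u q) := by module
    rw [e, key, ← mul_div_assoc]
    gcongr

end Config

section Cell

variable {ι : Type*}

/-- The cell of side length `ρ` containing `b i`. -/
noncomputable def cell (b : ι → V3) (ρ : ℝ) (i : ι) : Fin 3 → ℤ := fun l => ⌊b i l / ρ⌋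

theorem norm_sub_cell_le {b : ι → V3} {ρ : ℝ} (hρ : 0 < ρ) (i : ι) :
    ‖b i - fun l => ρ * (cell b ρ i l : ℝ)‖ ≤ ρ := by
  refine (pi_norm_le_iff_of_nonneg hρ.le).2 fun l => ?_
  have h1 := Int.floor_le (b i l / ρ)
  have h2 := Int.lt_floor_add_one (b i l / ρ)
  rw [le_div_iff₀ hρ] at h1
  rw [div_lt_iff₀ hρ] at h2
  simp only [Pi.sub_apply, Real.norm_eq_abs, cell, abs_le]
  constructor <;> nlinarith

theorem card_le_of_cell {b : ι → V3} {ρ C : ℝ} (hρ : 0 < ρ) (i : ι) {S : Finset ι}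
    (hS : ∀ j ∈ S, ‖b i - b j‖ < ρ) [DecidableEq (Fin 3 → ℤ)]
    (hC : ∀ Q, (#{j ∈ S | cell b ρ j = Q} : ℝ) ≤ C) : (#S : ℝ) ≤ 27 * C := by
  set R : Finset (Fin 3 → ℤ) :=
    Fintype.piFinset fun l => Icc (cell b ρ i l - 1) (cell b ρ i l + 1) with hR
  have hmaps : ∀ j ∈ S, cell b ρ j ∈ R := by
    intro j hj
    refine Fintype.mem_piFinset.2 fun l => ?_
    have h1 : |b i l - b j l| < ρ := (abs_apply_le_norm (b i - b j) l).trans_lt (hS j hj)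
    have h2 : |b i l / ρ - b j l / ρ| < 1 := by
      rw [← sub_div, abs_div, abs_of_pos hρ, div_lt_one hρ]
      exact h1
    obtain ⟨h3, h4⟩ := abs_lt.1 h2
    simp only [cell, mem_Icc]
    constructor
    · rw [sub_le_iff_le_add, ← Int.floor_add_one]
      exact Int.floor_mono (by linarith)
    · rw [← Int.floor_add_one]
      exact Int.floor_mono (by linarith)
  rw [card_eq_sum_card_fiberwise hmaps]
  push_cast
  refine (sum_le_card_nsmul _ _ _ fun Q _ => hC Q).trans_eq ?_
  have : #R = 27 := by
    rw [hR, Fintype.card_piFinset]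
    have : ∀ z : ℤ, z + 1 + 1 - (z - 1) = 3 := fun z => by ring
    simp [this]
  rw [this, nsmul_eq_mul]
  norm_num

end Cell

/-- The exponent of the incidence estimate. -/
noncomputable def incExp (J : ℕ) : ℝ := 1 / 4 + 7 / J

theorem rpow_eleven_eighths_pow {x : ℝ} (hx : 0 ≤ x) : (x ^ (11 / 8 : ℝ)) ^ 8 = x ^ 11 := by
  rw [← Real.rpow_natCast, ← Real.rpow_mul hx, ← Real.rpow_natCast]
  norm_num

theorem rpow_quarter_pow {x : ℝ} (hx : 0 ≤ x) : (x ^ (1 / 4 : ℝ)) ^ 8 = x ^ 2 := by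
  rw [← Real.rpow_natCast, ← Real.rpow_mul hx, ← Real.rpow_natCast]
  norm_num

theorem rpow_incExp {g : ℝ} (hg : 0 < g) {J : ℕ} (hJ : J ≠ 0) :
    (g ^ J) ^ (-incExp J) * (g ^ 7 * (g ^ J) ^ (1 / 4 : ℝ)) = 1 := by
  have hJ' : (J : ℝ) ≠ 0 := by exact_mod_cast hJ
  rw [← Real.rpow_natCast g J, ← Real.rpow_natCast g 7, ← Real.rpow_mul hg.le,
    ← Real.rpow_mul hg.le, ← Real.rpow_add hg, ← Real.rpow_add hg]
  convert Real.rpow_zero g using 2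
  unfold incExp
  field_simp
  push_cast
  ring

theorem rpow_incExp_rescale {g δ : ℝ} (hg : 0 < g) (hδ : 0 < δ) (hg4 : g ≤ 1 / 4) (J : ℕ) :
    (δ / g ^ 8) ^ (-incExp J) ≤ δ ^ (-incExp J) * (1 / 2 * g ^ (11 / 8 : ℝ)) := by
  have ha : (1 : ℝ) / 4 ≤ incExp J := by
    unfold incExp
    have : (0 : ℝ) ≤ 7 / J := by positivity
    linarith
  rw [Real.div_rpow hδ.le (by positivity), Real.rpow_neg (by positivity : 0 ≤ g ^ 8), div_inv_eq_mul]
  gcongr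
  calc (g ^ 8) ^ incExp J ≤ (g ^ 8) ^ (1 / 4 : ℝ) :=
        Real.rpow_le_rpow_of_exponent_ge (by positivity) (pow_le_one₀ hg.le (by linarith)) ha
    _ = g ^ 2 := by
        rw [← Real.rpow_natCast, ← Real.rpow_mul hg.le, ← Real.rpow_natCast]
        norm_num
    _ ≤ 1 / 2 * g ^ (11 / 8 : ℝ) := by
        refine le_of_pow_le_pow_left₀ (n := 8) (by norm_num) (by positivity) ?_
        rw [mul_pow, rpow_eleven_eighths_pow hg.le]
        have : g ^ 5 ≤ (1 / 4) ^ 5 := by gcongr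
        calc (g ^ 2) ^ 8 = g ^ 5 * g ^ 11 := by ring
          _ ≤ (1 / 4) ^ 5 * g ^ 11 := by gcongr
          _ ≤ _ := by gcongr; norm_num

namespace Config

variable {α ι : Type*} {K δ : ℝ} {M m : ℕ} {P : Finset α} {T : Finset ι} {a b : ι → V3}
  {k : α → ℕ} {p : α → V3} {I : α → Finset ι} {u : α → V3}

/-- `broad_bound` in linear form. -/
theorem broad_bound_linear (h : Config K δ M m P T a b k p I u) (hm : 1 ≤ m) {g : ℝ} (hg : 0 < g)
    {J : ℕ} (hJ : 20 ≤ J) (hδg : δ = g ^ J) (hgK : 10 ^ 12 * K ^ 6 * g ≤ 1)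
    (hgc : 10 ^ 4 * K ^ 3 * g ≤ pathConst (2 * J + 1) ^ 2) (hbroad : IsBroad b I P m g) :
    #P * (m : ℝ) ^ (11 / 8 : ℝ) ≤ δ ^ (-incExp J) * (M * #T) := by
  have hδ := h.δ_pos
  rcases P.eq_empty_or_nonempty with he | hP
  · rw [he]; simp; positivity
  have h1 := h.broad_bound hP hm hg hJ hδg hgK hgc hbroad
  have h2 : #P * (m : ℝ) ^ (11 / 8 : ℝ) * (g ^ 7 * δ ^ (1 / 4 : ℝ)) ≤ M * #T := by
    refine le_of_pow_le_pow_left₀ (n := 8) (by norm_num) (by positivity) (le_trans (le_of_eq ?_) h1)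
    rw [mul_pow, mul_pow, mul_pow, rpow_eleven_eighths_pow (by positivity), rpow_quarter_pow hδ.le]
    ring
  have h3 := rpow_incExp hg (J := J) (by omega)
  rw [← hδg] at h3
  calc #P * (m : ℝ) ^ (11 / 8 : ℝ) = #P * (m : ℝ) ^ (11 / 8 : ℝ) *
        (δ ^ (-incExp J) * (g ^ 7 * δ ^ (1 / 4 : ℝ))) := by rw [h3, mul_one]
    _ = δ ^ (-incExp J) * (#P * (m : ℝ) ^ (11 / 8 : ℝ) * (g ^ 7 * δ ^ (1 / 4 : ℝ))) := by ring
    _ ≤ _ := by gcongr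

open Classical in
/-- Narrow points are estimated through the rescaled configurations in the cells. -/
theorem narrow_bound (h : Config K δ M m P T a b k p I u) (hm : 1 ≤ m) {g : ℝ} (hg : 0 < g)
    (hg4 : g ≤ 1 / 4) (hδg : δ ≤ g ^ 8) (J : ℕ) {C : ℝ} (hC : 0 ≤ C)
    (hnarrow : ∀ q ∈ P, ∃ Q, g * m ≤ (#{i ∈ I q | cell b (g ^ 8) i = Q} : ℝ))
    (IH : ∀ (m' : ℕ) (P' : Finset α) (T' : Finset ι) (a' b' : ι → V3) (p' : α → V3)
      (I' : α → Finset ι), 1 ≤ m' → Config K (δ / g ^ 8) M m' P' T' a' b' k p' I' u →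
      #P' * (m' : ℝ) ^ (11 / 8 : ℝ) ≤ C * (δ / g ^ 8) ^ (-incExp J) * (M * #T')) :
    #P * (m : ℝ) ^ (11 / 8 : ℝ) ≤ C / 2 * δ ^ (-incExp J) * (M * #T) := by
  have hδ := h.δ_pos
  have hm' : (0 : ℝ) < m := by exact_mod_cast hm
  have hg8 : 0 < g ^ 8 := by positivity
  choose! Q hQ using hnarrow
  set m' := ⌈g * m⌉₊ with hm'def
  have hm1 : 1 ≤ m' := Nat.one_le_ceil_iff.2 (by positivity)
  have hgm : g * m ≤ m' := Nat.le_ceil _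
  have hsub : ∀ q ∈ P, ∃ S ⊆ {i ∈ I q | cell b (g ^ 8) i = Q q}, #S = m' := fun q hq =>
    exists_subset_card_eq (Nat.ceil_le.2 (hQ q hq))
  choose! I' hI' hI'card using hsub
  have hcell : ∀ R, (#{q ∈ P | Q q = R} : ℝ) * (m : ℝ) ^ (11 / 8 : ℝ) ≤
      C / 2 * δ ^ (-incExp J) * M * #{i ∈ T | cell b (g ^ 8) i = R} := by
    intro R
    have hc1 : Config K δ M m' {q ∈ P | Q q = R} {i ∈ T | cell b (g ^ 8) i = R} a b k p I' u := by
      refine h.restrict (filter_subset _ _) (filter_subset _ _) ?_ ?_ ?_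
      · exact fun q hq => (hI' q (mem_filter.1 hq).1).trans (filter_subset _ _)
      · intro q hq i hi
        obtain ⟨hq1, hq2⟩ := mem_filter.1 hq
        obtain ⟨hi1, hi2⟩ := mem_filter.1 (hI' q hq1 hi)
        exact mem_filter.2 ⟨h.I_sub q hq1 hi1, hi2.trans hq2⟩
      · exact fun q hq => hI'card q (mem_filter.1 hq).1
    have hc2 := hc1.rescale hδg (pow_le_one₀ hg.le (by linarith)) (fun l => g ^ 8 * (R l : ℝ))
      (fun i hi => by
        have := norm_sub_cell_le (b := b) hg8 i
        rwa [(mem_filter.1 hi).2] at this)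
    have h1 := IH _ _ _ _ _ _ _ hm1 hc2
    have h2 := rpow_incExp_rescale hg hδ hg4 J
    have h3 : g ^ (11 / 8 : ℝ) * (m : ℝ) ^ (11 / 8 : ℝ) ≤ (m' : ℝ) ^ (11 / 8 : ℝ) := by
      rw [← Real.mul_rpow hg.le hm'.le]
      gcongr
    have hg11 : 0 < g ^ (11 / 8 : ℝ) := by positivity
    refine le_of_mul_le_mul_left ?_ hg11
    calc g ^ (11 / 8 : ℝ) * ((#{q ∈ P | Q q = R} : ℝ) * (m : ℝ) ^ (11 / 8 : ℝ))
        = #{q ∈ P | Q q = R} * (g ^ (11 / 8 : ℝ) * (m : ℝ) ^ (11 / 8 : ℝ)) := by ring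
      _ ≤ #{q ∈ P | Q q = R} * (m' : ℝ) ^ (11 / 8 : ℝ) := by gcongr
      _ ≤ _ := h1
      _ ≤ C * (δ ^ (-incExp J) * (1 / 2 * g ^ (11 / 8 : ℝ))) *
          (M * #{i ∈ T | cell b (g ^ 8) i = R}) := by gcongr
      _ = _ := by ring
  have hsumP : #P = ∑ R ∈ P.image Q, #{q ∈ P | Q q = R} := card_eq_sum_card_image Q P
  have hsumT : ∑ R ∈ P.image Q, #{i ∈ T | cell b (g ^ 8) i = R} ≤ #T := by
    rw [sum_card_fiberwise_eq_card_filter]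
    exact card_filter_le _ _
  rw [hsumP]
  push_cast
  rw [sum_mul]
  refine (sum_le_sum fun R _ => hcell R).trans ?_
  rw [← mul_sum, ← mul_assoc]
  gcongr
  exact_mod_cast hsumT

theorem base_bound (h : Config K δ M m P T a b k p I u) (hm : 1 ≤ m) {δ₀ : ℝ} (hδ₀ : 0 < δ₀)
    (hδ : δ₀ ≤ δ) (J : ℕ) :
    #P * (m : ℝ) ^ (11 / 8 : ℝ) ≤ 64 * 8424 * K ^ 5 / δ₀ * δ ^ (-incExp J) * (M * #T) := by
  have hδ' := h.δ_pos
  have hK := h.K_pos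
  rcases P.eq_empty_or_nonempty with he | hP
  · rw [he]; simp; positivity
  have h1 := h.incidence_le
  have h2 : (m : ℝ) ≤ 8424 * K ^ 2 / δ₀ := (h.m_le hP).trans (by gcongr)
  have hm1 : (1 : ℝ) ≤ m := by exact_mod_cast hm
  have h3 : (m : ℝ) ^ (11 / 8 : ℝ) ≤ m * m := by
    calc (m : ℝ) ^ (11 / 8 : ℝ) ≤ (m : ℝ) ^ (2 : ℝ) :=
          Real.rpow_le_rpow_of_exponent_le hm1 (by norm_num)
      _ = m * m := by rw [Real.rpow_two, sq]
  have h4 : 1 ≤ δ ^ (-incExp J) := by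
    refine Real.one_le_rpow_of_pos_of_le_one_of_nonpos hδ' h.δ_le ?_
    unfold incExp
    have : (0 : ℝ) ≤ 7 / J := by positivity
    linarith
  calc #P * (m : ℝ) ^ (11 / 8 : ℝ) ≤ #P * (m * m) := by gcongr
    _ = (#P * m) * m := by ring
    _ ≤ (64 * K ^ 3 * (M * #T)) * (8424 * K ^ 2 / δ₀) := by gcongr
    _ = 64 * 8424 * K ^ 5 / δ₀ * 1 * (M * #T) := by ring
    _ ≤ _ := by gcongr

end Config

/-- The discretised planebrush estimate. -/
theorem exists_incidence_bound {K : ℝ} (hK : 1 ≤ K) {J : ℕ} (hJ : 20 ≤ J) :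
    ∃ C : ℝ, 0 < C ∧ ∀ {α ι : Type} {δ : ℝ} {M m : ℕ} {P : Finset α} {T : Finset ι} {a b : ι → V3}
      {k : α → ℕ} {p : α → V3} {I : α → Finset ι} {u : α → V3}, 1 ≤ m →
      Config K δ M m P T a b k p I u →
      #P * (m : ℝ) ^ (11 / 8 : ℝ) ≤ C * δ ^ (-incExp J) * (M * #T) := by
  classical
  have hK0 : 0 < K := by linarith
  obtain ⟨g₀, hg₀, hgK, hgc⟩ : ∃ g₀ : ℝ, 0 < g₀ ∧ 10 ^ 12 * K ^ 6 * g₀ ≤ 1 ∧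
      10 ^ 4 * K ^ 3 * g₀ ≤ pathConst (2 * J + 1) ^ 2 := by
    have hp := pathConst_pos (2 * J + 1)
    refine ⟨min (1 / (10 ^ 12 * K ^ 6)) (pathConst (2 * J + 1) ^ 2 / (10 ^ 4 * K ^ 3)),
      by positivity, ?_, ?_⟩
    · rw [mul_comm, ← le_div_iff₀ (by positivity)]
      exact min_le_left _ _
    · rw [mul_comm, ← le_div_iff₀ (by positivity)]
      exact min_le_right _ _
  set δ₀ := g₀ ^ J with hδ₀
  have hδ₀pos : 0 < δ₀ := by positivity
  set C := max 2 (64 * 8424 * K ^ 5 / δ₀) with hC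
  have hC2 : 2 ≤ C := le_max_left _ _
  refine ⟨C, by linarith, ?_⟩
  have main : ∀ n : ℕ, ∀ {α ι : Type} {δ : ℝ} {M m : ℕ} {P : Finset α} {T : Finset ι} {a b : ι → V3}
      {k : α → ℕ} {p : α → V3} {I : α → Finset ι} {u : α → V3}, (1 / 2 : ℝ) ^ n ≤ δ → 1 ≤ m →
      Config K δ M m P T a b k p I u →
      #P * (m : ℝ) ^ (11 / 8 : ℝ) ≤ C * δ ^ (-incExp J) * (M * #T) := by
    intro n
    induction n with
    | zero =>
      intro α ι δ M m P T a b k p I u hn hm h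
      have hδ := h.δ_pos
      have hK1 : 1 ≤ K ^ 6 := one_le_pow₀ hK
      have hg1 : g₀ ≤ 1 := by nlinarith
      refine (h.base_bound hm hδ₀pos (le_trans (pow_le_one₀ hg₀.le hg1) (by simpa using hn)) J).trans
        ?_
      gcongr
      exact le_max_right _ _
    | succ n ih =>
      intro α ι δ M m P T a b k p I u hn hm h
      have hδ := h.δ_pos
      by_cases hcase : δ₀ ≤ δ
      · refine (h.base_bound hm hδ₀pos hcase J).trans ?_
        gcongr
        exact le_max_right _ _
      set g := δ ^ ((J : ℝ)⁻¹) with hg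
      have hg0 : 0 < g := by positivity
      have hgJ : g ^ J = δ := Real.rpow_inv_natCast_pow hδ.le (by omega)
      have hgg : g ≤ g₀ := by
        refine le_of_lt (lt_of_pow_lt_pow_left₀ J hg₀.le ?_)
        rw [hgJ]
        exact not_le.1 hcase
      have hgK' : 10 ^ 12 * K ^ 6 * g ≤ 1 := le_trans (by gcongr) hgK
      have hgc' : 10 ^ 4 * K ^ 3 * g ≤ pathConst (2 * J + 1) ^ 2 := le_trans (by gcongr) hgc
      have hK1 : 1 ≤ K ^ 6 := one_le_pow₀ hK
      have hg4 : g ≤ 1 / 4 := by nlinarith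
      have hδg : δ ≤ g ^ 8 := by
        rw [← hgJ]
        exact pow_le_pow_of_le_one hg0.le (by linarith) (by omega)
      set Pn := {q ∈ P | ∃ Q, g * m ≤ (#{i ∈ I q | cell b (g ^ 8) i = Q} : ℝ)} with hPn
      set Pb := {q ∈ P | ¬ ∃ Q, g * m ≤ (#{i ∈ I q | cell b (g ^ 8) i = Q} : ℝ)} with hPb
      have hcard : (#P : ℝ) = #Pn + #Pb := by
        rw [hPn, hPb]
        exact_mod_cast (card_filter_add_card_filter_not (s := P) _).symm
      have hn' := (h.restrict (P' := Pn) (I' := I) (filter_subset _ _) (Subset.refl _)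
        (fun _ _ => Subset.refl _) (fun q hq => h.I_sub q (mem_filter.1 hq).1)
        (fun q hq => h.I_card q (mem_filter.1 hq).1)).narrow_bound hm hg0 hg4 hδg J (C := C)
        (by linarith) (fun q hq => (mem_filter.1 hq).2) (fun m' P' T' a' b' p' I' hm' hc' => by
          refine ih ?_ hm' hc'
          rw [le_div_iff₀ (by positivity)]
          have : g ^ 8 ≤ 1 / 2 := by
            calc g ^ 8 ≤ (1 / 4) ^ 8 := by gcongr
              _ ≤ 1 / 2 := by norm_num
          calc (1 / 2 : ℝ) ^ n * g ^ 8 ≤ (1 / 2) ^ n * (1 / 2) := by gcongr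
            _ ≤ δ := by rwa [← pow_succ])
      have hb' := (h.restrict (P' := Pb) (I' := I) (filter_subset _ _) (Subset.refl _)
        (fun _ _ => Subset.refl _) (fun q hq => h.I_sub q (mem_filter.1 hq).1)
        (fun q hq => h.I_card q (mem_filter.1 hq).1)).broad_bound_linear hm hg0 hJ hgJ.symm hgK' hgc'
        (by
          intro q hq i _ S hS hclose
          rw [mul_assoc]
          refine card_le_of_cell (b := b) (by positivity) i hclose fun Q => ?_
          have h1 := (mem_filter.1 hq).2
          push Not at h1
          refine le_trans ?_ (h1 Q).le
          exact_mod_cast card_le_card (filter_subset_filter _ hS))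
      rw [hcard, add_mul]
      have hpos : 0 ≤ δ ^ (-incExp J) * (M * #T) := by positivity
      nlinarith
  intro α ι δ M m P T a b k p I u hm h
  obtain ⟨n, hn⟩ := exists_pow_lt_of_lt_one h.δ_pos (by norm_num : (1 / 2 : ℝ) < 1)
  exact main n hn.le hm h

end Planebrush

namespace Planebrush

open Matrix Finset

theorem rpow_neg_le_telescope {m : ℕ} (hm : 1 ≤ m) :
    ((m + 1 : ℕ) : ℝ) ^ (-(11 / 8) : ℝ) ≤
      8 / 3 * ((m : ℝ) ^ (-(3 / 8) : ℝ) - ((m + 1 : ℕ) : ℝ) ^ (-(3 / 8) : ℝ)) := by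
  have hm' : (1 : ℝ) ≤ m := by exact_mod_cast hm
  push_cast
  have hm0 : (0 : ℝ) < m := by linarith
  have hm1 : (0 : ℝ) < m + 1 := by linarith
  set x : ℝ := m / (m + 1) with hx
  have hx0 : 0 < x := by positivity
  have hx1 : 1 - x = 1 / (m + 1) := by rw [hx]; field_simp; ring
  have hxm : (m : ℝ) = (m + 1) * x := by rw [hx]; field_simp
  have h1 : 1 + 3 / 8 * (1 / ((m : ℝ) + 1)) ≤ x ^ (-(3 / 8) : ℝ) := by
    rw [Real.rpow_def_of_pos hx0]
    have h2 := Real.add_one_le_exp (Real.log x * (-(3 / 8)))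
    have h3 := Real.log_le_sub_one_of_pos hx0
    linarith
  have h4 : (m : ℝ) ^ (-(3 / 8) : ℝ) = ((m : ℝ) + 1) ^ (-(3 / 8) : ℝ) * x ^ (-(3 / 8) : ℝ) := by
    rw [← Real.mul_rpow hm1.le hx0.le, ← hxm]
  have h5 : ((m : ℝ) + 1) ^ (-(11 / 8) : ℝ) =
      ((m : ℝ) + 1) ^ (-(3 / 8) : ℝ) * (1 / ((m : ℝ) + 1)) := by
    rw [one_div, ← Real.rpow_neg_one, ← Real.rpow_add hm1]
    norm_num
  rw [h4, h5]
  have h6 : 0 < ((m : ℝ) + 1) ^ (-(3 / 8) : ℝ) := by positivity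
  nlinarith

theorem sum_Ioc_rpow_le {s : ℕ} (hs : 1 ≤ s) (N : ℕ) :
    ∑ m ∈ Ioc s N, (m : ℝ) ^ (-(11 / 8) : ℝ) ≤ 8 / 3 * (s : ℝ) ^ (-(3 / 8) : ℝ) := by
  rcases le_total N s with h | h
  · rw [Ioc_eq_empty_of_le h, sum_empty]
    positivity
  suffices H : ∑ m ∈ Ioc s N, (m : ℝ) ^ (-(11 / 8) : ℝ) ≤
      8 / 3 * ((s : ℝ) ^ (-(3 / 8) : ℝ) - (N : ℝ) ^ (-(3 / 8) : ℝ)) by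
    have : 0 ≤ (N : ℝ) ^ (-(3 / 8) : ℝ) := by positivity
    linarith
  induction N, h using Nat.le_induction with
  | base => simp
  | succ n hn ih =>
    rw [← Finset.insert_Ioc_right_eq_Ioc_add_one (by omega), sum_insert (by simp)]
    have := rpow_neg_le_telescope (hs.trans hn)
    linarith

theorem sum_le_mul_card_add {α : Type*} (P : Finset α) (f : α → ℕ) {N : ℕ} (hf : ∀ q ∈ P, f q ≤ N)
    (s : ℕ) : ∑ q ∈ P, f q ≤ s * #P + ∑ m ∈ Ioc s N, #{q ∈ P | m ≤ f q} := by
  have h := sum_card_bipartiteAbove_eq_sum_card_bipartiteBelow (s := P) (t := Ioc s N)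
    (fun q m => m ≤ f q)
  unfold bipartiteAbove bipartiteBelow at h
  rw [← h, mul_comm, ← smul_eq_mul, ← sum_const, ← sum_add_distrib]
  refine sum_le_sum fun q hq => ?_
  have : {m ∈ Ioc s N | m ≤ f q} = Ioc s (f q) := by
    ext m
    have := hf q hq
    simp only [mem_filter, mem_Ioc]
    omega
  rw [this, Nat.card_Ioc]
  omega

theorem exists_card_lower_bound {K : ℝ} (hK : 1 ≤ K) {J : ℕ} (hJ : 20 ≤ J) :
    ∃ C : ℝ, 0 < C ∧ ∀ {α ι : Type} {δ : ℝ} {M : ℕ} {P : Finset α} {T : Finset ι} {a b : ι → V3}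
      {k : α → ℕ} {p : α → V3} {I : α → Finset ι} {u : α → V3}, 0 < δ → δ ≤ 1 →
      (∀ q ∈ P, I q ⊆ T) → (M * #T ≤ ∑ q ∈ P, #(I q)) →
      (∀ m P' I', P' ⊆ P → (∀ q ∈ P', I' q ⊆ I q ∧ #(I' q) = m) →
        Config K δ M m P' T a b k p I' u) →
      M * #T ≤ C * δ ^ (-(2 / 3 + 56 / 3 / (J : ℝ))) * #P := by
  classical
  obtain ⟨C, hC, H⟩ := exists_incidence_bound hK hJ
  refine ⟨4 * (16 / 3 * (C + 1)) ^ (8 / 3 : ℝ), by positivity, ?_⟩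
  intro α ι δ M P T a b k p I u hδ hδ1 hI hsum hconf
  have hJ0 : (0 : ℝ) < J := by positivity
  have hexp : 0 ≤ incExp J := by unfold incExp; positivity
  set B : ℝ := (C + 1) * δ ^ (-incExp J) with hB
  have hδB : 1 ≤ δ ^ (-incExp J) :=
    Real.one_le_rpow_of_pos_of_le_one_of_nonpos hδ hδ1 (by linarith)
  have hB1 : 1 ≤ B := by nlinarith
  set y : ℝ := (16 / 3 * B) ^ (8 / 3 : ℝ) with hy
  have hy1 : 1 ≤ y := Real.one_le_rpow (by linarith) (by norm_num)
  set s : ℕ := ⌈y⌉₊ with hs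
  have hys : y ≤ s := Nat.le_ceil y
  have hs1 : 1 ≤ s := by exact_mod_cast hy1.trans hys
  have hs2 : (s : ℝ) ≤ 2 * y := by
    have := Nat.ceil_lt_add_one (by linarith : 0 ≤ y)
    linarith
  set L : ℝ := M * #T with hL
  have hL0 : 0 ≤ L := by positivity
  have hlevel : ∀ m ∈ Ioc s (#T),
      (#{q ∈ P | m ≤ #(I q)} : ℝ) ≤ B * L * (m : ℝ) ^ (-(11 / 8) : ℝ) := by
    intro m hm
    have hm1 : 1 ≤ m := hs1.trans (mem_Ioc.1 hm).1.le
    have hm0 : (0 : ℝ) < m := by exact_mod_cast hm1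
    have : ∀ q, ∃ I' : Finset ι, q ∈ {q ∈ P | m ≤ #(I q)} → I' ⊆ I q ∧ #I' = m := by
      intro q
      by_cases hq : m ≤ #(I q)
      · obtain ⟨t, ht⟩ := exists_subset_card_eq hq
        exact ⟨t, fun _ => ht⟩
      · exact ⟨∅, fun h => absurd (mem_filter.1 h).2 hq⟩
    choose I' hI' using this
    have h1 := H hm1 (hconf m _ I' (filter_subset _ P) hI')
    rw [Real.rpow_neg hm0.le, ← div_eq_mul_inv, le_div_iff₀ (by positivity)]
    refine h1.trans ?_
    rw [hB]
    gcongr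
    linarith
  have h1 := sum_le_mul_card_add P (fun q => #(I q)) (fun q hq => card_le_card (hI q hq)) s
  have h2 : L ≤ s * #P + ∑ m ∈ Ioc s (#T), (#{q ∈ P | m ≤ #(I q)} : ℝ) := by
    rw [hL]
    exact_mod_cast hsum.trans h1
  have h3 := sum_le_sum hlevel
  rw [← mul_sum] at h3
  have h4 := sum_Ioc_rpow_le hs1 (#T)
  have h5 : (s : ℝ) ^ (-(3 / 8) : ℝ) ≤ (16 / 3 * B)⁻¹ := by
    have : (s : ℝ) ^ (-(3 / 8) : ℝ) ≤ y ^ (-(3 / 8) : ℝ) :=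
      Real.rpow_le_rpow_of_nonpos (by linarith) hys (by norm_num)
    refine this.trans_eq ?_
    rw [hy, ← Real.rpow_mul (by positivity), ← Real.rpow_neg_one]
    norm_num
  have h6 : B * L * ∑ m ∈ Ioc s (#T), (m : ℝ) ^ (-(11 / 8) : ℝ) ≤ L / 2 := by
    calc _ ≤ B * L * (8 / 3 * (16 / 3 * B)⁻¹) := by gcongr; linarith
      _ = L / 2 := by field_simp; ring
  have h7 : L ≤ 2 * s * #P := by linarith
  have h8 : y = (16 / 3 * (C + 1)) ^ (8 / 3 : ℝ) * δ ^ (-(2 / 3 + 56 / 3 / (J : ℝ))) := by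
    rw [hy, hB, ← mul_assoc, Real.mul_rpow (by positivity) (by positivity),
      ← Real.rpow_mul hδ.le]
    congr 2
    unfold incExp
    ring
  calc L ≤ 2 * s * #P := h7
    _ ≤ 2 * (2 * y) * #P := by gcongr
    _ = _ := by rw [h8]; ring

theorem exists_separated_cover {ι X : Type*} [PseudoMetricSpace X] (T : Finset ι) (f : ι → X)
    (δ : ℝ) : ∃ S ⊆ T, (∀ i ∈ S, ∀ j ∈ S, i ≠ j → δ ≤ dist (f i) (f j)) ∧
      ∀ j ∈ T, ∃ i ∈ S, dist (f i) (f j) ≤ max δ 0 := by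
  classical
  induction T using Finset.induction_on with
  | empty => exact ⟨∅, by simp⟩
  | insert c T hc ih =>
    obtain ⟨S, hST, hsep, hcov⟩ := ih
    by_cases h : ∃ i ∈ S, dist (f i) (f c) ≤ max δ 0
    · refine ⟨S, hST.trans (subset_insert _ _), hsep, ?_⟩
      intro j hj
      rcases mem_insert.1 hj with rfl | hj
      exacts [h, hcov j hj]
    · push Not at h
      have h' : ∀ i ∈ S, δ ≤ dist (f i) (f c) := fun i hi =>
        (le_max_left _ _).trans (h i hi).le
      refine ⟨insert c S, insert_subset_insert _ hST, ?_, ?_⟩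
      · intro i hi j hj hij
        rcases mem_insert.1 hi with rfl | hiS <;> rcases mem_insert.1 hj with rfl | hjS
        · exact absurd rfl hij
        · rw [dist_comm]; exact h' j hjS
        · exact h' i hiS
        · exact hsep i hiS j hjS hij
      · intro j hj
        rcases mem_insert.1 hj with rfl | hj
        · exact ⟨j, mem_insert_self _ _, by simp⟩
        · obtain ⟨i, hi, hd⟩ := hcov j hj
          exact ⟨i, mem_insert_of_mem hi, hd⟩

end Planebrush

namespace Planebrush

open Matrix Finset

/-- Ambient space. -/
abbrev E4 : Type := EuclideanSpace ℝ (Fin 4)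

/-- The coordinates of `v` other than the `l`-th one. -/
def hor (l : Fin 4) (v : E4) : V3 := fun j => v (l.succAbove j)

section hor

variable {l : Fin 4}

theorem hor_add (v w : E4) : hor l (v + w) = hor l v + hor l w := rfl

theorem hor_sub (v w : E4) : hor l (v - w) = hor l v - hor l w := rfl

theorem hor_smul (c : ℝ) (v : E4) : hor l (c • v) = c • hor l v := rfl

theorem norm_apply_le (v : E4) (j : Fin 4) : |v j| ≤ ‖v‖ := by
  simpa using PiLp.norm_apply_le v j

theorem norm_hor_le (v : E4) : ‖hor l v‖ ≤ ‖v‖ :=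
  (pi_norm_le_iff_of_nonneg (norm_nonneg _)).2 fun j => by
    simpa [hor] using PiLp.norm_apply_le v (l.succAbove j)

theorem norm_le_two_mul_hor {v : E4} (hv : v l = 0) : ‖v‖ ≤ 2 * ‖hor l v‖ := by
  have h : ‖v‖ ^ 2 ≤ (2 * ‖hor l v‖) ^ 2 := by
    rw [EuclideanSpace.real_norm_sq_eq, Fin.sum_univ_succAbove _ l, hv, Fin.sum_univ_three]
    have key : ∀ j, v (l.succAbove j) ^ 2 ≤ ‖hor l v‖ ^ 2 := fun j => by
      have := abs_apply_le_norm (hor l v) j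
      exact sq_le_sq.2 (by rwa [abs_norm])
    nlinarith [key 0, key 1, key 2, sq_nonneg ‖hor l v‖]
  exact le_of_sq_le_sq h (by positivity)

end hor

/-- The slope, per unit of time, of a tube of direction `e`; a unit of time is `1 / 4` in the
`l`-th coordinate. -/
noncomputable def slope (l : Fin 4) (e : E4) : V3 := (4 * e l)⁻¹ • hor l e

/-- The point of the line `x + ℝ e` whose `l`-th coordinate is `z`. -/
noncomputable def pointAt (l : Fin 4) (x e : E4) (z : ℝ) : E4 := x + ((z - x l) / e l) • e

section slope

variable {l : Fin 4} {e e' x : E4}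

theorem pointAt_apply (he : e l ≠ 0) (z : ℝ) : pointAt l x e z l = z := by
  simp [pointAt, he]

theorem hor_pointAt (z t : ℝ) :
    hor l (pointAt l x e (z + t / 4)) = hor l (pointAt l x e z) + t • slope l e := by
  unfold pointAt slope
  simp only [hor_add, hor_smul, mul_inv]
  module

theorem norm_slope_le (he : ‖e‖ = 1) (hl : 1 / 2 ≤ |e l|) : ‖slope l e‖ ≤ 1 := by
  unfold slope
  rw [norm_smul, norm_inv, norm_mul, Real.norm_eq_abs, Real.norm_eq_abs, inv_mul_le_iff₀
    (by positivity)]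
  have := norm_hor_le (l := l) e
  norm_num
  linarith

theorem le_norm_slope_sub {δ : ℝ} (he : ‖e‖ = 1) (he' : ‖e'‖ = 1) (hl : 1 / 2 ≤ |e l|)
    (hl' : 1 / 2 ≤ |e' l|) (hδ : δ ≤ min ‖e - e'‖ ‖e + e'‖) :
    δ / 16 ≤ ‖slope l e - slope l e'‖ := by
  have h0 : e l ≠ 0 := by rintro h; rw [h] at hl; norm_num at hl
  have h0' : e' l ≠ 0 := by rintro h; rw [h] at hl'; norm_num at hl'
  set w : E4 := (e l)⁻¹ • e with hw
  set w' : E4 := (e' l)⁻¹ • e' with hw'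
  have hww : ‖w - w'‖ ≤ 8 * ‖slope l e - slope l e'‖ := by
    have h1 : (w - w') l = 0 := by simp [hw, hw', h0, h0']
    have h2 : hor l (w - w') = (4 : ℝ) • (slope l e - slope l e') := by
      rw [hor_sub, hw, hw', hor_smul, hor_smul]
      unfold slope
      rw [mul_inv, mul_inv]
      module
    have h3 := norm_le_two_mul_hor h1
    rw [h2, norm_smul] at h3
    norm_num at h3
    linarith
  have hn : ‖w‖ = |e l|⁻¹ := by rw [hw, norm_smul, he, norm_inv, Real.norm_eq_abs, mul_one]
  have hn' : ‖w'‖ = |e' l|⁻¹ := by rw [hw', norm_smul, he', norm_inv, Real.norm_eq_abs, mul_one]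
  have hle : |e l| ≤ 1 := he ▸ norm_apply_le e l
  have hpos : 0 < |e l| := abs_pos.2 h0
  have hpos' : 0 < |e' l| := abs_pos.2 h0'
  have hdiff : ‖|e l| • w - |e' l| • w'‖ ≤ 2 * ‖w - w'‖ := by
    have h1 : |e l| • w - |e' l| • w' = |e l| • (w - w') + (|e l| - |e' l|) • w' := by module
    have h2 : ‖(|e l| - |e' l|) • w'‖ ≤ ‖w - w'‖ := by
      have h3 := abs_norm_sub_norm_le w' w
      rw [norm_sub_rev w' w, hn, hn'] at h3
      rw [norm_smul, hn', Real.norm_eq_abs]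
      have h4 : |(|e l| - |e' l|)| * |e' l|⁻¹ = |e l| * |(|e' l|⁻¹ - |e l|⁻¹)| := by
        rw [← abs_of_pos (inv_pos.2 hpos'), ← abs_mul, ← abs_of_pos hpos, ← abs_mul]
        simp only [abs_abs, abs_inv]
        congr 1
        field_simp
      rw [h4]
      nlinarith [abs_nonneg (|e' l|⁻¹ - |e l|⁻¹)]
    have h5 : ‖|e l| • (w - w')‖ ≤ ‖w - w'‖ := by
      rw [norm_smul, Real.norm_eq_abs, abs_abs]
      nlinarith [norm_nonneg (w - w')]
    rw [h1]
    exact (norm_add_le _ _).trans (by linarith)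
  have hmin : min ‖e - e'‖ ‖e + e'‖ ≤ ‖|e l| • w - |e' l| • w'‖ := by
    have key : ∀ v : E4, v l ≠ 0 → |v l| • (v l)⁻¹ • v = v ∨ |v l| • (v l)⁻¹ • v = -v := by
      intro v hv
      rw [smul_smul]
      rcases abs_cases (v l) with ⟨h, -⟩ | ⟨h, -⟩
      · left; rw [h, mul_inv_cancel₀ hv, one_smul]
      · right; rw [h, neg_mul, mul_inv_cancel₀ hv, neg_one_smul]
    rcases key e h0 with h | h <;> rcases key e' h0' with h' | h' <;> rw [hw, hw', h, h']
    · exact min_le_left _ _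
    · rw [sub_neg_eq_add]; exact min_le_right _ _
    · rw [← neg_add', norm_neg]; exact min_le_right _ _
    · rw [neg_sub_neg, norm_sub_rev]; exact min_le_left _ _
  linarith

end slope

theorem exists_line_of_plane {l : Fin 4} (W : Submodule ℝ E4) (hW : Module.finrank ℝ W = 2)
    {w₀ : E4} (hw₀ : w₀ ∈ W) (hl : w₀ l ≠ 0) :
    ∃ u : V3, u ⬝ᵥ u = 1 ∧ ∀ v ∈ W, v l = 0 → ∃ r : ℝ, hor l v = r • u := by
  let f : W →ₗ[ℝ] ℝ :=
    { toFun := fun v => (v : E4) l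
      map_add' := fun _ _ => rfl
      map_smul' := fun _ _ => rfl }
  have hf : LinearMap.range f = ⊤ := by
    rw [LinearMap.range_eq_top]
    intro c
    refine ⟨(c / w₀ l) • ⟨w₀, hw₀⟩, ?_⟩
    change (c / w₀ l) * w₀ l = c
    field_simp
  have hker : Module.finrank ℝ (LinearMap.ker f) = 1 := by
    have := LinearMap.finrank_range_add_finrank_ker f
    rw [hf, finrank_top, hW, Module.finrank_self] at this
    omega
  obtain ⟨v₀, hv₀, hspan⟩ := finrank_eq_one_iff'.1 hker
  set g : V3 := hor l ((v₀ : W) : E4) with hg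
  have hg0 : g ≠ 0 := by
    intro h
    apply hv₀
    have h1 : ((v₀ : W) : E4) l = 0 := v₀.2
    have h2 := norm_le_two_mul_hor h1
    rw [← hg, h, norm_zero, mul_zero, norm_le_zero_iff] at h2
    exact Subtype.ext (Subtype.ext h2)
  have hgg : 0 < g ⬝ᵥ g :=
    lt_of_lt_of_le (by have := norm_pos_iff.2 hg0; positivity) (norm_sq_le_dotProduct_self g)
  refine ⟨(√(g ⬝ᵥ g))⁻¹ • g, ?_, ?_⟩
  · rw [smul_dotProduct, dotProduct_smul, smul_eq_mul, smul_eq_mul, ← mul_assoc, ← mul_inv,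
      Real.mul_self_sqrt hgg.le, inv_mul_cancel₀ hgg.ne']
  · intro v hv hvl
    obtain ⟨c, hc⟩ := hspan ⟨⟨v, hv⟩, hvl⟩
    refine ⟨c * √(g ⬝ᵥ g), ?_⟩
    rw [smul_smul, mul_assoc, mul_inv_cancel₀ (Real.sqrt_pos.2 hgg).ne', mul_one, hg, ← hor_smul]
    have := congrArg (fun v : LinearMap.ker f => ((v : W) : E4)) hc
    rw [show c • ((v₀ : W) : E4) = v from this]

/-- Unit vectors near a common plane have slopes near a common line. -/
theorem exists_line_of_near_plane {ι : Type*} {l : Fin 4} {η : ℝ} (hη : η ≤ 1 / 4)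
    (W : Submodule ℝ E4) (hW : Module.finrank ℝ W = 2) (S : Set ι) (e : ι → E4)
    (he : ∀ i ∈ S, ‖e i‖ = 1) (hl : ∀ i ∈ S, 1 / 2 ≤ |e i l|)
    (hnear : ∀ i ∈ S, ∃ w ∈ W, ‖e i - w‖ ≤ η) :
    ∃ u : V3, u ⬝ᵥ u = 1 ∧
      ∀ i ∈ S, ∀ j ∈ S, ∃ r : ℝ, ‖slope l (e i) - slope l (e j) - r • u‖ ≤ 8 * η := by
  rcases S.eq_empty_or_nonempty with rfl | ⟨i₀, hi₀⟩
  · exact ⟨Pi.single 0 1, by simp, by simp⟩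
  have hη0 : 0 ≤ η := by
    obtain ⟨w, -, h⟩ := hnear i₀ hi₀
    exact (norm_nonneg _).trans h
  have hnear' : ∀ i ∈ S, ∃ w ∈ W, w l ≠ 0 ∧ ‖slope l (e i) - slope l w‖ ≤ 4 * η := by
    intro i hi
    obtain ⟨w, hw, hd⟩ := hnear i hi
    have h1 : |e i l - w l| ≤ η := (norm_apply_le (e i - w) l).trans hd
    have h2 := hl i hi
    have h3 : 1 / 4 ≤ |w l| := by
      have := abs_sub_abs_le_abs_sub (e i l) (w l)
      linarith
    have h4 : w l ≠ 0 := by rintro h; rw [h] at h3; norm_num at h3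
    have h5 : e i l ≠ 0 := by rintro h; rw [h] at h2; norm_num at h2
    refine ⟨w, hw, h4, ?_⟩
    have h6 : slope l (e i) - slope l w =
        (4 * e i l * w l)⁻¹ • (e i l • hor l (e i - w) - (e i l - w l) • hor l (e i)) := by
      have h7 : (4 * e i l)⁻¹ = (4 * e i l * w l)⁻¹ * w l := by field_simp
      have h8 : (4 * w l)⁻¹ = (4 * e i l * w l)⁻¹ * e i l := by field_simp
      unfold slope
      rw [h7, h8, hor_sub]
      module
    rw [h6, norm_smul, norm_inv, norm_mul, norm_mul, Real.norm_eq_abs, Real.norm_eq_abs,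
      Real.norm_eq_abs, inv_mul_le_iff₀ (by positivity)]
    have h9 : ‖e i l • hor l (e i - w) - (e i l - w l) • hor l (e i)‖ ≤ |e i l| * η + η * 1 := by
      refine (norm_sub_le _ _).trans ?_
      rw [norm_smul, norm_smul, Real.norm_eq_abs, Real.norm_eq_abs]
      gcongr
      · exact (norm_hor_le _).trans hd
      · exact (norm_hor_le _).trans (he i hi).le
    refine h9.trans ?_
    norm_num
    nlinarith [mul_le_mul_of_nonneg_left h3 (abs_nonneg (e i l))]
  obtain ⟨w₀, hw₀, hl₀, -⟩ := hnear' i₀ hi₀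
  obtain ⟨u, hu, hspan⟩ := exists_line_of_plane W hW hw₀ hl₀
  refine ⟨u, hu, fun i hi j hj => ?_⟩
  obtain ⟨w, hw, hwl, hd⟩ := hnear' i hi
  obtain ⟨w', hw', hwl', hd'⟩ := hnear' j hj
  obtain ⟨r, hr⟩ := hspan ((4 * w l)⁻¹ • w - (4 * w' l)⁻¹ • w')
    (W.sub_mem (W.smul_mem _ hw) (W.smul_mem _ hw')) (by
      have h1 : (4 * w l)⁻¹ * w l = 1 / 4 := by field_simp
      have h2 : (4 * w' l)⁻¹ * w' l = 1 / 4 := by field_simp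
      simp only [PiLp.sub_apply, PiLp.smul_apply, smul_eq_mul, h1, h2, sub_self])
  refine ⟨r, ?_⟩
  rw [hor_sub, hor_smul, hor_smul] at hr
  have : slope l (e i) - slope l (e j) - r • u =
      (slope l (e i) - slope l w) - (slope l (e j) - slope l w') := by
    rw [← hr]
    unfold slope
    abel
  rw [this]
  exact (norm_sub_le _ _).trans (by linarith)

end Planebrush

namespace Planebrush

open Matrix Finset

theorem exists_direction_near {δ ρ : ℝ} (hρ : 0 < ρ) {x e : E4} {H : AffineSubspace ℝ E4}
    (h : tube δ x e ⊆ cthickening ρ (H : Set E4)) : ∃ w ∈ H.direction, ‖e - w‖ ≤ 4 * ρ := by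
  have key : ∀ y ∈ segment ℝ x (x + e), ∃ z ∈ H, dist y z < 2 * ρ := by
    intro y hy
    have h1 := cthickening_subset_thickening' (δ₁ := ρ) (δ₂ := 2 * ρ) (by linarith) (by linarith)
      (H : Set E4) (h (self_subset_cthickening _ hy))
    exact mem_thickening_iff.1 h1
  obtain ⟨z, hz, hd⟩ := key x (left_mem_segment ℝ _ _)
  obtain ⟨z', hz', hd'⟩ := key (x + e) (right_mem_segment ℝ _ _)
  refine ⟨z' - z, AffineSubspace.vsub_mem_direction hz' hz, ?_⟩
  rw [dist_eq_norm] at hd hd'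
  have : e - (z' - z) = (x + e - z') - (x - z) := by abel
  rw [this]
  exact (norm_sub_le _ _).trans (by linarith)

theorem pointAt_mem_segment {l : Fin 4} {x e : E4} {z : ℝ}
    (h : (z - x l) / e l ∈ Set.Icc (0 : ℝ) 1) : pointAt l x e z ∈ segment ℝ x (x + e) := by
  rw [segment_eq_image']
  exact ⟨_, h, by simp [pointAt]⟩

/-- Tubes that cross a common slab transversally contain many separated points. -/
theorem exists_points_of_slab {K : ℝ} (hK : 1 ≤ K) {J : ℕ} (hJ : 20 ≤ J) :
    ∃ C : ℝ, 0 < C ∧ ∀ {ι : Type} {δ : ℝ} {x e : ι → E4} {l : Fin 4} {T : Finset ι} {z : ℝ},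
      0 < δ → K * δ ≤ 1 / 16 → (∀ i, ‖e i‖ = 1) →
      (∀ i j, i ≠ j → δ ≤ min ‖e i - e j‖ ‖e i + e j‖) →
      (∀ y ∈ ⋃ i, tube δ (x i) (e i), ∃ H : AffineSubspace ℝ E4, (H : Set E4).Nonempty ∧
        Module.finrank ℝ H.direction = 2 ∧
          ∀ i, y ∈ tube δ (x i) (e i) → tube δ (x i) (e i) ⊆ cthickening (K * δ) (H : Set E4)) →
      (∀ i ∈ T, 1 / 2 ≤ |e i l|) →
      (∀ i ∈ T, ∀ t ∈ Set.Icc (0 : ℝ) 1, (z + t / 4 - x i l) / e i l ∈ Set.Icc (0 : ℝ) 1) →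
      ∃ P ⊆ T ×ˢ range ⌈16 / δ⌉₊,
        (∀ q ∈ P, ∀ q' ∈ P, q ≠ q' → q.2 = q'.2 → δ / 16 ≤
          ‖hor l (pointAt l (x q.1) (e q.1) (z + (q.2 / ⌈16 / δ⌉₊ : ℝ) / 4)) -
            hor l (pointAt l (x q'.1) (e q'.1) (z + (q'.2 / ⌈16 / δ⌉₊ : ℝ) / 4))‖) ∧
        ⌈16 / δ⌉₊ * #T ≤ C * (δ / 16) ^ (-(2 / 3 + 56 / 3 / (J : ℝ))) * #P := by
  classical
  obtain ⟨C, hC, main⟩ := exists_card_lower_bound (K := 512 * K) (by linarith) hJ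
  refine ⟨C, hC, ?_⟩
  intro ι δ x e l T z hδ hKδ he hsep hplane hl hz
  have hδ16 : δ ≤ 1 / 16 := by nlinarith
  set M : ℕ := ⌈16 / δ⌉₊ with hM
  have hMδ : 16 / δ ≤ M := Nat.le_ceil _
  have hM0 : (0 : ℝ) < M := lt_of_lt_of_le (by positivity) hMδ
  set Y : ι → ℕ → E4 := fun i k => pointAt l (x i) (e i) (z + (k / M : ℝ) / 4) with hY
  have he0 : ∀ i ∈ T, e i l ≠ 0 := fun i hi h => by
    have := hl i hi
    rw [h] at this
    norm_num at this
  have hYseg : ∀ i ∈ T, ∀ k < M, Y i k ∈ segment ℝ (x i) (x i + e i) := by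
    intro i hi k hk
    refine pointAt_mem_segment (hz i hi _ ⟨by positivity, ?_⟩)
    rw [div_le_one hM0]
    exact_mod_cast hk.le
  choose S hST hSsep hScov using fun k : ℕ =>
    exists_separated_cover T (fun i => hor l (Y i k)) (δ / 16)
  set P : Finset (ι × ℕ) := {q ∈ T ×ˢ range M | q.1 ∈ S q.2} with hP
  set I : ι × ℕ → Finset ι := fun q => {j ∈ T | dist (hor l (Y q.1 q.2)) (hor l (Y j q.2)) ≤ δ / 16}
    with hI
  have hmax : max (δ / 16) 0 = δ / 16 := max_eq_left (by positivity)
  have hPmem : ∀ q ∈ P, q.1 ∈ T ∧ q.2 < M ∧ q.1 ∈ S q.2 := by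
    intro q hq
    simpa [hP, and_assoc] using hq
  have hcount : M * #T ≤ ∑ q ∈ P, #(I q) := by
    have h1 : T ×ˢ range M ⊆ P.biUnion fun q => I q ×ˢ {q.2} := by
      rintro ⟨j, k⟩ hjk
      obtain ⟨hj, hk⟩ := mem_product.1 hjk
      obtain ⟨i, hi, hd⟩ := hScov k j hj
      rw [hmax] at hd
      refine mem_biUnion.2 ⟨(i, k), mem_filter.2 ⟨mem_product.2 ⟨hST k hi, hk⟩, hi⟩, ?_⟩
      exact mem_product.2 ⟨mem_filter.2 ⟨hj, hd⟩, mem_singleton_self _⟩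
    have h2 := (card_le_card h1).trans card_biUnion_le
    simpa [mul_comm] using h2
  have hu : ∀ q : ι × ℕ, ∃ u : V3, u ⬝ᵥ u = 1 ∧ (q ∈ P → ∀ i ∈ I q, ∀ j ∈ I q,
      ∃ r : ℝ, ‖slope l (e i) - slope l (e j) - r • u‖ ≤ 512 * K * (δ / 16)) := by
    intro q
    by_cases hq : q ∈ P
    swap
    · exact ⟨Pi.single 0 1, by simp, fun h => absurd h hq⟩
    obtain ⟨hqT, hqM, hqS⟩ := hPmem q hq
    have hmem : ∀ j ∈ I q, Y q.1 q.2 ∈ tube δ (x j) (e j) := by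
      intro j hj
      obtain ⟨hjT, hd⟩ := mem_filter.1 hj
      refine mem_cthickening_of_dist_le _ _ _ _ (hYseg j hjT q.2 hqM) ?_
      have h0 : (Y q.1 q.2 - Y j q.2) l = 0 := by
        rw [PiLp.sub_apply, hY]
        simp only
        rw [pointAt_apply (he0 _ hqT), pointAt_apply (he0 _ hjT), sub_self]
      have h1 := norm_le_two_mul_hor h0
      rw [dist_eq_norm, ← hor_sub] at hd
      rw [dist_eq_norm]
      linarith
    have hself : q.1 ∈ I q := mem_filter.2 ⟨hqT, by rw [dist_self]; positivity⟩
    obtain ⟨H, -, hdim, hH⟩ := hplane (Y q.1 q.2) (Set.mem_iUnion.2 ⟨q.1, hmem _ hself⟩)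
    obtain ⟨u, hu1, hu2⟩ := exists_line_of_near_plane (l := l) (η := 4 * (K * δ)) (by linarith)
      H.direction hdim (I q : Set ι) e (fun i _ => he i)
      (fun i hi => hl i (mem_filter.1 hi).1)
      (fun i hi => exists_direction_near (by positivity) (hH i (hmem i hi)))
    refine ⟨u, hu1, fun _ i hi j hj => ?_⟩
    obtain ⟨r, hr⟩ := hu2 i hi j hj
    exact ⟨r, hr.trans (by linarith)⟩
  choose u hu1 hu2 using hu
  have hPsep : ∀ q ∈ P, ∀ q' ∈ P, q ≠ q' → q.2 = q'.2 →
      δ / 16 ≤ ‖hor l (Y q.1 q.2) - hor l (Y q'.1 q'.2)‖ := by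
    rintro ⟨i, k⟩ hq ⟨j, k'⟩ hq' hne hk
    obtain rfl : k = k' := hk
    rw [← dist_eq_norm]
    exact hSsep k i (hPmem _ hq).2.2 j (hPmem _ hq').2.2 fun h => hne (by rw [h])
  refine ⟨P, filter_subset _ _, hPsep, ?_⟩
  refine main (δ := δ / 16) (a := fun i => hor l (pointAt l (x i) (e i) z))
    (b := fun i => slope l (e i)) (k := Prod.snd) (p := fun q => hor l (Y q.1 q.2)) (I := I)
    (u := u) (by positivity) (by linarith) (fun q _ => filter_subset _ _) hcount ?_
  intro m P' I' hP' hI'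
  refine ⟨by linarith, by positivity, by linarith, ?_, ?_, ?_, ?_, ?_, ?_, ?_, ?_, hu1, ?_⟩
  · calc (1 : ℝ) = 16 / δ * (δ / 16) := by field_simp
      _ ≤ M * (δ / 16) := by gcongr
  · exact fun i hi j hj hij => le_norm_slope_sub (he i) (he j) (hl i hi) (hl j hj) (hsep i j hij)
  · exact fun i hi => norm_slope_le (he i) (hl i hi)
  · exact fun q hq q' hq' => hPsep q (hP' hq) q' (hP' hq')
  · exact fun q hq => (hPmem q (hP' hq)).2.1
  · exact fun q hq => (hI' q hq).1.trans (filter_subset _ _)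
  · exact fun q hq => (hI' q hq).2
  · intro q hq i hi
    obtain ⟨-, hd⟩ := mem_filter.1 ((hI' q hq).1 hi)
    have h1 : hor l (Y i q.2) = hor l (pointAt l (x i) (e i) z) +
        time Prod.snd M q • slope l (e i) := hor_pointAt _ _
    rw [sub_sub, ← h1, ← dist_eq_norm]
    refine hd.trans ?_
    nlinarith
  · intro q hq i hi j hj
    exact hu2 q (hP' hq) i ((hI' q hq).1 hi) j ((hI' q hq).1 hj)

end Planebrush

namespace Planebrush

open Matrix Finset

theorem exists_level {l : Fin 4} {x e : E4} (hl : 1 / 2 ≤ |e l|) :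
    ∃ h : ℤ, ∀ t ∈ Set.Icc (0 : ℝ) 1, ((h / 4 : ℝ) + t / 4 - x l) / e l ∈ Set.Icc (0 : ℝ) 1 := by
  rcases le_total 0 (e l) with h0 | h0
  · rw [abs_of_nonneg h0] at hl
    refine ⟨⌈4 * x l⌉, fun t ht => ?_⟩
    have h1 := Int.le_ceil (4 * x l)
    have h2 := Int.ceil_lt_add_one (4 * x l)
    constructor
    · exact div_nonneg (by linarith [ht.1]) h0
    · rw [div_le_one (by linarith)]
      linarith [ht.2]
  · rw [abs_of_nonpos h0] at hl
    refine ⟨⌈4 * (x l + e l)⌉, fun t ht => ?_⟩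
    have h1 := Int.le_ceil (4 * (x l + e l))
    have h2 := Int.ceil_lt_add_one (4 * (x l + e l))
    constructor
    · exact div_nonneg_of_nonpos (by linarith [ht.2]) h0
    · rw [div_le_one_of_neg (by linarith)]
      linarith [ht.1]

theorem exists_half_le_abs_apply {e : E4} (he : ‖e‖ = 1) : ∃ l, 1 / 2 ≤ |e l| := by
  by_contra! h
  have h1 := EuclideanSpace.real_norm_sq_eq e
  have h2 : ∀ l, e l ^ 2 < 1 / 4 := fun l => by
    have := sq_lt_sq.2 ((h l).trans_le (le_abs_self _))
    linarith
  rw [he, Fin.sum_univ_four] at h1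
  linarith [h2 0, h2 1, h2 2, h2 3]

theorem one_le_mul_abs_sub_of_lex {h h' : ℤ} {k k' M : ℕ} (hk : k < M) (hk' : k' < M)
    (hne : h = h' → k ≠ k') :
    1 ≤ 4 * (M : ℝ) * |(h / 4 + (k / M : ℝ) / 4) - (h' / 4 + (k' / M : ℝ) / 4 : ℝ)| := by
  have hM : (0 : ℝ) < M := by exact_mod_cast (Nat.zero_le k).trans_lt hk
  have key : h * M + k - (h' * M + k') ≠ 0 := by
    intro heq
    have hh : h = h' := by
      have hM' : (0 : ℤ) < M := by omega
      rcases lt_trichotomy h h' with hlt | heq' | hgt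
      · nlinarith
      · exact heq'
      · nlinarith
    subst hh
    exact hne rfl (by omega)
  have h1 : (1 : ℝ) ≤ |((h * M + k - (h' * M + k') : ℤ) : ℝ)| := by
    exact_mod_cast Int.one_le_abs key
  have h2 : 4 * (M : ℝ) * |(h / 4 + (k / M : ℝ) / 4) - (h' / 4 + (k' / M : ℝ) / 4 : ℝ)| =
      |((h * M + k - (h' * M + k') : ℤ) : ℝ)| := by
    rw [← abs_of_pos (by positivity : 0 < 4 * (M : ℝ)), ← abs_mul]
    congr 1
    push_cast
    field_simp
  rw [h2]
  exact h1

theorem card_mul_volume_ball_le {α : Type*} (P : Finset α) (Y : α → E4) {r : ℝ} (hr : 0 ≤ r)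
    (hsep : ∀ q ∈ P, ∀ q' ∈ P, q ≠ q' → 2 * r ≤ dist (Y q) (Y q')) {E : Set E4}
    (hE : Bornology.IsBounded E) (hball : ∀ q ∈ P, ball (Y q) r ⊆ E) :
    #P * r ^ 4 * (volume (ball (0 : E4) 1)).toReal ≤ (volume E).toReal := by
  have h1 : volume (⋃ q ∈ P, ball (Y q) r) = ∑ q ∈ P, volume (ball (Y q) r) := by
    refine measure_biUnion_finset (fun q hq q' hq' hne => ?_) fun _ _ => measurableSet_ball
    exact ball_disjoint_ball (by linarith [hsep q hq q' hq' hne])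
  have h2 : volume (⋃ q ∈ P, ball (Y q) r) ≤ volume E :=
    measure_mono (Set.iUnion₂_subset hball)
  have h3 := ENNReal.toReal_mono hE.measure_lt_top.ne h2
  rw [h1] at h3
  refine le_trans (le_of_eq ?_) h3
  simp only [Measure.addHaar_ball _ _ hr]
  rw [sum_const, nsmul_eq_mul, ENNReal.toReal_mul, ENNReal.toReal_mul, ENNReal.toReal_natCast,
    ENNReal.toReal_ofReal (by positivity), finrank_euclideanSpace_fin]
  ring

theorem isBounded_tube (δ : ℝ) (x e : E4) : Bornology.IsBounded (tube δ x e) := by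
  have : Bornology.IsBounded (segment ℝ x (x + e)) := by
    rw [segment_eq_image']
    exact (isCompact_Icc.image (by fun_prop)).isBounded
  exact this.cthickening

theorem ball_subset_tube {δ r : ℝ} {x e y : E4} (hr : r ≤ δ) (hy : y ∈ segment ℝ x (x + e)) :
    ball y r ⊆ tube δ x e := fun v hv =>
  mem_cthickening_of_dist_le v y _ _ hy ((mem_ball.1 hv).le.trans hr)

theorem volume_lower_bound {K : ℝ} (hK : 1 ≤ K) {J : ℕ} (hJ : 20 ≤ J) :
    ∃ c : ℝ, 0 < c ∧ ∀ {N : ℕ} {δ : ℝ} {x e : Fin N → E4},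
      0 < δ → K * δ ≤ 1 / 16 → (∀ i, ‖e i‖ = 1) →
      (∀ i j, i ≠ j → δ ≤ min ‖e i - e j‖ ‖e i + e j‖) →
      (∀ y ∈ ⋃ i, tube δ (x i) (e i), ∃ H : AffineSubspace ℝ E4, (H : Set E4).Nonempty ∧
        Module.finrank ℝ H.direction = 2 ∧
          ∀ i, y ∈ tube δ (x i) (e i) → tube δ (x i) (e i) ⊆ cthickening (K * δ) (H : Set E4)) →
      c * (N * δ ^ 3) * δ ^ (2 / 3 + 56 / 3 / (J : ℝ)) ≤
        (volume (⋃ i, tube δ (x i) (e i))).toReal := by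
  classical
  obtain ⟨C, hC, main⟩ := exists_points_of_slab hK hJ
  set β : ℝ := 2 / 3 + 56 / 3 / (J : ℝ) with hβ
  set v : ℝ := (volume (ball (0 : E4) 1)).toReal with hv
  have hv0 : 0 < v :=
    ENNReal.toReal_pos (measure_ball_pos volume _ one_pos).ne' measure_ball_lt_top.ne
  refine ⟨4 * v / (C * 256 ^ 4 * 16 ^ β), by positivity, ?_⟩
  intro N δ x e hδ hKδ he hsep hplane
  have hδ16 : δ ≤ 1 / 16 := by nlinarith
  choose c hc using fun i => exists_half_le_abs_apply (he i)
  obtain ⟨l, hlN⟩ : ∃ l, (N : ℝ) ≤ 4 * #{i | c i = l} := by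
    by_contra! h
    have h1 : N = ∑ l, #{i | c i = l} := by
      have := card_eq_sum_card_fiberwise (f := c) (s := univ) (t := univ) (by simp)
      rwa [card_univ, Fintype.card_fin] at this
    have h2 : (N : ℝ) = ∑ l, (#{i | c i = l} : ℝ) := by exact_mod_cast h1
    rw [Fin.sum_univ_four] at h2
    linarith [h 0, h 1, h 2, h 3]
  set G : Finset (Fin N) := {i | c i = l} with hG
  have hGl : ∀ i ∈ G, 1 / 2 ≤ |e i l| := by
    intro i hi
    rw [← (mem_filter.1 hi).2]
    exact hc i
  have hlev : ∀ i, ∃ h : ℤ, i ∈ G → ∀ t ∈ Set.Icc (0 : ℝ) 1,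
      ((h / 4 : ℝ) + t / 4 - x i l) / e i l ∈ Set.Icc (0 : ℝ) 1 := by
    intro i
    by_cases hi : i ∈ G
    · obtain ⟨h, hh⟩ := exists_level (x := x i) (hGl i hi)
      exact ⟨h, fun _ => hh⟩
    · exact ⟨0, fun h => absurd h hi⟩
  choose lev hlev using hlev
  set M : ℕ := ⌈16 / δ⌉₊ with hM
  have hMδ : 16 / δ ≤ M := Nat.le_ceil _
  have hM0 : (0 : ℝ) < M := lt_of_lt_of_le (by positivity) hMδ
  have hMδ' : (M : ℝ) ≤ 32 / δ := by
    have h1 := Nat.ceil_lt_add_one (by positivity : 0 ≤ 16 / δ)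
    have h2 : 1 ≤ 16 / δ := by rw [le_div_iff₀ hδ]; linarith
    have h3 : 32 / δ = 16 / δ + 16 / δ := by ring
    linarith
  choose Q hQsub hQsep hQcard using fun h : ℤ => main (T := {i ∈ G | lev i = h}) (z := (h / 4 : ℝ))
    (l := l) hδ hKδ he hsep hplane (fun i hi => hGl i (mem_filter.1 hi).1) (fun i hi => by
      obtain ⟨hi1, hi2⟩ := mem_filter.1 hi
      rw [← hi2]
      exact hlev i hi1)
  have hQmem : ∀ h, ∀ q ∈ Q h, q.1 ∈ G ∧ lev q.1 = h ∧ q.2 < M := by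
    intro h q hq
    have := mem_product.1 (hQsub h hq)
    exact ⟨(mem_filter.1 this.1).1, (mem_filter.1 this.1).2, mem_range.1 this.2⟩
  set P : Finset (Fin N × ℕ) := (G.image lev).biUnion Q with hP
  set Y : Fin N × ℕ → E4 := fun q =>
    pointAt l (x q.1) (e q.1) ((lev q.1 / 4 : ℝ) + (q.2 / M : ℝ) / 4) with hY
  have hPmem : ∀ q ∈ P, q.1 ∈ G ∧ q.2 < M ∧ q ∈ Q (lev q.1) := by
    intro q hq
    obtain ⟨h, -, hq⟩ := mem_biUnion.1 hq
    obtain ⟨h1, h2, h3⟩ := hQmem h q hq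
    exact ⟨h1, h3, h2 ▸ hq⟩
  have hPcard : #P = ∑ h ∈ G.image lev, #(Q h) := by
    refine card_biUnion fun h _ h' _ hne => disjoint_left.2 fun q hq hq' => hne ?_
    rw [← (hQmem h q hq).2.1, (hQmem h' q hq').2.1]
  have hcard : M * #G ≤ C * (δ / 16) ^ (-β) * #P := by
    rw [hPcard, card_eq_sum_card_image lev G]
    push_cast
    rw [mul_sum, mul_sum]
    exact sum_le_sum fun h _ => hQcard h
  have hYsep : ∀ q ∈ P, ∀ q' ∈ P, q ≠ q' → 2 * (δ / 256) ≤ dist (Y q) (Y q') := by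
    intro q hq q' hq' hne
    obtain ⟨hqG, hqM, hqQ⟩ := hPmem q hq
    obtain ⟨hqG', hqM', hqQ'⟩ := hPmem q' hq'
    have he0 : ∀ i ∈ G, e i l ≠ 0 := fun i hi h => by
      have := hGl i hi
      rw [h] at this
      norm_num at this
    rw [dist_eq_norm]
    by_cases hsame : lev q.1 = lev q'.1 ∧ q.2 = q'.2
    · rw [← hsame.1] at hqQ'
      have h1 := hQsep _ q hqQ q' hqQ' hne hsame.2
      have h2 := norm_hor_le (l := l) (Y q - Y q')
      rw [hor_sub] at h2
      simp only [hY] at h2 ⊢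
      rw [← hsame.1] at h2 ⊢
      linarith
    · have h1 := one_le_mul_abs_sub_of_lex hqM hqM' fun h h' => hsame ⟨h, h'⟩
      have h2 := norm_apply_le (Y q - Y q') l
      rw [PiLp.sub_apply] at h2
      simp only [hY] at h2 ⊢
      rw [pointAt_apply (he0 _ hqG), pointAt_apply (he0 _ hqG')] at h2
      have h3 := h1.trans (mul_le_mul_of_nonneg_left h2 (by positivity))
      have h4 := h3.trans (mul_le_mul_of_nonneg_right (mul_le_mul_of_nonneg_left hMδ'
        (by norm_num : (0 : ℝ) ≤ 4)) (norm_nonneg _))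
      have h5 : 4 * (32 / δ) = 128 / δ := by ring
      rw [h5, div_mul_eq_mul_div, le_div_iff₀ hδ] at h4
      linarith
  have hYball : ∀ q ∈ P, ball (Y q) (δ / 256) ⊆ ⋃ i, tube δ (x i) (e i) := by
    intro q hq
    obtain ⟨hqG, hqM, -⟩ := hPmem q hq
    refine (ball_subset_tube (by linarith) (pointAt_mem_segment (hlev q.1 hqG _
      ⟨by positivity, ?_⟩))).trans (Set.subset_iUnion (fun i => tube δ (x i) (e i)) q.1)
    rw [div_le_one hM0]
    exact_mod_cast hqM.le
  have hvol := card_mul_volume_ball_le P Y (by positivity) hYsep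
    ((Bornology.isBounded_iUnion).2 fun i => isBounded_tube δ (x i) (e i)) hYball
  refine le_trans ?_ hvol
  have h1 : 4 / δ * N ≤ C * (δ / 16) ^ (-β) * #P :=
    calc 4 / δ * N ≤ 4 / δ * (4 * #G) := by gcongr
      _ = 16 / δ * #G := by ring
      _ ≤ M * #G := by gcongr
      _ ≤ _ := hcard
  rw [Real.rpow_neg (by positivity), Real.div_rpow hδ.le (by norm_num), inv_div] at h1
  have hδβ : 0 < δ ^ β := by positivity
  have h2 : 4 / δ * N * (δ ^ β / (C * 16 ^ β)) ≤ #P := by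
    calc _ ≤ C * (16 ^ β / δ ^ β) * #P * (δ ^ β / (C * 16 ^ β)) := by gcongr
      _ = #P := by field_simp
  calc _ = 4 / δ * N * (δ ^ β / (C * 16 ^ β)) * (δ / 256) ^ 4 * v := by field_simp
    _ ≤ #P * (δ / 256) ^ 4 * v := by gcongr

end Planebrush

/-- Katz–Zahl planebrush estimate: a family of `δ`-tubes in `ℝ⁴` pointing in
`δ`-separated directions with `δ^{-3}/K ≤ #𝕋 ≤ Kδ^{-3}`, such that through each point
`y` of the union all tubes containing `y` lie in the `(Kδ)`-neighborhood of a common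
affine 2-plane `H_y`, satisfies `|⋃ T| ≥ C_ε⁻¹ δ^ε δ^{2/3}`. -/
theorem katz_zahl_planebrush (K : ℝ) (hK : 1 ≤ K) :
    ∀ ε : ℝ, 0 < ε → ∃ Cε : ℝ, 0 < Cε ∧
      ∀ δ : ℝ, 0 < δ → δ < 1 →
        ∀ (N : ℕ) (x e : Fin N → EuclideanSpace ℝ (Fin 4)),
          (∀ i, ‖e i‖ = 1) →
          (∀ i j, i ≠ j → δ ≤ min ‖e i - e j‖ ‖e i + e j‖) →
          δ ^ (-3 : ℝ) / K ≤ (N : ℝ) → (N : ℝ) ≤ K * δ ^ (-3 : ℝ) →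
          (∀ y ∈ ⋃ i, tube δ (x i) (e i),
            ∃ H : AffineSubspace ℝ (EuclideanSpace ℝ (Fin 4)),
              (H : Set (EuclideanSpace ℝ (Fin 4))).Nonempty ∧
              Module.finrank ℝ H.direction = 2 ∧
              ∀ i, y ∈ tube δ (x i) (e i) →
                tube δ (x i) (e i) ⊆
                  cthickening (K * δ) (H : Set (EuclideanSpace ℝ (Fin 4)))) →
          Cε⁻¹ * δ ^ ε * δ ^ ((2 : ℝ) / 3) ≤
            (volume (⋃ i, tube δ (x i) (e i))).toReal := by
  intro ε hε
  obtain ⟨J, hJ⟩ := exists_nat_ge (max 20 (56 / 3 / ε))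
  have hJ20 : 20 ≤ J := by exact_mod_cast (le_max_left _ _).trans hJ
  have hJε : 56 / 3 / (J : ℝ) ≤ ε := by
    have h1 := (le_max_right _ _).trans hJ
    rw [div_le_iff₀ hε] at h1
    rw [div_le_iff₀ (by positivity)]
    linarith
  have hK0 : 0 < K := by linarith
  obtain ⟨c, hc, main⟩ := Planebrush.volume_lower_bound hK hJ20
  set v : ℝ := (volume (ball (0 : Planebrush.E4) 1)).toReal with hv
  have hv0 : 0 < v :=
    ENNReal.toReal_pos (measure_ball_pos volume _ one_pos).ne' measure_ball_lt_top.ne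
  set c' : ℝ := min (c / K) ((1 / (16 * K)) ^ 4 * v) with hc'
  have hc'0 : 0 < c' := by positivity
  refine ⟨c'⁻¹, by positivity, ?_⟩
  intro δ hδ hδ1 N x e he hsep hN _ hplane
  rw [inv_inv, mul_assoc, ← Real.rpow_add hδ]
  have hδ3 : δ ^ (-3 : ℝ) = (δ ^ 3)⁻¹ := by
    rw [Real.rpow_neg hδ.le]
    norm_cast
  rw [hδ3] at hN
  rcases le_or_gt (K * δ) (1 / 16) with hsmall | hlarge
  · refine le_trans ?_ (main hδ hsmall he hsep hplane)
    have h1 : 1 / K ≤ N * δ ^ 3 := by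
      calc 1 / K = (δ ^ 3)⁻¹ / K * δ ^ 3 := by field_simp
        _ ≤ _ := by gcongr
    have h2 : δ ^ (ε + 2 / 3) ≤ δ ^ (2 / 3 + 56 / 3 / (J : ℝ)) :=
      Real.rpow_le_rpow_of_exponent_ge hδ hδ1.le (by linarith)
    have h3 : c' ≤ c * (N * δ ^ 3) := by
      calc c' ≤ c / K := min_le_left _ _
        _ = c * (1 / K) := by ring
        _ ≤ _ := by gcongr
    exact mul_le_mul h3 h2 (by positivity) (by positivity)
  · have hNpos : 0 < N := by
      have : (0 : ℝ) < N := lt_of_lt_of_le (by positivity) hN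
      exact_mod_cast this
    have h1 := Planebrush.card_mul_volume_ball_le {(⟨0, hNpos⟩ : Fin N)} x hδ.le (by simp)
      ((Bornology.isBounded_iUnion).2 fun i => Planebrush.isBounded_tube δ (x i) (e i)) (fun i _ =>
        (Planebrush.ball_subset_tube le_rfl (left_mem_segment ℝ _ _)).trans
          (Set.subset_iUnion (fun i => tube δ (x i) (e i)) i))
    rw [Finset.card_singleton, Nat.cast_one, one_mul] at h1
    refine le_trans ?_ h1
    have h2 : δ ^ (ε + 2 / 3) ≤ 1 := Real.rpow_le_one hδ.le hδ1.le (by positivity)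
    have h3 : 1 / (16 * K) ≤ δ := by
      rw [div_le_iff₀ (by positivity)]
      linarith
    calc c' * δ ^ (ε + 2 / 3) ≤ c' * 1 := by gcongr
      _ = c' := mul_one _
      _ ≤ (1 / (16 * K)) ^ 4 * v := min_le_right _ _
      _ ≤ δ ^ 4 * v := by gcongr
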